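/- Let n ≥ 1, γ > −1/2, and suppose (P_{k,j})_{k≥0, 1≤j≤N_k} is a family of real algebraic polynomials on 𝔹^n such that deg P_{k,j} ≤ k, the family is orthonormal in L²(𝔹^n, μ), the polynomials {P_{k,j} : k ≤ m, 1 ≤ j ≤ N_k} span all polynomials of degree ≤ m for every m, and L P_{k,j} = −λ_k P_{k,j} on 𝔹^n for all k, j. Define the heat kernel e^{tL}(x,y) := Σ_{k≥0} e^{−λ_k t} Σ_{j=1}^{N_k} P_{k,j}(x) P_{k,j}(y). Then there exist constants c₁, c₂, c₃, c₄ > 0 such that for all x, y in the closed unit ball and all t > 0: c₁ exp(−ρ(x,y)²/(c₂ t)) / √(V(x,√t) V(y,√t)) ≤ e^{tL}(x,y) ≤ c₃ exp(−ρ(x,y)²/(c₄ t)) / √(V(x,√t) V(y,√t)). -/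

import Mathlib

open MeasureTheory MvPolynomial Real

noncomputable section

/-- The weighted measure `μ` on the open unit ball `𝔹^n ⊂ ℝ^n` with density
`(1 - ‖x‖²)^(γ - 1/2)` with respect to Lebesgue measure. -/
def ballMeasure (n : ℕ) (γ : ℝ) : Measure (Fin n → ℝ) :=
  (volume.restrict {x : Fin n → ℝ | (∑ i, (x i) ^ 2) < 1}).withDensity
    fun x => ENNReal.ofReal ((1 - ∑ i, (x i) ^ 2) ^ (γ - 1 / 2))

/-- The distance `ρ(x,y) = arccos(x·y + √(1-‖x‖²)√(1-‖y‖²))` on the closed unit ball. -/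
def ballDist (n : ℕ) (x y : Fin n → ℝ) : ℝ :=
  Real.arccos ((∑ i, x i * y i) +
    Real.sqrt (1 - ∑ i, (x i) ^ 2) * Real.sqrt (1 - ∑ i, (y i) ^ 2))

/-- `V(x,r) = μ(B(x,r))`, the weighted volume of the ball `B(x,r) = {y : ρ(x,y) < r}`. -/
def ballVol (n : ℕ) (γ : ℝ) (x : Fin n → ℝ) (r : ℝ) : ℝ :=
  (ballMeasure n γ {y | ballDist n x y < r}).toReal

/-- The differential operator
`L f = Σ_i ∂_i² f − Σ_{i,j} x_i x_j ∂_i ∂_j f − (n + 2γ) Σ_i x_i ∂_i f`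
acting on polynomials. -/
def ballOp (n : ℕ) (γ : ℝ) (f : MvPolynomial (Fin n) ℝ) : MvPolynomial (Fin n) ℝ :=
  (∑ i, pderiv i (pderiv i f))
    - (∑ i, ∑ j, X i * X j * pderiv i (pderiv j f))
    - C ((n : ℝ) + 2 * γ) * ∑ i, X i * pderiv i f

/-- The eigenvalues `λ_k = k(k + n + 2γ − 1)`. -/
def ballEig (n : ℕ) (γ : ℝ) (k : ℕ) : ℝ := k * (k + n + 2 * γ - 1)

/-- `N_k = C(k+n-1, k)` (equal to `1` when `k = 0`). -/
def ballNk (n k : ℕ) : ℕ := (k + n - 1).choose k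

/-- The heat kernel `e^{tL}(x,y) = Σ_k e^{-λ_k t} Σ_j P_{k,j}(x) P_{k,j}(y)`. -/
def ballHeat (n : ℕ) (γ : ℝ) (P : (k : ℕ) → Fin (ballNk n k) → MvPolynomial (Fin n) ℝ)
    (t : ℝ) (x y : Fin n → ℝ) : ℝ :=
  ∑' k : ℕ, Real.exp (-(ballEig n γ k) * t) * ∑ j, eval x (P k j) * eval y (P k j)

section

open Filter Topology Asymptotics

/-- `u` has the second-order Taylor expansion with gradient `g` and Hessian `H` at `x`. -/
def IsJet {n : ℕ} (u : (Fin n → ℝ) → ℝ) (x g : Fin n → ℝ) (H : Fin n → Fin n → ℝ) : Prop :=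
  (fun v : Fin n → ℝ => u (x + v) - u x - ∑ i, g i * v i - (∑ i, ∑ j, H i j * (v i * v j)) / 2)
    =o[𝓝 0] fun v => ‖v‖ ^ 2

lemma isBigO_coord {n : ℕ} (i : Fin n) :
    (fun v : Fin n → ℝ => v i) =O[𝓝 0] fun v => ‖v‖ :=
  IsBigO.of_bound 1 (Eventually.of_forall fun v => by simpa using norm_le_pi_norm v i)

lemma isBigO_linear {n : ℕ} (g : Fin n → ℝ) :
    (fun v : Fin n → ℝ => ∑ i, g i * v i) =O[𝓝 0] fun v => ‖v‖ :=
  IsBigO.fun_sum fun i _ => (isBigO_coord i).const_mul_left _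

lemma isBigO_quadratic {n : ℕ} (H : Fin n → Fin n → ℝ) :
    (fun v : Fin n → ℝ => (∑ i, ∑ j, H i j * (v i * v j)) / 2) =O[𝓝 0] fun v => ‖v‖ ^ 2 := by
  have : (fun v : Fin n → ℝ => ∑ i, ∑ j, H i j * (v i * v j)) =O[𝓝 0] fun v => ‖v‖ ^ 2 := by
    refine IsBigO.fun_sum fun i _ => IsBigO.fun_sum fun j _ => IsBigO.const_mul_left ?_ _
    simpa [sq] using (isBigO_coord i).mul (isBigO_coord j)
  simpa [div_eq_inv_mul] using this.const_mul_left 2⁻¹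

lemma isBigO_norm_sq {n : ℕ} :
    (fun v : Fin n → ℝ => ‖v‖ ^ 2) =O[𝓝 0] fun v => ‖v‖ := by
  refine IsBigO.of_bound 1 ?_
  filter_upwards [Metric.ball_mem_nhds (0 : Fin n → ℝ) one_pos] with v hv
  rw [mem_ball_zero_iff] at hv
  simp only [norm_pow, norm_norm, one_mul]
  nlinarith [norm_nonneg v]

lemma IsJet.add {n : ℕ} {u v : (Fin n → ℝ) → ℝ} {x g g' : Fin n → ℝ} {H H' : Fin n → Fin n → ℝ}
    (hu : IsJet u x g H) (hv : IsJet v x g' H') :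
    IsJet (fun z => u z + v z) x (fun i => g i + g' i) (fun i j => H i j + H' i j) := by
  refine (IsLittleO.add hu hv).congr_left fun w => ?_
  simp only [add_mul, Finset.sum_add_distrib]
  ring

lemma IsJet.const_mul {n : ℕ} {u : (Fin n → ℝ) → ℝ} {x g : Fin n → ℝ} {H : Fin n → Fin n → ℝ}
    (hu : IsJet u x g H) (c : ℝ) :
    IsJet (fun z => c * u z) x (fun i => c * g i) (fun i j => c * H i j) := by
  refine (IsLittleO.const_mul_left hu c).congr_left fun w => ?_
  simp only [mul_assoc, ← Finset.mul_sum]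
  ring

lemma IsJet.const {n : ℕ} (c : ℝ) (x : Fin n → ℝ) : IsJet (fun _ => c) x 0 0 := by
  refine (isLittleO_zero _ _).congr_left fun w => ?_
  simp

lemma IsJet.coord {n : ℕ} (i : Fin n) (x : Fin n → ℝ) :
    IsJet (fun z => z i) x (Pi.single i 1) 0 := by
  refine (isLittleO_zero _ _).congr_left fun w => ?_
  simp [Pi.single_apply]

/-- Chain rule for second-order expansions. -/
lemma IsJet.comp {n : ℕ} {u : (Fin n → ℝ) → ℝ} {x g : Fin n → ℝ} {H : Fin n → Fin n → ℝ}
    (hu : IsJet u x g H) {f : ℝ → ℝ} {f₁ f₂ : ℝ}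
    (hf : (fun d => f (u x + d) - f (u x) - f₁ * d - f₂ / 2 * d ^ 2) =o[𝓝 0] fun d => d ^ 2) :
    IsJet (fun z => f (u z)) x (fun i => f₁ * g i)
      (fun i j => f₁ * H i j + f₂ * (g i * g j)) := by
  set ℓ : (Fin n → ℝ) → ℝ := fun v => ∑ i, g i * v i with hℓ
  set q : (Fin n → ℝ) → ℝ := fun v => (∑ i, ∑ j, H i j * (v i * v j)) / 2 with hq
  set d : (Fin n → ℝ) → ℝ := fun v => u (x + v) - u x with hd
  have h1 : (fun v => d v - ℓ v - q v) =o[𝓝 0] fun v => ‖v‖ ^ 2 := hu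
  have h2 : (fun v => d v - ℓ v) =O[𝓝 0] fun v => ‖v‖ ^ 2 :=
    (h1.isBigO.add (isBigO_quadratic H)).congr_left fun v => by ring
  have h3 : d =O[𝓝 0] fun v => ‖v‖ :=
    ((h2.trans isBigO_norm_sq).add (isBigO_linear g)).congr_left fun v => by ring
  have hn : Tendsto (fun v : Fin n → ℝ => ‖v‖) (𝓝 0) (𝓝 0) := by
    simpa using (continuous_norm (E := Fin n → ℝ)).tendsto 0
  have hd0 : Tendsto d (𝓝 0) (𝓝 0) := h3.trans_tendsto hn
  have h4 : (fun v => f (u x + d v) - f (u x) - f₁ * d v - f₂ / 2 * d v ^ 2) =o[𝓝 0]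
      fun v => ‖v‖ ^ 2 := (hf.comp_tendsto hd0).trans_isBigO (h3.pow 2)
  have h5 : (fun v => (d v - ℓ v) * (d v + ℓ v)) =o[𝓝 0] fun v => ‖v‖ ^ 2 := by
    have h6 : (fun v => d v + ℓ v) =o[𝓝 0] fun _ => (1 : ℝ) :=
      (isLittleO_one_iff ℝ).2 ((h3.add (isBigO_linear g)).trans_tendsto hn)
    simpa using h2.mul_isLittleO h6
  refine ((h4.add (h1.const_mul_left f₁)).add (h5.const_mul_left (f₂ / 2))).congr_left fun v => ?_
  have e1 : ∑ i, f₁ * g i * v i = f₁ * ℓ v := by simp only [hℓ, mul_assoc, ← Finset.mul_sum]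
  have e2 : ∑ i, ∑ j, (f₁ * H i j + f₂ * (g i * g j)) * (v i * v j)
      = f₁ * (2 * q v) + f₂ * ℓ v ^ 2 := by
    have : ℓ v ^ 2 = ∑ i, ∑ j, (g i * g j) * (v i * v j) := by
      rw [sq, hℓ, Finset.sum_mul_sum]
      exact Finset.sum_congr rfl fun i _ => Finset.sum_congr rfl fun j _ => by ring
    rw [this, hq]
    simp only [add_mul, Finset.sum_add_distrib, mul_assoc, ← Finset.mul_sum]
    ring
  rw [e1, e2]
  simp only [hd]
  have : u x + (u (x + v) - u x) = u (x + v) := by ring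
  rw [this]
  ring

lemma isLittleO_taylor_two {f f' : ℝ → ℝ} {z f₂ : ℝ}
    (h1 : ∀ᶠ w in 𝓝 z, HasDerivAt f (f' w) w) (h2 : HasDerivAt f' f₂ z) :
    (fun d => f (z + d) - f z - f' z * d - f₂ / 2 * d ^ 2) =o[𝓝 0] fun d => d ^ 2 := by
  rw [isLittleO_iff]
  intro c hc
  have h2' := (hasDerivAt_iff_isLittleO_nhds_zero.1 h2)
  rw [isLittleO_iff] at h2'
  have h1' : ∀ᶠ d in 𝓝 (0 : ℝ), HasDerivAt f (f' (z + d)) (z + d) := by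
    have : Tendsto (fun d : ℝ => z + d) (𝓝 0) (𝓝 z) := by
      have := (continuous_const_add z).tendsto 0
      rwa [add_zero] at this
    exact this.eventually h1
  obtain ⟨r, hr, hball⟩ := Metric.eventually_nhds_iff_ball.1 (h1'.and (h2' hc))
  filter_upwards [Metric.ball_mem_nhds (0 : ℝ) hr] with d hd
  have hsub : ∀ w ∈ Set.uIcc 0 d, |w| ≤ |d| := by
    intro w hw
    rw [Set.mem_uIcc] at hw
    rcases hw with ⟨h, h'⟩ | ⟨h, h'⟩
    · rw [abs_of_nonneg h, abs_of_nonneg (h.trans h')]; exact h'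
    · rw [abs_of_nonpos h', abs_of_nonpos (h.trans h')]; linarith
  have hin : ∀ w ∈ Set.uIcc 0 d, w ∈ Metric.ball (0 : ℝ) r := fun w hw => by
    rw [mem_ball_zero_iff, Real.norm_eq_abs] at hd ⊢
    exact (hsub w hw).trans_lt hd
  have key := (convex_uIcc (0 : ℝ) d).norm_image_sub_le_of_norm_hasDerivWithin_le
    (f := fun w => f (z + w) - f z - f' z * w - f₂ / 2 * w ^ 2)
    (f' := fun w => f' (z + w) - f' z - f₂ * w) (C := c * |d|) (x := 0) (y := d)
    (fun w hw => by
      have := (hball w (hin w hw)).1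
      have h3 : HasDerivAt (fun w => f (z + w)) (f' (z + w)) w := by
        simpa using HasDerivAt.comp_const_add z w this
      have h4 := ((h3.sub_const (f z)).sub ((hasDerivAt_id w).const_mul (f' z))).sub
        (((hasDerivAt_id w).pow 2).const_mul (f₂ / 2))
      refine HasDerivAt.hasDerivWithinAt (h4.congr_deriv ?_)
      simp
      ring)
    (fun w hw => by
      have := (hball w (hin w hw)).2
      simp only [smul_eq_mul, Real.norm_eq_abs] at this ⊢
      rw [mul_comm f₂]
      exact this.trans (mul_le_mul_of_nonneg_left (hsub w hw) hc.le))
    Set.left_mem_uIcc Set.right_mem_uIcc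
  simp only [Real.norm_eq_abs, add_zero, sub_zero, mul_zero, sub_self] at key ⊢
  simp only [ne_eq, OfNat.ofNat_ne_zero, not_false_eq_true, zero_pow, mul_zero, sub_zero] at key
  refine key.trans (le_of_eq ?_)
  rw [abs_pow]; ring

lemma IsJet.sq {n : ℕ} {u : (Fin n → ℝ) → ℝ} {x g : Fin n → ℝ} {H : Fin n → Fin n → ℝ}
    (hu : IsJet u x g H) :
    IsJet (fun z => u z ^ 2) x (fun i => 2 * u x * g i)
      (fun i j => 2 * u x * H i j + 2 * (g i * g j)) := by
  refine hu.comp (f := fun w => w ^ 2) ((isLittleO_zero _ _).congr_left fun d => ?_)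
  ring

lemma IsJet.mul {n : ℕ} {u v : (Fin n → ℝ) → ℝ} {x g g' : Fin n → ℝ} {H H' : Fin n → Fin n → ℝ}
    (hu : IsJet u x g H) (hv : IsJet v x g' H') :
    IsJet (fun z => u z * v z) x (fun i => u x * g' i + v x * g i)
      (fun i j => u x * H' i j + v x * H i j + g i * g' j + g' i * g j) := by
  have h := ((hu.add hv).sq.const_mul (1 / 4)).add
    ((hu.add (hv.const_mul (-1))).sq.const_mul (-1 / 4))
  convert h using 1 <;> funext <;> ring

lemma isJet_eval {n : ℕ} (p : MvPolynomial (Fin n) ℝ) (x : Fin n → ℝ) :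
    IsJet (fun z => eval z p) x (fun i => eval x (pderiv i p))
      (fun i j => eval x (pderiv i (pderiv j p))) := by
  induction p using MvPolynomial.induction_on with
  | C a =>
    convert IsJet.const a x using 1 <;> funext <;> simp
  | add p q hp hq =>
    convert hp.add hq using 1 <;> funext <;> simp
  | mul_X p k hp =>
    convert hp.mul (IsJet.coord k x) using 1
    · funext; simp
    · funext i
      rcases eq_or_ne k i with rfl | h
      · simp [Derivation.leibniz]
      · simp [Derivation.leibniz, pderiv_X_of_ne h, h.symm]
    · funext i j
      rcases eq_or_ne k i with rfl | h
      · rcases eq_or_ne k j with rfl | h'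
        · simp [Derivation.leibniz]; ring
        · simp [Derivation.leibniz, pderiv_X_of_ne h', h'.symm]
      · rcases eq_or_ne k j with rfl | h'
        · simp [Derivation.leibniz, pderiv_X_of_ne h, h.symm]; ring
        · simp [Derivation.leibniz, pderiv_X_of_ne h, pderiv_X_of_ne h', h.symm, h'.symm]

/-- The closed Euclidean unit ball in `Fin n → ℝ`. -/
def cBall (n : ℕ) : Set (Fin n → ℝ) := {x | ∑ i, (x i) ^ 2 ≤ 1}

lemma mem_cBall {n : ℕ} {x : Fin n → ℝ} : x ∈ cBall n ↔ ∑ i, (x i) ^ 2 ≤ 1 := Iff.rfl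

lemma isCompact_cBall (n : ℕ) : IsCompact (cBall n) := by
  refine Metric.isCompact_of_isClosed_isBounded ?_ ?_
  · exact isClosed_le (by fun_prop) continuous_const
  · refine (Metric.isBounded_closedBall (x := (0 : Fin n → ℝ)) (r := 1)).subset fun x hx => ?_
    rw [mem_closedBall_zero_iff, pi_norm_le_iff_of_nonneg zero_le_one]
    intro i
    have h1 : x i ^ 2 ≤ 1 :=
      (Finset.single_le_sum (fun j _ => sq_nonneg (x j)) (Finset.mem_univ i)).trans hx
    rw [Real.norm_eq_abs, ← sq_le_one_iff_abs_le_one]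
    exact h1

/-- The value of the operator `ballOp n γ` at `x` on a function with gradient `g` and
Hessian `H` at `x`. -/
def genAt {n : ℕ} (γ : ℝ) (x g : Fin n → ℝ) (H : Fin n → Fin n → ℝ) : ℝ :=
  ∑ i, H i i - ∑ i, ∑ j, x i * x j * H i j - (n + 2 * γ) * ∑ i, x i * g i

/-- The operator `ballOp n γ` takes the value `ℓ` at `x` on the function `u`. -/
def HasGen {n : ℕ} (γ : ℝ) (u : (Fin n → ℝ) → ℝ) (x : Fin n → ℝ) (ℓ : ℝ) : Prop :=
  ∃ g H, IsJet u x g H ∧ genAt γ x g H = ℓ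

lemma HasGen.add {n : ℕ} {γ : ℝ} {u v : (Fin n → ℝ) → ℝ} {x : Fin n → ℝ} {ℓ ℓ' : ℝ}
    (hu : HasGen γ u x ℓ) (hv : HasGen γ v x ℓ') : HasGen γ (fun z => u z + v z) x (ℓ + ℓ') := by
  obtain ⟨g, H, h, rfl⟩ := hu
  obtain ⟨g', H', h', rfl⟩ := hv
  refine ⟨_, _, h.add h', ?_⟩
  simp only [genAt, mul_add, Finset.sum_add_distrib]
  ring

lemma HasGen.const_mul {n : ℕ} {γ : ℝ} {u : (Fin n → ℝ) → ℝ} {x : Fin n → ℝ} {ℓ : ℝ}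
    (hu : HasGen γ u x ℓ) (c : ℝ) : HasGen γ (fun z => c * u z) x (c * ℓ) := by
  obtain ⟨g, H, h, rfl⟩ := hu
  refine ⟨_, _, h.const_mul c, ?_⟩
  have e1 : ∑ i, ∑ j, x i * x j * (c * H i j) = c * ∑ i, ∑ j, x i * x j * H i j := by
    simp only [Finset.mul_sum]
    exact Finset.sum_congr rfl fun i _ => Finset.sum_congr rfl fun j _ => by ring
  have e2 : ∑ i, x i * (c * g i) = c * ∑ i, x i * g i := by
    simp only [Finset.mul_sum]
    exact Finset.sum_congr rfl fun i _ => by ring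
  simp only [genAt, e1, e2, ← Finset.mul_sum]
  ring

lemma HasGen.const {n : ℕ} (γ c : ℝ) (x : Fin n → ℝ) : HasGen γ (fun _ => c) x 0 :=
  ⟨0, 0, IsJet.const c x, by simp [genAt]⟩

lemma HasGen.sum {n : ℕ} {γ : ℝ} {ι : Type*} (s : Finset ι) {u : ι → (Fin n → ℝ) → ℝ}
    {x : Fin n → ℝ} {ℓ : ι → ℝ} (h : ∀ i ∈ s, HasGen γ (u i) x (ℓ i)) :
    HasGen γ (fun z => ∑ i ∈ s, u i z) x (∑ i ∈ s, ℓ i) := by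
  classical
  induction s using Finset.induction_on with
  | empty => simpa using HasGen.const γ 0 x
  | insert a s ha ih =>
    simp only [Finset.sum_insert ha]
    exact (h a (Finset.mem_insert_self _ _)).add
      (ih fun i hi => h i (Finset.mem_insert_of_mem hi))

lemma hasGen_eval {n : ℕ} (γ : ℝ) (p : MvPolynomial (Fin n) ℝ) (x : Fin n → ℝ) :
    HasGen γ (fun z => eval z p) x (eval x (ballOp n γ p)) := by
  refine ⟨_, _, isJet_eval p x, ?_⟩
  simp [genAt, ballOp]

/-- Second-order condition along a curve on which `u` is minimal. -/
lemma IsJet.curve_nonneg {n : ℕ} {u : (Fin n → ℝ) → ℝ} {x g : Fin n → ℝ}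
    {H : Fin n → Fin n → ℝ} (hu : IsJet u x g H) (a b : Fin n → ℝ)
    (hmin : ∀ᶠ θ in 𝓝 (0 : ℝ), u x ≤ u (x + ((1 - cos θ) • a + sin θ • b))) :
    0 ≤ ∑ i, g i * a i + ∑ i, ∑ j, H i j * (b i * b j) := by
  set c : ℝ → Fin n → ℝ := fun θ => (1 - cos θ) • a + sin θ • b with hc
  have hcO : c =O[𝓝 0] fun θ : ℝ => θ := by
    have h := ((((hasDerivAt_cos 0).const_sub 1).smul_const a).add
      ((hasDerivAt_sin 0).smul_const b)).differentiableAt.isBigO_sub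
    simpa [hc, Pi.add_def] using h
  have hc0 : Tendsto c (𝓝 0) (𝓝 0) := hcO.trans_tendsto tendsto_id
  have h1 : (fun θ => u (x + c θ) - u x - ∑ i, g i * c θ i
      - (∑ i, ∑ j, H i j * (c θ i * c θ j)) / 2) =o[𝓝 0] fun θ : ℝ => θ ^ 2 :=
    (hu.comp_tendsto hc0).trans_isBigO (hcO.norm_left.pow 2)
  have hneg : Tendsto (fun θ : ℝ => -θ) (𝓝 0) (𝓝 0) := by
    simpa using (continuous_neg (G := ℝ)).tendsto 0
  have h2 := (h1.comp_tendsto hneg).congr_right (g₂ := fun θ : ℝ => θ ^ 2) fun θ => by simp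
  set A := ∑ i, g i * a i
  set B := ∑ i, ∑ j, H i j * (b i * b j)
  set K := ∑ i, ∑ j, H i j * (a i * a j)
  have hlin : ∀ θ, ∑ i, g i * c θ i + ∑ i, g i * c (-θ) i = 2 * ((1 - cos θ) * A) := by
    intro θ
    rw [← Finset.sum_add_distrib, Finset.mul_sum, Finset.mul_sum]
    refine Finset.sum_congr rfl fun i _ => ?_
    simp [hc]; ring
  have hquad : ∀ θ, (∑ i, ∑ j, H i j * (c θ i * c θ j)) / 2
      + (∑ i, ∑ j, H i j * (c (-θ) i * c (-θ) j)) / 2 = (1 - cos θ) ^ 2 * K + sin θ ^ 2 * B := by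
    intro θ
    rw [← add_div, ← Finset.sum_add_distrib, Finset.mul_sum, Finset.mul_sum,
      ← Finset.sum_add_distrib, Finset.sum_div]
    refine Finset.sum_congr rfl fun i _ => ?_
    rw [← Finset.sum_add_distrib, Finset.mul_sum, Finset.mul_sum,
      ← Finset.sum_add_distrib, Finset.sum_div]
    refine Finset.sum_congr rfl fun j _ => ?_
    simp [hc]; ring
  have h3 := (h1.add h2).tendsto_div_nhds_zero
  have l1 : Tendsto (fun θ : ℝ => (1 - cos θ) / θ ^ 2) (𝓝[≠] 0) (𝓝 (1 / 2)) := by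
    have h := isLittleO_taylor_two (f := fun θ => 1 - cos θ) (f' := sin) (z := 0) (f₂ := 1)
      (Eventually.of_forall fun w => by simpa using (hasDerivAt_cos w).const_sub 1)
      (by simpa using hasDerivAt_sin 0)
    have h' := (h.tendsto_div_nhds_zero.mono_left
      (nhdsWithin_le_nhds (s := {0}ᶜ))).add_const (1 / 2 : ℝ)
    rw [zero_add] at h'
    refine h'.congr' ?_
    filter_upwards [self_mem_nhdsWithin] with θ hθ
    have : θ ≠ 0 := hθ
    simp
    field_simp
    ring
  have l2 : Tendsto (fun θ : ℝ => sin θ / θ) (𝓝[≠] 0) (𝓝 1) := by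
    have h := (hasDerivAt_iff_tendsto_slope.1 (hasDerivAt_sin 0))
    rw [cos_zero] at h
    refine h.congr fun θ => ?_
    simp [slope_def_field]
  have l0 : Tendsto (fun θ : ℝ => 1 - cos θ) (𝓝[≠] 0) (𝓝 0) := by
    have hcont : Continuous fun θ : ℝ => 1 - cos θ := by fun_prop
    have := hcont.tendsto 0
    simp only [cos_zero, sub_self] at this
    exact this.mono_left nhdsWithin_le_nhds
  have lim : Tendsto (fun θ : ℝ => 2 * ((1 - cos θ) / θ ^ 2 * A)
      + ((1 - cos θ) * ((1 - cos θ) / θ ^ 2) * K + (sin θ / θ) ^ 2 * B)) (𝓝[≠] 0)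
      (𝓝 (2 * (1 / 2 * A) + (0 * (1 / 2) * K + 1 ^ 2 * B))) :=
    ((l1.mul_const A).const_mul 2).add (((l0.mul l1).mul_const K).add ((l2.pow 2).mul_const B))
  have lim2 := lim.add (h3.mono_left (nhdsWithin_le_nhds (s := {0}ᶜ)))
  have hge : ∀ᶠ θ in 𝓝[≠] (0 : ℝ), 0 ≤ 2 * ((1 - cos θ) / θ ^ 2 * A)
      + ((1 - cos θ) * ((1 - cos θ) / θ ^ 2) * K + (sin θ / θ) ^ 2 * B)
      + ((u (x + c θ) - u x - ∑ i, g i * c θ i - (∑ i, ∑ j, H i j * (c θ i * c θ j)) / 2)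
      + (u (x + c (-θ)) - u x - ∑ i, g i * c (-θ) i
          - (∑ i, ∑ j, H i j * (c (-θ) i * c (-θ) j)) / 2)) / θ ^ 2 := by
    filter_upwards [self_mem_nhdsWithin, nhdsWithin_le_nhds hmin,
      nhdsWithin_le_nhds (hneg.eventually hmin)] with θ hθ m1 m2
    have hθ' : θ ≠ 0 := hθ
    have : 0 ≤ (u (x + c θ) - u x + (u (x + c (-θ)) - u x)) / θ ^ 2 := by
      have : 0 ≤ u (x + c θ) - u x + (u (x + c (-θ)) - u x) := by
        simp only [hc] at m1 m2 ⊢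
        linarith
      positivity
    refine this.trans (le_of_eq ?_)
    have e1 := hlin θ
    have e2 := hquad θ
    have e3 : u (x + c θ) - u x + (u (x + c (-θ)) - u x) = 2 * ((1 - cos θ) * A)
        + ((1 - cos θ) ^ 2 * K + sin θ ^ 2 * B)
        + ((u (x + c θ) - u x - ∑ i, g i * c θ i - (∑ i, ∑ j, H i j * (c θ i * c θ j)) / 2)
        + (u (x + c (-θ)) - u x - ∑ i, g i * c (-θ) i
          - (∑ i, ∑ j, H i j * (c (-θ) i * c (-θ) j)) / 2)) := by
      linear_combination e1 + e2
    rw [e3, add_div, add_div, add_div, div_pow]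
    ring
  have := ge_of_tendsto lim2 hge
  linarith

lemma genAt_eq {n : ℕ} (γ : ℝ) (x g : Fin n → ℝ) (H : Fin n → Fin n → ℝ) :
    genAt γ x g H = (∑ i, ∑ j, if i = j then 0 else
      (-(x i * g i + x j * g j) + (x i ^ 2 * H j j + x j ^ 2 * H i i
        - x i * x j * (H i j + H j i)))) / 2
      + (1 - ∑ i, x i ^ 2) * ∑ i, H i i + (1 + 2 * γ) * -∑ i, x i * g i := by
  have h1 : ∀ i j : Fin n, (if i = j then 0 else
      (-(x i * g i + x j * g j) + (x i ^ 2 * H j j + x j ^ 2 * H i i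
        - x i * x j * (H i j + H j i))))
      = (if i = j then 2 * (x i * g i) else 0) + (-(x i * g i) + (-(x j * g j)
        + (x i ^ 2 * H j j + (x j ^ 2 * H i i
        + (-(x i * x j * H i j) + -(x j * x i * H j i)))))) := by
    intro i j
    by_cases h : i = j
    · subst h; simp; ring
    · simp [h]; ring
  have h2 : ∑ i, ∑ j, x j * x i * H j i = ∑ i, ∑ j, x i * x j * H i j := Finset.sum_comm
  simp only [h1, Finset.sum_add_distrib, Finset.sum_neg_distrib, h2, Finset.sum_ite_eq,
    Finset.mem_univ, if_true, ← Finset.mul_sum, ← Finset.sum_mul, Finset.sum_const,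
    Finset.card_univ, Fintype.card_fin, nsmul_eq_mul, genAt, mul_neg]
  have h3 : ∑ i, x i * (n * g i) = n * ∑ i, x i * g i := by
    simp only [mul_left_comm, Finset.mul_sum]
  linear_combination h3 / 2

lemma sum_quadratic_pair {n : ℕ} (H : Fin n → Fin n → ℝ) {i j : Fin n} (a b : ℝ) :
    ∑ k, ∑ l, H k l * ((a * Pi.single (M := fun _ => ℝ) i 1 k
      + b * Pi.single (M := fun _ => ℝ) j 1 k)
      * (a * Pi.single (M := fun _ => ℝ) i 1 l + b * Pi.single (M := fun _ => ℝ) j 1 l))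
      = a ^ 2 * H i i + b ^ 2 * H j j + a * b * (H i j + H j i) := by
  simp only [Pi.single_apply, mul_add, add_mul, Finset.sum_add_distrib]
  simp
  ring

/-- The operator is nonnegative at a minimum point over the closed ball. -/
lemma genAt_nonneg_of_min {n : ℕ} {γ : ℝ} (hγ : -(1 / 2 : ℝ) < γ) {u : (Fin n → ℝ) → ℝ}
    {x g : Fin n → ℝ} {H : Fin n → Fin n → ℝ} (hu : IsJet u x g H) (hx : x ∈ cBall n)
    (hmin : ∀ z ∈ cBall n, u x ≤ u z) : 0 ≤ genAt γ x g H := by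
  rw [genAt_eq]
  have hx' : ∑ i, x i ^ 2 ≤ 1 := hx
  have rot : ∀ i j : Fin n, i ≠ j → 0 ≤ (-(x i * g i + x j * g j)
      + (x i ^ 2 * H j j + x j ^ 2 * H i i - x i * x j * (H i j + H j i))) := by
    intro i j hij
    have := hu.curve_nonneg (-(x i) • Pi.single i 1 + -(x j) • Pi.single j 1)
      (-(x j) • Pi.single i 1 + x i • Pi.single j 1) (Eventually.of_forall fun θ => hmin _ ?_)
    · simp only [Pi.add_apply, Pi.smul_apply, smul_eq_mul, sum_quadratic_pair] at this
      have e : ∑ k, g k * (-(x i) * Pi.single (M := fun _ => ℝ) i 1 k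
          + -(x j) * Pi.single (M := fun _ => ℝ) j 1 k) = -(x i * g i + x j * g j) := by
        simp only [Pi.single_apply, mul_add, Finset.sum_add_distrib]
        simp
        ring
      rw [e] at this
      linarith
    · rw [mem_cBall]
      refine le_trans (le_of_eq ?_) hx'
      have split : ∀ f : Fin n → ℝ,
          ∑ k, f k = f i + f j + ∑ k ∈ (Finset.univ.erase i).erase j, f k := fun f => by
        rw [← Finset.add_sum_erase _ _ (Finset.mem_univ i), ← Finset.add_sum_erase _ _
          (Finset.mem_erase.2 ⟨hij.symm, Finset.mem_univ j⟩), ← add_assoc]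
      rw [split, split fun k => x k ^ 2]
      congr 1
      · simp [hij, hij.symm]
        linear_combination (x i ^ 2 + x j ^ 2) * sin_sq_add_cos_sq θ
      · refine Finset.sum_congr rfl fun k hk => ?_
        simp only [Finset.mem_erase] at hk
        simp [hk.1, hk.2.1]
  have diag : 0 ≤ (1 - ∑ i, x i ^ 2) * ∑ i, H i i := by
    rcases hx'.eq_or_lt with h | h
    · simp [h]
    · refine mul_nonneg (by linarith) (Finset.sum_nonneg fun i _ => ?_)
      have := hu.curve_nonneg 0 (Pi.single i 1) ?_
      · simpa [Pi.single_apply] using this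
      · have hcont : Continuous fun θ : ℝ =>
            ∑ k, (x + ((1 - cos θ) • 0 + sin θ • Pi.single i 1) : Fin n → ℝ) k ^ 2 := by
          simp only [Pi.add_apply, Pi.smul_apply, smul_eq_mul]
          fun_prop
        have : ∀ᶠ θ in 𝓝 (0 : ℝ),
            ∑ k, (x + ((1 - cos θ) • 0 + sin θ • Pi.single i 1) : Fin n → ℝ) k ^ 2 < 1 :=
          hcont.continuousAt.eventually_lt_const (by simpa using h)
        filter_upwards [this] with θ hθ
        exact hmin _ hθ.le
  have rad : 0 ≤ -∑ i, x i * g i := by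
    have := hu.curve_nonneg (-x) 0 ?_
    · simpa [mul_comm] using this
    · have h1 : ∀ᶠ θ in 𝓝 (0 : ℝ), 0 < cos θ :=
        continuous_cos.continuousAt.eventually_const_lt (by simp)
      filter_upwards [h1] with θ hθ
      refine hmin _ ?_
      have e : ∀ k, (x + ((1 - cos θ) • -x + sin θ • (0 : Fin n → ℝ))) k ^ 2
          = cos θ ^ 2 * x k ^ 2 := fun k => by simp; ring
      rw [mem_cBall]
      simp only [e, ← Finset.mul_sum]
      have := cos_sq_le_one θ
      nlinarith [Finset.sum_nonneg fun i (_ : i ∈ Finset.univ) => sq_nonneg (x i)]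
  have hsum : 0 ≤ ∑ i, ∑ j, if i = j then 0 else
      (-(x i * g i + x j * g j) + (x i ^ 2 * H j j + x j ^ 2 * H i i
        - x i * x j * (H i j + H j i))) := by
    refine Finset.sum_nonneg fun i _ => Finset.sum_nonneg fun j _ => ?_
    split_ifs with h
    · exact le_rfl
    · exact rot i j h
  have : 0 ≤ (1 + 2 * γ) * -∑ i, x i * g i := mul_nonneg (by linarith) rad
  linarith

/-- Parabolic maximum principle on the closed ball. -/
lemma nonneg_of_supersolution {n : ℕ} {γ : ℝ} (hγ : -(1 / 2 : ℝ) < γ) {T : ℝ}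
    {u : ℝ → (Fin n → ℝ) → ℝ}
    (hc : ContinuousOn (fun p : ℝ × (Fin n → ℝ) => u p.1 p.2) (Set.Icc 0 T ×ˢ cBall n))
    (h0 : ∀ x ∈ cBall n, 0 ≤ u 0 x)
    (hp : ∀ t ∈ Set.Ioc 0 T, ∀ x ∈ cBall n, u t x < 0 →
      ∃ d ℓ, HasDerivAt (fun s => u s x) d t ∧ HasGen γ (u t) x ℓ ∧ ℓ ≤ d) :
    ∀ t ∈ Set.Icc 0 T, ∀ x ∈ cBall n, 0 ≤ u t x := by
  intro t ht x hx
  refine le_of_forall_pos_le_add fun ε hε => ?_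
  have hT : 0 ≤ T := ht.1.trans ht.2
  set η := ε / (T + 1) with hη
  have hη0 : 0 < η := by positivity
  have hηT : η * T ≤ ε := by
    rw [hη, div_mul_eq_mul_div, div_le_iff₀ (by positivity)]
    nlinarith
  have hcomp : IsCompact (Set.Icc 0 T ×ˢ cBall n) := isCompact_Icc.prod (isCompact_cBall n)
  obtain ⟨⟨s, z⟩, ⟨hs, hz⟩, hmin⟩ := hcomp.exists_isMinOn ⟨(t, x), ht, hx⟩
    (hc.add (by fun_prop : Continuous fun p : ℝ × (Fin n → ℝ) => η * p.1).continuousOn)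
  have hmin' : ∀ s' ∈ Set.Icc 0 T, ∀ z' ∈ cBall n, u s z + η * s ≤ u s' z' + η * s' :=
    fun s' hs' z' hz' => hmin (Set.mk_mem_prod hs' hz')
  have hkey : 0 ≤ u s z + η * s := by
    by_contra! hneg
    have hs0 : 0 < s := by
      rcases hs.1.eq_or_lt with h | h
      · have h' : s = 0 := h.symm
        have := h0 z hz
        rw [h'] at hneg
        linarith
      · exact h
    obtain ⟨d, ℓ, hd, ⟨g, H, hj, rfl⟩, hle⟩ := hp s ⟨hs0, hs.2⟩ z hz (by nlinarith)
    have hL := genAt_nonneg_of_min hγ hj hz fun z' hz' => by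
      have := hmin' s hs z' hz'
      linarith
    have hd' : d + η ≤ 0 := by
      have h1 : HasDerivAt (fun s' => u s' z + η * s') (d + η) s := by
        simpa using hd.fun_add ((hasDerivAt_id' s).const_mul η)
      have h2 := (hasDerivWithinAt_iff_tendsto_slope' (s := Set.Iio s) (by simp)).1
        h1.hasDerivWithinAt
      refine le_of_tendsto h2 ?_
      filter_upwards [Ioo_mem_nhdsLT hs0] with s' hs'
      rw [slope_def_field]
      have := hmin' s' ⟨hs'.1.le, hs'.2.le.trans hs.2⟩ z hz
      exact div_nonpos_of_nonneg_of_nonpos (by linarith) (by linarith [hs'.2])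
    linarith
  have := hmin' t ht x hx
  have h2 : η * t ≤ η * T := by gcongr; exact ht.2
  linarith

/-- The Euclidean dot product on `Fin n → ℝ`. -/
def dotp {n : ℕ} (x y : Fin n → ℝ) : ℝ := ∑ i, x i * y i

/-- The squared Euclidean norm on `Fin n → ℝ`. -/
def nsq {n : ℕ} (x : Fin n → ℝ) : ℝ := ∑ i, x i ^ 2

lemma nsq_nonneg {n : ℕ} (x : Fin n → ℝ) : 0 ≤ nsq x := Finset.sum_nonneg fun _ _ => sq_nonneg _

lemma nsq_le_one {n : ℕ} {x : Fin n → ℝ} (hx : x ∈ cBall n) : nsq x ≤ 1 := hx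

@[fun_prop]
lemma continuous_nsq {n : ℕ} : Continuous (nsq : (Fin n → ℝ) → ℝ) := by
  unfold nsq; fun_prop

lemma continuous_dotp {n : ℕ} : Continuous fun p : (Fin n → ℝ) × (Fin n → ℝ) => dotp p.1 p.2 := by
  unfold dotp; fun_prop

lemma dotp_comm {n : ℕ} (x y : Fin n → ℝ) : dotp x y = dotp y x :=
  Finset.sum_congr rfl fun _ _ => mul_comm _ _

lemma dotp_self {n : ℕ} (x : Fin n → ℝ) : dotp x x = nsq x :=
  Finset.sum_congr rfl fun _ _ => (sq _).symm

lemma isJet_dotp {n : ℕ} (x y : Fin n → ℝ) : IsJet (fun z => dotp z y) x y 0 := by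
  refine (isLittleO_zero _ _).congr_left fun v => ?_
  have : dotp (x + v) y = dotp x y + ∑ i, y i * v i := by
    rw [dotp, dotp, ← Finset.sum_add_distrib]
    exact Finset.sum_congr rfl fun i _ => by simp; ring
  simp [this]

lemma isJet_nsq {n : ℕ} (x : Fin n → ℝ) :
    IsJet nsq x (fun i => 2 * x i) (fun i j => if i = j then 2 else 0) := by
  refine (isLittleO_zero _ _).congr_left fun v => ?_
  have : nsq (x + v) = nsq x + ∑ i, 2 * x i * v i + ∑ i, v i ^ 2 := by
    rw [nsq, nsq, ← Finset.sum_add_distrib, ← Finset.sum_add_distrib]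
    exact Finset.sum_congr rfl fun i _ => by simp; ring
  have h2 : ∑ i, ∑ j, (if i = j then (2 : ℝ) else 0) * (v i * v j) = 2 * ∑ i, v i ^ 2 := by
    simp [ite_mul, Finset.mul_sum, sq]
  rw [this, h2]
  ring

lemma IsJet.exp {n : ℕ} {u : (Fin n → ℝ) → ℝ} {x g : Fin n → ℝ} {H : Fin n → Fin n → ℝ}
    (hu : IsJet u x g H) :
    IsJet (fun z => Real.exp (u z)) x (fun i => Real.exp (u x) * g i)
      (fun i j => Real.exp (u x) * H i j + Real.exp (u x) * (g i * g j)) :=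
  hu.comp (isLittleO_taylor_two (Eventually.of_forall fun w => Real.hasDerivAt_exp w)
    (Real.hasDerivAt_exp _))

lemma HasGen.exp {n : ℕ} (γ : ℝ) {u : (Fin n → ℝ) → ℝ} {x g : Fin n → ℝ}
    {H : Fin n → Fin n → ℝ} (hu : IsJet u x g H) :
    HasGen γ (fun z => Real.exp (u z)) x
      (Real.exp (u x) * (genAt γ x g H + nsq g - dotp x g ^ 2)) := by
  refine ⟨_, _, hu.exp, ?_⟩
  have e1 : ∑ i, ∑ j, x i * x j * (Real.exp (u x) * H i j + Real.exp (u x) * (g i * g j))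
      = Real.exp (u x) * (∑ i, ∑ j, x i * x j * H i j + dotp x g ^ 2) := by
    rw [sq, dotp, Finset.sum_mul_sum, ← Finset.sum_add_distrib, Finset.mul_sum]
    refine Finset.sum_congr rfl fun i _ => ?_
    rw [← Finset.sum_add_distrib, Finset.mul_sum]
    exact Finset.sum_congr rfl fun j _ => by ring
  have e2 : ∑ i, x i * (Real.exp (u x) * g i) = Real.exp (u x) * ∑ i, x i * g i := by
    rw [Finset.mul_sum]
    exact Finset.sum_congr rfl fun i _ => by ring
  have e3 : ∑ i, (Real.exp (u x) * H i i + Real.exp (u x) * (g i * g i))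
      = Real.exp (u x) * (∑ i, H i i + nsq g) := by
    rw [nsq, ← Finset.sum_add_distrib, Finset.mul_sum]
    exact Finset.sum_congr rfl fun i _ => by ring
  simp only [genAt, e1, e2, e3]
  ring

/-- The generator on `exp (b + β x·y + f (A + σ (1 - |x|²)))`. -/
lemma hasGen_exp_profile {n : ℕ} (γ b β σ A : ℝ) (x y : Fin n → ℝ) {f : ℝ → ℝ} {p₁ p₂ : ℝ}
    (hf : (fun d => f (A + σ * (1 - nsq x) + d) - f (A + σ * (1 - nsq x)) - p₁ * d
      - p₂ / 2 * d ^ 2) =o[𝓝 0] fun d => d ^ 2) :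
    HasGen γ (fun z => Real.exp (b + β * dotp z y + f (A + σ * (1 - nsq z)))) x
      (Real.exp (b + β * dotp x y + f (A + σ * (1 - nsq x))) *
        ((-2 * σ * p₁ * n + 4 * σ ^ 2 * p₂ * nsq x)
          - (-2 * σ * p₁ * nsq x + 4 * σ ^ 2 * p₂ * nsq x ^ 2)
          - (n + 2 * γ) * (β * dotp x y - 2 * σ * p₁ * nsq x)
          + (β ^ 2 * nsq y - 4 * β * σ * p₁ * dotp x y + 4 * σ ^ 2 * p₁ ^ 2 * nsq x)
          - (β * dotp x y - 2 * σ * p₁ * nsq x) ^ 2)) := by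
  have hq : IsJet (fun z => A + σ * (1 - nsq z)) x (fun i => -2 * σ * x i)
      (fun i j => if i = j then -2 * σ else 0) := by
    convert (IsJet.const (A + σ) x).add ((isJet_nsq x).const_mul (-σ)) using 1
    · funext; ring
    · funext; simp; ring
    · funext i j; simp only [mul_ite, mul_zero, zero_add, Pi.zero_apply]; split_ifs <;> ring
  have hj := ((IsJet.const b x).add ((isJet_dotp x y).const_mul β)).add (hq.comp hf)
  convert HasGen.exp γ hj using 2
  have e1 : dotp x (fun i => (0 : Fin n → ℝ) i + β * y i + p₁ * (-2 * σ * x i))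
      = β * dotp x y - 2 * σ * p₁ * nsq x := by
    rw [dotp, dotp, nsq, Finset.mul_sum, Finset.mul_sum, ← Finset.sum_sub_distrib]
    exact Finset.sum_congr rfl fun i _ => by simp; ring
  have e2 : nsq (fun i => (0 : Fin n → ℝ) i + β * y i + p₁ * (-2 * σ * x i))
      = β ^ 2 * nsq y - 4 * β * σ * p₁ * dotp x y + 4 * σ ^ 2 * p₁ ^ 2 * nsq x := by
    rw [dotp, nsq, nsq, nsq, Finset.mul_sum, Finset.mul_sum, Finset.mul_sum,
      ← Finset.sum_sub_distrib, ← Finset.sum_add_distrib]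
    exact Finset.sum_congr rfl fun i _ => by simp; ring
  have e3 : ∑ i, ∑ j, x i * x j * ((0 : Fin n → Fin n → ℝ) i j + β * (0 : Fin n → Fin n → ℝ) i j
      + (p₁ * (if i = j then -2 * σ else 0) + p₂ * (-2 * σ * x i * (-2 * σ * x j))))
      = -2 * σ * p₁ * nsq x + 4 * σ ^ 2 * p₂ * nsq x ^ 2 := by
    have : ∀ i j, x i * x j * ((0 : Fin n → Fin n → ℝ) i j + β * (0 : Fin n → Fin n → ℝ) i j
      + (p₁ * (if i = j then -2 * σ else 0) + p₂ * (-2 * σ * x i * (-2 * σ * x j))))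
      = (if i = j then -2 * σ * p₁ * x i ^ 2 else 0) + 4 * σ ^ 2 * p₂ * (x i ^ 2 * x j ^ 2) := by
      intro i j
      by_cases h : i = j
      · subst h; simp; ring
      · simp [h]; ring
    simp only [this, Finset.sum_add_distrib, ← Finset.mul_sum, ← Finset.sum_mul,
      Finset.sum_ite_eq, Finset.mem_univ, if_true, nsq]
    ring
  have e4 : ∑ i, ((0 : Fin n → Fin n → ℝ) i i + β * (0 : Fin n → Fin n → ℝ) i i
      + (p₁ * (if i = i then -2 * σ else 0) + p₂ * (-2 * σ * x i * (-2 * σ * x i))))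
      = -2 * σ * p₁ * n + 4 * σ ^ 2 * p₂ * nsq x := by
    simp only [if_true, Finset.sum_add_distrib, nsq, Finset.mul_sum]
    simp
    rw [Finset.sum_congr rfl fun i _ => show p₂ * (2 * σ * x i * (2 * σ * x i))
      = 4 * σ ^ 2 * p₂ * x i ^ 2 by ring]
    ring
  rw [e2, e1, genAt, e3, e4]
  change _ = _ - _ - _ * dotp x _ + _ - _
  rw [e1]

/-- The profile `√τ - (γ/2) log τ - δ/√τ`. -/
def prof (γ δ τ : ℝ) : ℝ := √τ - γ / 2 * log τ - δ / √τ

/-- The first derivative of `prof`. -/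
def profD (γ δ τ : ℝ) : ℝ := 1 / (2 * √τ) - γ / (2 * τ) + δ / (2 * (τ * √τ))

/-- The second derivative of `prof`. -/
def profDD (γ δ τ : ℝ) : ℝ :=
  -1 / (4 * (τ * √τ)) + γ / (2 * τ ^ 2) - 3 * δ / (4 * (τ ^ 2 * √τ))

lemma hasDerivAt_prof (γ δ : ℝ) {τ : ℝ} (hτ : 0 < τ) :
    HasDerivAt (prof γ δ) (profD γ δ τ) τ := by
  have h0 : √τ ≠ 0 := (Real.sqrt_pos.2 hτ).ne'
  have h1 := Real.hasDerivAt_sqrt hτ.ne'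
  have h := (h1.fun_sub ((Real.hasDerivAt_log hτ.ne').const_mul (γ / 2))).fun_sub
    ((hasDerivAt_const τ δ).fun_div h1 h0)
  refine h.congr_deriv ?_
  have h2 : √τ ^ 2 = τ := Real.sq_sqrt hτ.le
  rw [h2, profD]
  field_simp
  ring

lemma hasDerivAt_profD (γ δ : ℝ) {τ : ℝ} (hτ : 0 < τ) :
    HasDerivAt (profD γ δ) (profDD γ δ τ) τ := by
  have hs : 0 < √τ := Real.sqrt_pos.2 hτ
  have h0 : √τ ≠ 0 := hs.ne'
  have h1 := Real.hasDerivAt_sqrt hτ.ne'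
  have h := (((hasDerivAt_const τ (1 : ℝ)).fun_div (h1.const_mul 2) (by positivity)).fun_sub
    ((hasDerivAt_const τ γ).fun_div ((hasDerivAt_id' τ).const_mul 2) (by positivity))).fun_add
    ((hasDerivAt_const τ δ).fun_div (((hasDerivAt_id' τ).fun_mul h1).const_mul 2) (by positivity))
  refine h.congr_deriv ?_
  have h2 : √τ ^ 2 = τ := Real.sq_sqrt hτ.le
  clear h h1
  rw [profDD]
  generalize √τ = s at hs h0 h2 ⊢
  subst h2
  field_simp
  ring

lemma prof_taylor (γ δ : ℝ) {τ : ℝ} (hτ : 0 < τ) :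
    (fun d => prof γ δ (τ + d) - prof γ δ τ - profD γ δ τ * d - profDD γ δ τ / 2 * d ^ 2)
      =o[𝓝 0] fun d => d ^ 2 :=
  isLittleO_taylor_two
    ((eventually_gt_nhds hτ).mono fun _ hw => hasDerivAt_prof γ δ hw) (hasDerivAt_profD γ δ hτ)

/-- Logarithm of the Gaussian parametrix. -/
def parG {n : ℕ} (γ M δ c a : ℝ) (y : Fin n → ℝ) (t : ℝ) (x : Fin n → ℝ) : ℝ :=
  -a * log t - (1 - dotp x y) / (c * t)
    + prof γ δ (M ^ 2 + (1 - nsq y) / (c * t) ^ 2 * (1 - nsq x))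

/-- The Gaussian parametrix. -/
def parU {n : ℕ} (γ M δ c a : ℝ) (y : Fin n → ℝ) (t : ℝ) (x : Fin n → ℝ) : ℝ :=
  Real.exp (parG γ M δ c a y t x)

/-- The first error coefficient of the parametrix. -/
def errR (γ M δ S : ℝ) : ℝ :=
  2 * profD γ δ (M ^ 2 + S) * S + 4 * S ^ 2 * profDD γ δ (M ^ 2 + S)

/-- The second error coefficient of the parametrix. -/
def errD (γ M δ S : ℝ) : ℝ :=
  (2 + 4 * γ) * profD γ δ (M ^ 2 + S)
    + 4 * S * (profDD γ δ (M ^ 2 + S) + profD γ δ (M ^ 2 + S) ^ 2) - 1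

/-- The drift term of the heat operator applied to the parametrix. -/
def kap (γ M δ S : ℝ) : ℝ := 2 * profD γ δ (M ^ 2 + S) * S

lemma parU_pos {n : ℕ} (γ M δ c a : ℝ) (y : Fin n → ℝ) (t : ℝ) (x : Fin n → ℝ) :
    0 < parU γ M δ c a y t x := Real.exp_pos _

/-- The heat operator applied to the parametrix. -/
lemma parU_spec {n : ℕ} (γ δ a : ℝ) {M c t : ℝ} (hM : 0 < M) (hc : 0 < c) (ht : 0 < t)
    {x y : Fin n → ℝ} (hx : x ∈ cBall n) (hy : y ∈ cBall n) :
    ∃ d ℓ, HasDerivAt (fun s => parU γ M δ c a y s x) d t ∧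
      HasGen γ (parU γ M δ c a y t) x ℓ ∧
      ∀ β σ S Y : ℝ, β = 1 / (c * t) → σ = (1 - nsq y) / (c * t) ^ 2 → S = σ * (1 - nsq x) →
        Y = β - β * dotp x y - kap γ M δ S →
        d - ℓ = parU γ M δ c a y t x * (Y ^ 2 + (c - 2) * β * Y - (n + 2 * γ) * Y
          + (n + 2 * γ - a * c) * β + errR γ M δ S - σ * errD γ M δ S) := by
  have hx' := nsq_le_one hx
  have hy' := nsq_le_one hy
  set τ := M ^ 2 + (1 - nsq y) / (c * t) ^ 2 * (1 - nsq x) with hτdef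
  have hτ : 0 < τ := by
    have : 0 ≤ (1 - nsq y) / (c * t) ^ 2 * (1 - nsq x) :=
      mul_nonneg (div_nonneg (by linarith) (by positivity)) (by linarith)
    positivity
  have hgen := hasGen_exp_profile γ (-a * log t - 1 / (c * t)) (1 / (c * t))
    ((1 - nsq y) / (c * t) ^ 2) (M ^ 2) x y (prof_taylor γ δ hτ)
  have hU : ∀ z, Real.exp (-a * log t - 1 / (c * t) + 1 / (c * t) * dotp z y
      + prof γ δ (M ^ 2 + (1 - nsq y) / (c * t) ^ 2 * (1 - nsq z))) = parU γ M δ c a y t z := by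
    intro z
    rw [parU, parG]
    congr 2
    ring
  simp only [hU] at hgen
  have hct : HasDerivAt (fun s => c * s) c t := by simpa using (hasDerivAt_id' t).const_mul c
  have hct0 : c * t ≠ 0 := by positivity
  have hin : HasDerivAt (fun s => M ^ 2 + (1 - nsq y) / (c * s) ^ 2 * (1 - nsq x))
      (-2 * c * (1 - nsq y) / (c * t) ^ 3 * (1 - nsq x)) t := by
    have h := (((hasDerivAt_const t (1 - nsq y)).fun_div (hct.fun_pow 2)
      (pow_ne_zero 2 hct0)).mul_const (1 - nsq x)).const_add (M ^ 2)
    refine h.congr_deriv ?_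
    field_simp
    ring
  have hG : HasDerivAt (fun s => parG γ M δ c a y s x)
      (-a * (1 / t) + (1 - dotp x y) * c / (c * t) ^ 2
        + profD γ δ τ * (-2 * c * (1 - nsq y) / (c * t) ^ 3 * (1 - nsq x))) t := by
    have h1 := (((Real.hasDerivAt_log ht.ne').const_mul (-a)).fun_sub
      ((hasDerivAt_const t (1 - dotp x y)).fun_div hct hct0)).fun_add
      ((hasDerivAt_prof γ δ hτ).comp t hin)
    refine h1.congr_deriv ?_
    field_simp
    ring
  refine ⟨_, _, hG.exp, hgen, ?_⟩
  rintro β σ S Y hβ hσ hS hY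
  have hτS : τ = M ^ 2 + S := by rw [hS, hσ]
  have hσβ : σ = (1 - nsq y) * β ^ 2 := by rw [hσ, hβ]; field_simp
  have ht' : 1 / t = c * β := by rw [hβ]; field_simp
  have h2 : (1 - dotp x y) * c / (c * t) ^ 2 = (1 - dotp x y) * c * β ^ 2 := by
    rw [hβ]; field_simp
  have h3 : -2 * c * (1 - nsq y) / (c * t) ^ 3 * (1 - nsq x)
      = -2 * c * β * σ * (1 - nsq x) := by
    rw [hσ, hβ]; field_simp
  rw [← hτdef, ← hσ, ← hβ, h2, h3, ht', hτS]
  change parU γ M δ c a y t x * _ - _ = _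
  rw [← mul_sub, errR, errD, hY, kap]
  congr 1
  generalize profD γ δ (M ^ 2 + S) = p
  generalize profDD γ δ (M ^ 2 + S) = p'
  subst hS hσβ
  ring

lemma profD_eq (γ δ : ℝ) {m : ℝ} (hm : 0 < m) :
    profD γ δ (m ^ 2) = m⁻¹ / 2 - γ * m⁻¹ ^ 2 / 2 + δ * m⁻¹ ^ 3 / 2 := by
  rw [profD, Real.sqrt_sq hm.le]
  field_simp

lemma profDD_eq (γ δ : ℝ) {m : ℝ} (hm : 0 < m) :
    profDD γ δ (m ^ 2) = -m⁻¹ ^ 3 / 4 + γ * m⁻¹ ^ 4 / 2 - 3 * δ * m⁻¹ ^ 5 / 4 := by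
  rw [profDD, Real.sqrt_sq hm.le]
  field_simp

/-- Parametrization of `M² + S` as a square. -/
lemma exists_sq_param {M S : ℝ} (hM : 1 ≤ M) (hS : 0 ≤ S) :
    ∃ m z : ℝ, M ≤ m ∧ 0 < z ∧ z ≤ 1 ∧ M * z ≤ 1 ∧ m * z = 1 ∧ M ^ 2 + S = m ^ 2 ∧ z = m⁻¹ := by
  have h : 0 ≤ M ^ 2 + S := by positivity
  have hm : M ≤ √(M ^ 2 + S) := Real.le_sqrt_of_sq_le (by linarith)
  have hm0 : 0 < √(M ^ 2 + S) := by linarith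
  refine ⟨√(M ^ 2 + S), (√(M ^ 2 + S))⁻¹, hm, by positivity, inv_le_one_of_one_le₀ (by linarith),
    ?_, mul_inv_cancel₀ hm0.ne', (Real.sq_sqrt h).symm, rfl⟩
  rw [← div_eq_mul_inv, div_le_one hm0]
  exact hm

lemma abs_kap_sub_le (γ : ℝ) {M δ S : ℝ} (hM : 1 ≤ M) (hδ : 0 ≤ δ) (hS : 0 ≤ S) :
    |kap γ M δ S - √S| ≤ 2 * M + |γ| + δ := by
  obtain ⟨m, z, h1, h2, h3, h4, h5, h6, h7⟩ := exists_sq_param hM hS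
  have hm : 0 < m := by linarith
  have hk : kap γ M δ S = (1 - (M * z) ^ 2) * (m - γ + δ * z) := by
    rw [kap, h6, profD_eq γ δ hm, ← h7, show S = m ^ 2 - M ^ 2 by linarith]
    linear_combination (m - γ * (m * z + 1) + δ * z * (m * z + 1) + M ^ 2 * z) * h5
  have hs1 : √S ≤ m := by
    rw [Real.sqrt_le_left hm.le]; nlinarith
  have hs2 : m - M ≤ √S := Real.le_sqrt_of_sq_le (by nlinarith)
  have hMz : 0 ≤ M * z := by positivity
  have hq1 : (M * z) ^ 2 ≤ 1 := by nlinarith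
  have hq0 : 0 ≤ (M * z) ^ 2 := by positivity
  have hq2 : (M * z) ^ 2 * m ≤ M := by
    have : (M * z) ^ 2 * m = M * (M * z) * (m * z) := by ring
    rw [this, h5]; nlinarith
  have hq3 : 0 ≤ (M * z) ^ 2 * m := by positivity
  have h8 := neg_abs_le γ
  have h9 := le_abs_self γ
  have h10 := abs_nonneg γ
  have h11 : (1 - (M * z) ^ 2) * |γ| ≤ |γ| := by nlinarith
  have h12 : (1 - (M * z) ^ 2) * (δ * z) ≤ δ := by
    have : δ * z ≤ δ := by nlinarith
    have : 0 ≤ δ * z := by positivity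
    nlinarith
  have h13 : 0 ≤ (1 - (M * z) ^ 2) * (δ * z) := mul_nonneg (by linarith) (by positivity)
  rw [hk, abs_le]
  constructor <;> nlinarith

lemma abs_errR_le (γ : ℝ) {M δ S : ℝ} (hM : 1 ≤ M) (hδ : 0 ≤ δ) (hS : 0 ≤ S) :
    |errR γ M δ S| ≤ 3 * |γ| + 5 * δ + M := by
  obtain ⟨m, z, h1, h2, h3, h4, h5, h6, h7⟩ := exists_sq_param hM hS
  have hm : 0 < m := by linarith
  set q := (M * z) ^ 2 with hq
  have hk : errR γ M δ S = (1 - q) * (γ - 2 * (δ * z) + q * m - q * (2 * γ) + 3 * q * (δ * z)) := by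
    have hS' : S = m ^ 2 * (1 - q) := by
      rw [hq]
      linear_combination (M ^ 2 * (m * z + 1)) * h5 + h6
    rw [errR, h6, profD_eq γ δ hm, profDD_eq γ δ hm, ← h7, hS']
    have e1 : m⁻¹ = z := h7.symm
    have e2 : z = 1 / m := by rw [h7]; simp
    rw [e2]
    field_simp
    ring
  have hMz : 0 ≤ M * z := by positivity
  have hq1 : q ≤ 1 := by rw [hq]; nlinarith
  have hq0 : 0 ≤ q := by rw [hq]; positivity
  have hq2 : q * m ≤ M := by
    have : (M * z) ^ 2 * m = M * (M * z) * (m * z) := by ring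
    rw [hq, this, h5]; nlinarith
  have hq3 : 0 ≤ q * m := by positivity
  have hδz : δ * z ≤ δ := by nlinarith
  have hδz0 : 0 ≤ δ * z := by positivity
  have hqd : q * (δ * z) ≤ δ := by nlinarith
  have hqd0 : 0 ≤ q * (δ * z) := by positivity
  have h8 := neg_abs_le γ
  have h9 := le_abs_self γ
  have h10 := abs_nonneg γ
  have hqg : |q * (2 * γ)| ≤ 2 * |γ| := by
    rw [abs_mul, abs_mul, abs_of_nonneg hq0, abs_two]
    nlinarith
  obtain ⟨hg1, hg2⟩ := abs_le.1 hqg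
  rw [hk, abs_mul, abs_of_nonneg (by linarith : 0 ≤ 1 - q)]
  have : |γ - 2 * (δ * z) + q * m - q * (2 * γ) + 3 * q * (δ * z)| ≤ 3 * |γ| + 5 * δ + M := by
    rw [abs_le]
    constructor <;> nlinarith
  nlinarith [abs_nonneg (γ - 2 * (δ * z) + q * m - q * (2 * γ) + 3 * q * (δ * z))]

lemma errD_eq (γ M δ S : ℝ) {m z : ℝ} (hm : 0 < m) (hz : z = m⁻¹) (h : M ^ 2 + S = m ^ 2) :
    errD γ M δ S = (1 + 2 * γ) * (z - γ * z ^ 2 + δ * z ^ 3)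
      + (1 - (M * z) ^ 2) * ((1 - γ * z + δ * z ^ 2) ^ 2 - z + 2 * γ * z ^ 2 - 3 * δ * z ^ 3)
      - 1 := by
  have hS : S = m ^ 2 - M ^ 2 := by linarith
  rw [errD, h, profD_eq γ δ hm, profDD_eq γ δ hm, hS, hz]
  field_simp
  ring

lemma exists_errD_nonpos {γ : ℝ} (hγ : -(1 / 2 : ℝ) < γ) :
    ∃ M : ℝ, 1 ≤ M ∧ ∀ S, 0 ≤ S → errD γ M 0 S ≤ 0 := by
  refine ⟨4 + 4 * |γ| * (2 + |γ|) + 4, ?_, fun S hS => ?_⟩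
  · have := abs_nonneg γ
    nlinarith [mul_nonneg this this]
  set M := 4 + 4 * |γ| * (2 + |γ|) + 4 with hMdef
  have hγ0 := abs_nonneg γ
  have hM : 1 ≤ M := by nlinarith [mul_nonneg hγ0 hγ0]
  obtain ⟨m, z, h1, h2, h3, h4, h5, h6, h7⟩ := exists_sq_param hM hS
  have hm : 0 < m := by linarith
  rw [errD_eq γ M 0 S hm h7 h6]
  have hg := le_abs_self γ
  have hg2 : γ ^ 2 = |γ| ^ 2 := (sq_abs γ).symm
  have e : (1 + 2 * γ) * (z - γ * z ^ 2 + 0 * z ^ 3)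
      + (1 - (M * z) ^ 2) * ((1 - γ * z + 0 * z ^ 2) ^ 2 - z + 2 * γ * z ^ 2 - 3 * 0 * z ^ 3) - 1
      = z ^ 2 * ((γ - γ ^ 2) - M ^ 2 * (1 - (1 + 2 * γ) * z + (γ ^ 2 + 2 * γ) * z ^ 2)) := by
    ring
  rw [e]
  have hz4 : (1 + 2 * γ) * z ≤ 1 / 4 := by
    have : 4 * (1 + 2 * γ) ≤ M := by nlinarith
    nlinarith
  have hz8 : z ≤ 1 / 8 := by nlinarith
  have hb : 1 / 2 ≤ 1 - (1 + 2 * γ) * z + (γ ^ 2 + 2 * γ) * z ^ 2 := by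
    have : -1 ≤ γ ^ 2 + 2 * γ := by nlinarith [sq_nonneg (γ + 1)]
    have : z ^ 2 ≤ 1 / 64 := by nlinarith
    nlinarith [sq_nonneg z]
  have : (γ - γ ^ 2) ≤ M ^ 2 / 2 := by nlinarith [sq_nonneg γ]
  refine mul_nonpos_of_nonneg_of_nonpos (sq_nonneg z) ?_
  nlinarith [sq_nonneg M]

lemma exists_errD_nonneg {γ : ℝ} (hγ : -(1 / 2 : ℝ) < γ) :
    ∃ δ : ℝ, 0 ≤ δ ∧ ∀ S, 0 ≤ S → 0 ≤ errD γ 1 δ S := by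
  set b := min (1 / 2) ((1 + 2 * γ) / 8) with hb
  have hb0 : 0 < b := lt_min (by norm_num) (by linarith)
  set K := 3 * |γ| + 2 * |γ| ^ 2 + 2 + |γ| ^ 2 + 2 * |γ| with hK
  have hK0 : 0 ≤ K := by positivity
  refine ⟨K / b, by positivity, fun S hS => ?_⟩
  obtain ⟨m, z, h1, h2, h3, h4, h5, h6, h7⟩ := exists_sq_param le_rfl hS
  have hm : 0 < m := by linarith
  rw [errD_eq γ 1 _ S hm h7 h6]
  set δ := K / b with hδ
  have hδ0 : 0 ≤ δ := by positivity
  have e : (1 + 2 * γ) * (z - γ * z ^ 2 + δ * z ^ 3)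
      + (1 - (1 * z) ^ 2) * ((1 - γ * z + δ * z ^ 2) ^ 2 - z + 2 * γ * z ^ 2 - 3 * δ * z ^ 3) - 1
      = z ^ 2 * ((γ - γ ^ 2 - 1 + (1 + 2 * γ) * z - (γ ^ 2 + 2 * γ) * z ^ 2)
        + δ * ((1 + 2 * γ) * z ^ 3 + 2 * (1 - z) ^ 2 * (1 + z))
        + δ ^ 2 * (1 - z ^ 2) * z ^ 2) := by ring
  rw [e]
  have hB : b ≤ (1 + 2 * γ) * z ^ 3 + 2 * (1 - z) ^ 2 * (1 + z) := by
    rcases le_total z (1 / 2) with h | h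
    · refine (min_le_left _ _).trans ?_
      have : 0 ≤ (1 + 2 * γ) * z ^ 3 := mul_nonneg (by linarith) (by positivity)
      have h9 : 1 / 4 ≤ (1 - z) ^ 2 := by nlinarith
      have h10 : 1 / 4 * 1 ≤ (1 - z) ^ 2 * (1 + z) :=
        mul_le_mul h9 (by linarith) zero_le_one (by positivity)
      linarith
    · refine (min_le_right _ _).trans ?_
      have h8 : (1 / 2 : ℝ) ^ 3 ≤ z ^ 3 := by gcongr
      have h9 : 0 ≤ 2 * (1 - z) ^ 2 * (1 + z) := by positivity
      have h10 : (1 + 2 * γ) * (1 / 2) ^ 3 ≤ (1 + 2 * γ) * z ^ 3 :=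
        mul_le_mul_of_nonneg_left h8 (by linarith)
      linarith
  have hδb : K ≤ δ * ((1 + 2 * γ) * z ^ 3 + 2 * (1 - z) ^ 2 * (1 + z)) := by
    calc K = δ * b := by rw [hδ]; field_simp
      _ ≤ _ := by gcongr
  have hA : -K ≤ γ - γ ^ 2 - 1 + (1 + 2 * γ) * z - (γ ^ 2 + 2 * γ) * z ^ 2 := by
    have hg := neg_abs_le γ
    have hg' := le_abs_self γ
    have hg2 : γ ^ 2 = |γ| ^ 2 := (sq_abs γ).symm
    have : 0 ≤ (1 + 2 * γ) * z := mul_nonneg (by linarith) h2.le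
    have hz2 : z ^ 2 ≤ 1 := by nlinarith
    have : (γ ^ 2 + 2 * γ) * z ^ 2 ≤ |γ| ^ 2 + 2 * |γ| := by
      have h9 : (γ ^ 2 + 2 * γ) ≤ |γ| ^ 2 + 2 * |γ| := by linarith
      have h10 : 0 ≤ |γ| ^ 2 + 2 * |γ| := by positivity
      calc (γ ^ 2 + 2 * γ) * z ^ 2 ≤ (|γ| ^ 2 + 2 * |γ|) * z ^ 2 := by gcongr
        _ ≤ (|γ| ^ 2 + 2 * |γ|) * 1 := by gcongr
        _ = _ := mul_one _
    linarith [abs_nonneg γ, sq_nonneg |γ|]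
  refine mul_nonneg (sq_nonneg z) ?_
  have : 0 ≤ δ ^ 2 * (1 - z ^ 2) * z ^ 2 :=
    mul_nonneg (mul_nonneg (sq_nonneg _) (by nlinarith)) (sq_nonneg _)
  linarith

/-- The height `√(1 - |x|²)`. -/
def bw {n : ℕ} (x : Fin n → ℝ) : ℝ := √(1 - nsq x)

/-- The cosine of the distance `ballDist`. -/
def bk {n : ℕ} (x y : Fin n → ℝ) : ℝ := dotp x y + bw x * bw y

lemma bw_nonneg {n : ℕ} (x : Fin n → ℝ) : 0 ≤ bw x := Real.sqrt_nonneg _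

lemma bw_sq {n : ℕ} {x : Fin n → ℝ} (hx : x ∈ cBall n) : bw x ^ 2 = 1 - nsq x :=
  Real.sq_sqrt (by linarith [nsq_le_one hx])

lemma bw_le_one {n : ℕ} (x : Fin n → ℝ) : bw x ≤ 1 := by
  exact Real.sqrt_le_iff.2 ⟨zero_le_one, by linarith [nsq_nonneg x]⟩

lemma bk_comm {n : ℕ} (x y : Fin n → ℝ) : bk x y = bk y x := by
  rw [bk, bk, dotp_comm, mul_comm (bw x)]

lemma one_sub_bk {n : ℕ} {x y : Fin n → ℝ} (hx : x ∈ cBall n) (hy : y ∈ cBall n) :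
    1 - bk x y = (nsq (x - y) + (bw x - bw y) ^ 2) / 2 := by
  have h : nsq (x - y) = nsq x - 2 * dotp x y + nsq y := by
    rw [nsq, nsq, nsq, dotp, Finset.mul_sum, ← Finset.sum_sub_distrib, ← Finset.sum_add_distrib]
    exact Finset.sum_congr rfl fun i _ => by simp; ring
  rw [h, bk]
  linear_combination (-1 / 2) * bw_sq hx - (1 / 2) * bw_sq hy

lemma bk_le_one {n : ℕ} {x y : Fin n → ℝ} (hx : x ∈ cBall n) (hy : y ∈ cBall n) : bk x y ≤ 1 := by
  have := one_sub_bk hx hy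
  nlinarith [nsq_nonneg (x - y), sq_nonneg (bw x - bw y)]

/-- The factor `(1 + w(x) w(y) / t)^(-γ)`. -/
def wfac {n : ℕ} (γ t : ℝ) (x y : Fin n → ℝ) : ℝ := (1 + bw x * bw y / t) ^ (-γ)

lemma wfac_pos {n : ℕ} (γ : ℝ) {t : ℝ} (ht : 0 < t) (x y : Fin n → ℝ) : 0 < wfac γ t x y := by
  have := mul_nonneg (bw_nonneg x) (bw_nonneg y)
  exact Real.rpow_pos_of_pos (by positivity) _

lemma wfac_comm {n : ℕ} (γ t : ℝ) (x y : Fin n → ℝ) : wfac γ t x y = wfac γ t y x := by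
  rw [wfac, wfac, mul_comm (bw x)]

/-- The model Gaussian. -/
def gau {n : ℕ} (γ c a t : ℝ) (x y : Fin n → ℝ) : ℝ :=
  t ^ (-a) * Real.exp (-((1 - bk x y) / (c * t))) * wfac γ t x y

lemma gau_pos {n : ℕ} (γ c a : ℝ) {t : ℝ} (ht : 0 < t) (x y : Fin n → ℝ) :
    0 < gau γ c a t x y :=
  mul_pos (mul_pos (Real.rpow_pos_of_pos ht _) (Real.exp_pos _)) (wfac_pos γ ht x y)

/-- The bounded exponent error in `parU_eq_gau`. -/
def parC (γ M δ c : ℝ) : ℝ := Real.exp (M + δ + |γ| * (|log (M + 1 / c)| + log (1 + c)))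

lemma one_le_parC {γ M δ c : ℝ} (hM : 1 ≤ M) (hδ : 0 ≤ δ) (hc : 0 < c) : 1 ≤ parC γ M δ c := by
  refine Real.one_le_exp ?_
  have := Real.log_nonneg (by linarith : 1 ≤ 1 + c)
  positivity

lemma parU_eq_gau {n : ℕ} (γ a : ℝ) {M δ c t : ℝ} (hM : 1 ≤ M) (hδ : 0 ≤ δ) (hc : 0 < c)
    (ht : 0 < t) {x y : Fin n → ℝ} (hx : x ∈ cBall n) (hy : y ∈ cBall n) :
    ∃ e : ℝ, |e| ≤ M + δ + |γ| * (|log (M + 1 / c)| + log (1 + c)) ∧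
      parU γ M δ c a y t x = gau γ c a t x y * Real.exp e := by
  have hww := mul_nonneg (bw_nonneg x) (bw_nonneg y)
  set p := 1 + bw x * bw y / t with hp
  have hp1 : 1 ≤ p := by rw [hp]; linarith [div_nonneg hww ht.le]
  set S := (1 - nsq y) / (c * t) ^ 2 * (1 - nsq x) with hSdef
  have hS : S = (bw x * bw y / (c * t)) ^ 2 := by
    rw [hSdef, ← bw_sq hx, ← bw_sq hy]; field_simp
  have hr0 : 0 ≤ bw x * bw y / (c * t) := by positivity
  set r := bw x * bw y / (c * t) with hr
  have hpr : p = 1 + c * r := by rw [hp, hr]; field_simp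
  set m := √(M ^ 2 + S) with hm
  have hm2 : m ^ 2 = M ^ 2 + S := Real.sq_sqrt (by rw [hS]; positivity)
  have hmM : M ≤ m := Real.le_sqrt_of_sq_le (by rw [hS]; nlinarith [sq_nonneg r])
  have hmr : r ≤ m := Real.le_sqrt_of_sq_le (by rw [hS]; nlinarith [sq_nonneg M])
  have hmu : m ≤ M + r := by
    rw [hm, Real.sqrt_le_left (by linarith), hS]; nlinarith [mul_nonneg (by linarith : 0 ≤ M) hr0]
  have hm0 : 0 < m := by linarith
  have hlogτ : log (M ^ 2 + S) = 2 * log m := by rw [← hm2, Real.log_pow]; norm_num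
  have hl1 : log m - log p ≤ |log (M + 1 / c)| := by
    rw [← Real.log_div hm0.ne' (by linarith)]
    refine (Real.log_le_log (div_pos hm0 (by linarith)) ?_).trans (le_abs_self _)
    rw [div_le_iff₀ (by linarith), hpr]
    have h1 : 1 / c * (c * r) = r := by field_simp
    have h2 : 0 ≤ M * (c * r) := by positivity
    have h3 : 0 < 1 / c := by positivity
    nlinarith
  have hl2 : log p - log m ≤ log (1 + c) := by
    rw [← Real.log_div (by linarith) hm0.ne']
    refine Real.log_le_log (div_pos (by linarith) hm0) ?_
    rw [div_le_iff₀ hm0, hpr]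
    nlinarith
  have hL2 := Real.log_nonneg (by linarith : 1 ≤ 1 + c)
  have hLabs : |log m - log p| ≤ |log (M + 1 / c)| + log (1 + c) := by
    rw [abs_le]; constructor <;> linarith [abs_nonneg (log (M + 1 / c))]
  refine ⟨m - r - δ / m - γ * (log m - log p), ?_, ?_⟩
  · have h1 : |γ * (log m - log p)| ≤ |γ| * (|log (M + 1 / c)| + log (1 + c)) := by
      rw [abs_mul]; gcongr
    have h2 : 0 ≤ δ / m := by positivity
    have h3 : δ / m ≤ δ := div_le_self hδ (by linarith)
    have h4 := abs_le.1 h1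
    rw [abs_le]
    constructor <;> linarith
  · rw [gau, wfac, ← hp, Real.rpow_def_of_pos ht, Real.rpow_def_of_pos (by linarith : 0 < p),
      ← Real.exp_add, ← Real.exp_add, ← Real.exp_add, parU, parG, prof, ← hSdef, ← hm, hlogτ]
    congr 1
    have : (1 - bk x y) / (c * t) = (1 - dotp x y) / (c * t) - r := by rw [bk, hr]; ring
    rw [this]
    ring

lemma parU_le_gau {n : ℕ} (γ a : ℝ) {M δ c t : ℝ} (hM : 1 ≤ M) (hδ : 0 ≤ δ) (hc : 0 < c)
    (ht : 0 < t) {x y : Fin n → ℝ} (hx : x ∈ cBall n) (hy : y ∈ cBall n) :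
    parU γ M δ c a y t x ≤ parC γ M δ c * gau γ c a t x y := by
  obtain ⟨e, he, h⟩ := parU_eq_gau γ a hM hδ hc ht hx hy
  rw [h, mul_comm]
  exact mul_le_mul_of_nonneg_right (Real.exp_le_exp.2 ((le_abs_self e).trans he))
    (gau_pos γ c a ht x y).le

lemma gau_le_parU {n : ℕ} (γ a : ℝ) {M δ c t : ℝ} (hM : 1 ≤ M) (hδ : 0 ≤ δ) (hc : 0 < c)
    (ht : 0 < t) {x y : Fin n → ℝ} (hx : x ∈ cBall n) (hy : y ∈ cBall n) :
    gau γ c a t x y ≤ parC γ M δ c * parU γ M δ c a y t x := by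
  obtain ⟨e, he, h⟩ := parU_eq_gau γ a hM hδ hc ht hx hy
  rw [h, ← mul_assoc, mul_comm (parC _ _ _ _), mul_assoc]
  refine le_mul_of_one_le_right (gau_pos γ c a ht x y).le ?_
  rw [parC, ← Real.exp_add]
  exact Real.one_le_exp (by linarith [neg_abs_le e])

lemma parU_comm {n : ℕ} (γ M δ c a t : ℝ) (x y : Fin n → ℝ) :
    parU γ M δ c a y t x = parU γ M δ c a x t y := by
  rw [parU, parU, parG, parG, dotp_comm, div_mul_eq_mul_div, div_mul_eq_mul_div,
    mul_comm (1 - nsq y)]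

lemma continuousOn_parU {n : ℕ} (γ δ a : ℝ) {M c : ℝ} (hM : 0 < M) (hc : 0 < c)
    {y : Fin n → ℝ} (hy : y ∈ cBall n) :
    ContinuousOn (fun p : ℝ × (Fin n → ℝ) => parU γ M δ c a y p.1 p.2)
      (Set.Ioi 0 ×ˢ cBall n) := by
  intro p hp
  obtain ⟨ht, hx⟩ := hp
  have ht : 0 < p.1 := ht
  have hct : c * p.1 ≠ 0 := by positivity
  refine ContinuousAt.continuousWithinAt ?_
  have hτ : 0 < M ^ 2 + (1 - nsq y) / (c * p.1) ^ 2 * (1 - nsq p.2) := by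
    have : 0 ≤ (1 - nsq y) / (c * p.1) ^ 2 * (1 - nsq p.2) :=
      mul_nonneg (div_nonneg (by linarith [nsq_le_one hy]) (by positivity))
        (by linarith [nsq_le_one hx])
    positivity
  have h1 : ContinuousAt (fun q : ℝ × (Fin n → ℝ) =>
      M ^ 2 + (1 - nsq y) / (c * q.1) ^ 2 * (1 - nsq q.2)) p := by
    refine continuousAt_const.add (ContinuousAt.mul ?_ (by fun_prop))
    exact continuousAt_const.div (by fun_prop) (pow_ne_zero 2 hct)
  have h2 : ContinuousAt (fun q : ℝ × (Fin n → ℝ) => dotp q.2 y) p := by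
    unfold dotp; fun_prop
  refine ContinuousAt.rexp (((continuousAt_const.mul
    ((Real.continuousAt_log ht.ne').comp continuousAt_fst)).sub
    ((continuousAt_const.sub h2).div (by fun_prop) hct)).add ?_)
  exact ContinuousAt.comp (f := fun q : ℝ × (Fin n → ℝ) =>
    M ^ 2 + (1 - nsq y) / (c * q.1) ^ 2 * (1 - nsq q.2)) (g := prof γ δ)
    (hasDerivAt_prof γ δ hτ).continuousAt h1

/-- A Gaussian supersolution `U` and subsolution `v` of the heat equation on the ball. -/
structure Barrier (n : ℕ) (γ : ℝ) where
  /-- the supersolution -/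
  U : ℝ → (Fin n → ℝ) → (Fin n → ℝ) → ℝ
  /-- the subsolution -/
  v : ℝ → (Fin n → ℝ) → (Fin n → ℝ) → ℝ
  /-- the comparison constant -/
  C : ℝ
  /-- the time up to which `v` is a subsolution -/
  t₁ : ℝ
  hC : 1 ≤ C
  ht₁ : 0 < t₁
  ht₁' : t₁ ≤ 1
  U_pos : ∀ t x y, 0 < U t x y
  U_comm : ∀ t x y, U t x y = U t y x
  v_comm : ∀ t x y, v t x y = v t y x
  U_cont : ∀ y ∈ cBall n, ContinuousOn (fun p : ℝ × (Fin n → ℝ) => U p.1 p.2 y)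
    (Set.Ioi 0 ×ˢ cBall n)
  v_cont : ∀ y ∈ cBall n, ContinuousOn (fun p : ℝ × (Fin n → ℝ) => v p.1 p.2 y)
    (Set.Ioi 0 ×ˢ cBall n)
  U_super : ∀ y ∈ cBall n, ∀ t, 0 < t → ∀ x ∈ cBall n, ∃ d ℓ,
    HasDerivAt (fun s => U s x y) d t ∧ HasGen γ (fun z => U t z y) x ℓ ∧ ℓ ≤ d
  v_sub : ∀ y ∈ cBall n, ∀ t, 0 < t → t ≤ t₁ → ∀ x ∈ cBall n, ∃ d ℓ,
    HasDerivAt (fun s => v s x y) d t ∧ HasGen γ (fun z => v t z y) x ℓ ∧ d ≤ ℓ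
  U_le : ∀ x ∈ cBall n, ∀ y ∈ cBall n, ∀ t, 0 < t → t ≤ 1 →
    U t x y ≤ C * gau γ 2 ((n + 2 * γ) / 2) t x y
  v_le : ∀ x ∈ cBall n, ∀ y ∈ cBall n, ∀ t, 0 < t → t ≤ 1 →
    v t x y ≤ C * gau γ 2 ((n + 2 * γ) / 2) t x y
  le_U : ∀ x ∈ cBall n, ∀ y ∈ cBall n, ∀ t, 0 < t →
    gau γ 2 ((n + 2 * γ) / 2) t x y ≤ C * U t x y
  le_v : ∀ x ∈ cBall n, ∀ y ∈ cBall n, ∀ t, 0 < t → t ≤ t₁ → 1 - bk x y ≤ t →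
    t ^ (-((n + 2 * γ) / 2)) * wfac γ t x y ≤ C * v t x y

lemma exists_supersolution (n : ℕ) {γ : ℝ} (hγ : -(1 / 2 : ℝ) < γ) :
    ∃ M b : ℝ, 1 ≤ M ∧ 0 ≤ b ∧ ∀ y ∈ cBall n, ∀ t, 0 < t → ∀ x ∈ cBall n, ∃ d ℓ,
      HasDerivAt (fun s => Real.exp (b * s) * parU γ M 0 2 ((n + 2 * γ) / 2) y s x) d t ∧
      HasGen γ (fun z => Real.exp (b * t) * parU γ M 0 2 ((n + 2 * γ) / 2) y t z) x ℓ ∧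
      ℓ ≤ d := by
  obtain ⟨M, hM, hD⟩ := exists_errD_nonpos hγ
  refine ⟨M, (n + 2 * γ) ^ 2 / 4 + (3 * |γ| + 5 * 0 + M), hM, by positivity,
    fun y hy t ht x hx => ?_⟩
  set b := ((n : ℝ) + 2 * γ) ^ 2 / 4 + (3 * |γ| + 5 * 0 + M) with hb
  obtain ⟨d, ℓ, h1, h2, h3⟩ := parU_spec γ 0 ((n + 2 * γ) / 2) (by linarith : 0 < M)
    two_pos ht hx hy
  have hexp : HasDerivAt (fun s => Real.exp (b * s)) (b * Real.exp (b * t)) t := by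
    have := ((hasDerivAt_id' t).const_mul b).exp
    refine this.congr_deriv ?_
    ring
  refine ⟨_, _, hexp.fun_mul h1, h2.const_mul _, ?_⟩
  set σ := (1 - nsq y) / (2 * t) ^ 2 with hσ
  have hσ0 : 0 ≤ σ := div_nonneg (by linarith [nsq_le_one hy]) (by positivity)
  set S := σ * (1 - nsq x) with hSdef
  have hS : 0 ≤ S := mul_nonneg hσ0 (by linarith [nsq_le_one hx])
  have h4 := h3 _ σ S _ rfl rfl rfl rfl
  set Y := 1 / (2 * t) - 1 / (2 * t) * dotp x y - kap γ M 0 S with hY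
  have hR := (abs_le.1 (abs_errR_le γ hM le_rfl hS)).1
  have hDS := mul_nonpos_of_nonneg_of_nonpos hσ0 (hD S hS)
  have h5 : -b ≤ Y ^ 2 + (2 - 2) * (1 / (2 * t)) * Y - (n + 2 * γ) * Y
      + (n + 2 * γ - (n + 2 * γ) / 2 * 2) * (1 / (2 * t)) + errR γ M 0 S - σ * errD γ M 0 S := by
    have h6 : (n + 2 * γ - (n + 2 * γ) / 2 * 2) * (1 / (2 * t)) = 0 := by ring
    rw [h6, hb]
    nlinarith [sq_nonneg (Y - (n + 2 * γ) / 2)]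
  have h7 := mul_le_mul_of_nonneg_left h5 (parU_pos γ M 0 2 ((n + 2 * γ) / 2) y t x).le
  rw [← h4] at h7
  have h8 := Real.exp_pos (b * t)
  nlinarith

lemma one_add_sq_mul_exp_le {θ z : ℝ} (hθ : 0 < θ) (hz : 0 ≤ z) :
    (1 + z ^ 2) * Real.exp (-z) ≤ (1 + 2 / θ ^ 2) * Real.exp (-((1 - θ) * z)) := by
  have h1 := Real.quadratic_le_exp_of_nonneg (by positivity : 0 ≤ θ * z)
  have h2 : 1 + z ^ 2 ≤ (1 + 2 / θ ^ 2) * Real.exp (θ * z) := by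
    calc 1 + z ^ 2 ≤ (1 + 2 / θ ^ 2) * (1 + (θ * z) ^ 2 / 2) := by
          have : 2 / θ ^ 2 * ((θ * z) ^ 2 / 2) = z ^ 2 := by field_simp
          have h3 : 0 < 2 / θ ^ 2 := by positivity
          nlinarith [sq_nonneg (θ * z)]
      _ ≤ _ := by
          have : 0 ≤ θ * z := by positivity
          gcongr
          linarith
  have h3 : Real.exp (-((1 - θ) * z)) = Real.exp (θ * z) * Real.exp (-z) := by
    rw [← Real.exp_add]; congr 1; ring
  rw [h3, ← mul_assoc]
  exact mul_le_mul_of_nonneg_right h2 (Real.exp_pos _).le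

lemma sqrt_profile {n : ℕ} {x y : Fin n → ℝ} (hx : x ∈ cBall n) (hy : y ∈ cBall n) {r : ℝ}
    (hr : 0 < r) : √((1 - nsq y) / r ^ 2 * (1 - nsq x)) = bw x * bw y / r := by
  have h : (1 - nsq y) / r ^ 2 * (1 - nsq x) = (bw x * bw y / r) ^ 2 := by
    rw [← bw_sq hx, ← bw_sq hy]; field_simp
  rw [h, Real.sqrt_sq]
  exact div_nonneg (mul_nonneg (bw_nonneg x) (bw_nonneg y)) hr.le

lemma subsolution_error_le {N z e E R R₀ D β : ℝ} (he : e ^ 2 ≤ E ^ 2) (hR : R ≤ R₀)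
    (hR₀ : 0 ≤ R₀) (hD : 0 ≤ D) :
    (z - e) ^ 2 + (2 - 2) * β * (z - e) - N * (z - e) + (N - N / 2 * 2) * β + R - D
      ≤ (4 * E ^ 2 + N ^ 2 / 4 + R₀ + 4) * (1 + z ^ 2) := by
  have h7 : (z - e) ^ 2 ≤ 2 * z ^ 2 + 2 * e ^ 2 := by nlinarith [sq_nonneg (z + e)]
  have h8 : -N * (z - e) ≤ (z - e) ^ 2 + N ^ 2 / 4 := by nlinarith [sq_nonneg (z - e + N / 2)]
  have h9 : 0 ≤ (4 * E ^ 2 + N ^ 2 / 4 + R₀) * z ^ 2 := by positivity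
  linarith

lemma le_supersolution_error {N Y β ε Ck R R₀ D c : ℝ} (hε0 : 0 ≤ ε) (hβ0 : 0 < β)
    (hc : c = 2 + ε) (hYl : -Ck ≤ Y) (hεN : ε * (|N| + Ck) ≤ 1)
    (hβK : 2 * (N ^ 2 / 4 + R₀) ≤ β) (hR : -R₀ ≤ R) (hD : D ≤ 0) :
    β / 2 ≤ Y ^ 2 + (c - 2) * β * Y - N * Y + (N - (N / 2 - 1) * c) * β + R - D := by
  have h6 : (c - 2) * β * Y ≥ -(ε * Ck) * β := by
    have : c - 2 = ε := by rw [hc]; ring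
    rw [this]
    have : 0 ≤ ε * β * (Y + Ck) := mul_nonneg (by positivity) (by linarith)
    linarith
  have h7 : (N - (N / 2 - 1) * c) * β ≥ (2 + ε - ε * |N|) * β := by
    refine mul_le_mul_of_nonneg_right ?_ hβ0.le
    rw [hc]
    have : ε * N ≤ ε * |N| := by gcongr; exact le_abs_self N
    have : 0 ≤ ε * |N| := by positivity
    linarith
  have h8 : (2 + ε - ε * |N|) * β - ε * Ck * β ≥ β := by
    have : 0 ≤ (1 + ε - ε * (|N| + Ck)) * β := mul_nonneg (by linarith) hβ0.le
    linarith
  have h9 : Y ^ 2 - N * Y ≥ -(N ^ 2 / 4) := by nlinarith [sq_nonneg (Y - N / 2)]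
  linarith

set_option maxHeartbeats 800000 in
lemma exists_subsolution (n : ℕ) {γ : ℝ} (hγ : -(1 / 2 : ℝ) < γ) :
    ∃ M δ c K t₀ : ℝ, 1 ≤ M ∧ 0 ≤ δ ∧ 0 < c ∧ 0 ≤ K ∧ 0 < t₀ ∧
      ∀ y ∈ cBall n, ∀ t, 0 < t → t ≤ t₀ → ∀ x ∈ cBall n, ∃ d ℓ,
      HasDerivAt (fun s => parU γ 1 δ 2 ((n + 2 * γ) / 2) y s x
        + -K * parU γ M 0 c ((n + 2 * γ) / 2 - 1) y s x) d t ∧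
      HasGen γ (fun z => parU γ 1 δ 2 ((n + 2 * γ) / 2) y t z
        + -K * parU γ M 0 c ((n + 2 * γ) / 2 - 1) y t z) x ℓ ∧
      d ≤ ℓ := by
  obtain ⟨M, hM, hDM⟩ := exists_errD_nonpos hγ
  obtain ⟨δ, hδ, hDδ⟩ := exists_errD_nonneg hγ
  set N : ℝ := n + 2 * γ with hN
  set Ck := 2 * M + |γ| + 0 with hCk
  have hCk0 : 0 ≤ Ck := by positivity
  set ε := 1 / (|N| + Ck + 1) with hε
  have hε0 : 0 < ε := by positivity
  have hεN : ε * (|N| + Ck) ≤ 1 := by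
    rw [hε, div_mul_eq_mul_div, div_le_one (by positivity)]; linarith
  set c := 2 + ε with hc
  have hc0 : 0 < c := by positivity
  set θ := ε / c with hθ
  have hθ0 : 0 < θ := by positivity
  set K₁ := 4 * (2 * 1 + |γ| + δ) ^ 2 + N ^ 2 / 4 + (3 * |γ| + 5 * δ + 1) with hK₁
  have hK₁0 : 0 ≤ K₁ := by positivity
  set K₂ := (K₁ + 4) * parC γ 1 δ 2 * (1 + 2 / θ ^ 2) with hK₂
  have hC1 := one_le_parC (γ := γ) le_rfl hδ two_pos
  have hC2 := one_le_parC (γ := γ) hM le_rfl hc0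
  have hK₂0 : 0 ≤ K₂ := by positivity
  set K₃ := N ^ 2 / 4 + (3 * |γ| + 5 * 0 + M) with hK₃
  have hK₃0 : 0 < K₃ := by positivity
  set K := K₂ * (2 * c * parC γ M 0 c) with hK
  refine ⟨M, δ, c, K, 1 / (c * (2 * K₃)), hM, hδ, hc0, by positivity, by positivity,
    fun y hy t ht htt x hx => ?_⟩
  have hx' := nsq_le_one hx
  have hy' := nsq_le_one hy
  obtain ⟨d₁, ℓ₁, h1, h2, h3⟩ := parU_spec γ δ (N / 2) one_pos two_pos ht hx hy
  obtain ⟨d₂, ℓ₂, h1', h2', h3'⟩ := parU_spec γ 0 (N / 2 - 1) (by linarith : 0 < M) hc0 ht hx hy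
  refine ⟨_, _, h1.fun_add (h1'.const_mul (-K)), h2.add (h2'.const_mul (-K)), ?_⟩
  have hz : 0 ≤ (1 - bk x y) / (2 * t) := div_nonneg (by linarith [bk_le_one hx hy]) (by positivity)
  have hg0 := gau_pos γ c (N / 2) ht x y
  have up : d₁ - ℓ₁ ≤ K₂ * gau γ c (N / 2) t x y := by
    set z := (1 - bk x y) / (2 * t) with hzdef
    set σ := (1 - nsq y) / (2 * t) ^ 2 with hσ
    have hσ0 : 0 ≤ σ := div_nonneg (by linarith) (by positivity)
    set S := σ * (1 - nsq x) with hSdef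
    have hS : 0 ≤ S := mul_nonneg hσ0 (by linarith)
    have hsq : √S = bw x * bw y / (2 * t) :=
      sqrt_profile hx hy (by positivity)
    have h4 := h3 _ σ S _ rfl rfl rfl rfl
    set Y := 1 / (2 * t) - 1 / (2 * t) * dotp x y - kap γ 1 δ S with hY
    have hYz : Y = z - (kap γ 1 δ S - √S) := by rw [hY, hzdef, hsq, bk]; ring
    have hk := abs_kap_sub_le γ le_rfl hδ hS
    set e := kap γ 1 δ S - √S with he
    have he2 : e ^ 2 ≤ (2 * 1 + |γ| + δ) ^ 2 := sq_le_sq' (abs_le.1 hk).1 (abs_le.1 hk).2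
    have hR := (abs_le.1 (abs_errR_le γ le_rfl hδ hS)).2
    have hDS := mul_nonneg hσ0 (hDδ S hS)
    have h5 : Y ^ 2 + (2 - 2) * (1 / (2 * t)) * Y - N * Y
        + (N - N / 2 * 2) * (1 / (2 * t)) + errR γ 1 δ S - σ * errD γ 1 δ S
        ≤ (K₁ + 4) * (1 + z ^ 2) := by
      rw [hYz]
      exact subsolution_error_le he2 hR (by positivity) hDS
    rw [h4]
    refine (mul_le_mul_of_nonneg_left h5 (parU_pos _ _ _ _ _ _ _ _).le).trans ?_
    have h10 := parU_le_gau γ (N / 2) le_rfl hδ two_pos ht hx hy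
    refine (mul_le_mul_of_nonneg_right h10 (by positivity)).trans ?_
    have h11 := one_add_sq_mul_exp_le hθ0 hz
    have h12 : (1 - θ) * z = (1 - bk x y) / (c * t) := by
      rw [hzdef, hθ]
      have : 1 - ε / c = 2 / c := by field_simp; rw [hc]; ring
      rw [this]; field_simp
    rw [h12] at h11
    rw [gau, gau, hK₂, ← hzdef]
    have h13 : 0 ≤ (K₁ + 4) * parC γ 1 δ 2 * (t ^ (-(N / 2)) * wfac γ t x y) := by
      have := wfac_pos γ ht x y
      positivity
    have := mul_le_mul_of_nonneg_left h11 h13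
    linarith
  have low : gau γ c (N / 2) t x y / (2 * c * parC γ M 0 c) ≤ d₂ - ℓ₂ := by
    set σ := (1 - nsq y) / (c * t) ^ 2 with hσ
    have hσ0 : 0 ≤ σ := div_nonneg (by linarith) (by positivity)
    set S := σ * (1 - nsq x) with hSdef
    have hS : 0 ≤ S := mul_nonneg hσ0 (by linarith)
    have hsq : √S = bw x * bw y / (c * t) :=
      sqrt_profile hx hy (by positivity)
    have h4 := h3' _ σ S _ rfl rfl rfl rfl
    set β := 1 / (c * t) with hβ
    have hβ0 : 0 < β := by positivity
    set Y := β - β * dotp x y - kap γ M 0 S with hY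
    have hYz : Y = β * (1 - bk x y) - (kap γ M 0 S - √S) := by rw [hY, hβ, hsq, bk]; ring
    have hk := (abs_le.1 (abs_kap_sub_le γ hM le_rfl hS)).2
    have hYl : -Ck ≤ Y := by
      have : 0 ≤ β * (1 - bk x y) := mul_nonneg hβ0.le (by linarith [bk_le_one hx hy])
      rw [hYz]; linarith
    have hβK : 2 * K₃ ≤ β := by
      rw [hβ, le_div_iff₀ (by positivity)]
      rw [le_div_iff₀ (by positivity)] at htt
      linarith
    have hR := (abs_le.1 (abs_errR_le γ hM le_rfl hS)).1
    have hDS := mul_nonpos_of_nonneg_of_nonpos hσ0 (hDM S hS)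
    have h5 : β / 2 ≤ Y ^ 2 + (c - 2) * β * Y - N * Y
        + (N - (N / 2 - 1) * c) * β + errR γ M 0 S - σ * errD γ M 0 S := by
      exact le_supersolution_error hε0.le hβ0 hc hYl hεN hβK hR hDS
    rw [h4]
    refine le_trans ?_ (mul_le_mul_of_nonneg_left h5 (parU_pos _ _ _ _ _ _ _ _).le)
    have h10 := gau_le_parU γ (N / 2 - 1) hM le_rfl hc0 ht hx hy
    have h11 : gau γ c (N / 2 - 1) t x y = t * gau γ c (N / 2) t x y := by
      rw [gau, gau, show -(N / 2 - 1) = 1 + -(N / 2) by ring, Real.rpow_add ht, Real.rpow_one]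
      ring
    rw [h11] at h10
    rw [div_le_iff₀ (by positivity), hβ]
    calc gau γ c (N / 2) t x y = (t * gau γ c (N / 2) t x y) * (1 / t) := by field_simp
      _ ≤ (parC γ M 0 c * parU γ M 0 c (N / 2 - 1) y t x) * (1 / t) := by gcongr
      _ = _ := by field_simp
  have h14 : K * (d₂ - ℓ₂) ≥ K₂ * gau γ c (N / 2) t x y := by
    have h15 : 0 ≤ K := by positivity
    have h16 := mul_le_mul_of_nonneg_left low h15
    refine le_trans (le_of_eq ?_) h16
    rw [hK]
    have : parC γ M 0 c ≠ 0 := by positivity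
    field_simp
  linarith

lemma nonempty_barrier (n : ℕ) {γ : ℝ} (hγ : -(1 / 2 : ℝ) < γ) : Nonempty (Barrier n γ) := by
  obtain ⟨M, b, hM, hb, hU⟩ := exists_supersolution n hγ
  obtain ⟨M', δ, c, K, t₀, hM', hδ, hc, hK, ht₀, hv⟩ := exists_subsolution n hγ
  set N : ℝ := n + 2 * γ with hN
  have hC0 := one_le_parC (γ := γ) hM le_rfl two_pos
  have hC1 := one_le_parC (γ := γ) le_rfl hδ two_pos
  have hC2 := one_le_parC (γ := γ) hM' le_rfl hc
  set C₀ := parC γ M 0 2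
  set C₁ := parC γ 1 δ 2
  set C₂ := parC γ M' 0 c
  set q := Real.exp (-(1 / 2)) with hq
  have hq0 : 0 < q := Real.exp_pos _
  have hq1 : q ≤ 1 := Real.exp_le_one_iff.2 (by norm_num)
  set s := q / (2 * C₁ * (K + 1) * C₂) with hs
  have hs0 : 0 < s := by positivity
  have heb : 1 ≤ Real.exp b := Real.one_le_exp hb
  have hC1q : 1 ≤ 2 * C₁ / q := by rw [le_div_iff₀ hq0]; linarith
  refine ⟨{
    U := fun t x y => Real.exp (b * t) * parU γ M 0 2 (N / 2) y t x
    v := fun t x y => parU γ 1 δ 2 (N / 2) y t x + -K * parU γ M' 0 c (N / 2 - 1) y t x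
    C := Real.exp b * C₀ + 2 * C₁ / q
    t₁ := min 1 (min t₀ s)
    hC := by have : 0 < Real.exp b * C₀ := by positivity
             linarith
    ht₁ := by positivity
    ht₁' := min_le_left _ _
    U_pos := fun t x y => mul_pos (Real.exp_pos _) (parU_pos _ _ _ _ _ _ _ _)
    U_comm := fun t x y => by simp only [parU_comm γ M 0 2 (N / 2) t x y]
    v_comm := fun t x y => by
      simp only [parU_comm γ M' 0 c (N / 2 - 1) t x y, parU_comm γ 1 δ 2 (N / 2) t x y]
    U_cont := fun y hy => (by fun_prop : Continuous fun p : ℝ × (Fin n → ℝ) =>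
      Real.exp (b * p.1)).continuousOn.mul (continuousOn_parU γ 0 (N / 2) (by linarith) two_pos hy)
    v_cont := fun y hy => (continuousOn_parU γ δ (N / 2) one_pos two_pos hy).add
      (continuousOn_const.mul (continuousOn_parU γ 0 (N / 2 - 1) (by linarith) hc hy))
    U_super := hU
    v_sub := fun y hy t ht htt => hv y hy t ht
      (htt.trans ((min_le_right _ _).trans (min_le_left _ _)))
    U_le := ?_
    v_le := ?_
    le_U := ?_
    le_v := ?_ }⟩
  · intro x hx y hy t ht ht1
    have h := parU_le_gau γ (N / 2) hM le_rfl two_pos ht hx hy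
    have hg := gau_pos γ 2 (N / 2) ht x y
    have h2 : Real.exp (b * t) ≤ Real.exp b := Real.exp_le_exp.2 (by nlinarith)
    have h3 : 0 ≤ 2 * C₁ / q * gau γ 2 (N / 2) t x y := by positivity
    calc _ ≤ Real.exp b * (C₀ * gau γ 2 (N / 2) t x y) :=
          mul_le_mul h2 h (parU_pos _ _ _ _ _ _ _ _).le (by positivity)
      _ ≤ _ := by rw [add_mul]; linarith
  · intro x hx y hy t ht ht1
    have h := parU_le_gau γ (N / 2) le_rfl hδ two_pos ht hx hy
    have hg := gau_pos γ 2 (N / 2) ht x y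
    have h3 : 0 ≤ K * parU γ M' 0 c (N / 2 - 1) y t x :=
      mul_nonneg hK (parU_pos _ _ _ _ _ _ _ _).le
    have h4 : 0 ≤ Real.exp b * C₀ * gau γ 2 (N / 2) t x y := by positivity
    have h5 : C₁ ≤ 2 * C₁ / q := by
      rw [le_div_iff₀ hq0]; nlinarith
    have h6 : C₁ * gau γ 2 (N / 2) t x y ≤ 2 * C₁ / q * gau γ 2 (N / 2) t x y := by gcongr
    calc _ ≤ C₁ * gau γ 2 (N / 2) t x y := by linarith
      _ ≤ _ := by rw [add_mul]; linarith
  · intro x hx y hy t ht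
    have h := gau_le_parU γ (N / 2) hM le_rfl two_pos ht hx hy
    have h1 : 1 ≤ Real.exp (b * t) := Real.one_le_exp (by positivity)
    have hu := parU_pos γ M 0 2 (N / 2) y t x
    have h2 : C₀ ≤ Real.exp b * C₀ + 2 * C₁ / q := by
      have : C₀ ≤ Real.exp b * C₀ := by nlinarith
      linarith
    refine h.trans (mul_le_mul h2 ?_ hu.le (by positivity))
    nlinarith
  · intro x hx y hy t ht htt hbk
    have hts : t ≤ s := htt.trans ((min_le_right _ _).trans (min_le_right _ _))
    have hw := wfac_pos γ ht x y
    have hP : 0 < t ^ (-(N / 2)) * wfac γ t x y := mul_pos (Real.rpow_pos_of_pos ht _) hw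
    have h1 := gau_le_parU γ (N / 2) le_rfl hδ two_pos ht hx hy
    have h2 := parU_le_gau γ (N / 2 - 1) hM' le_rfl hc ht hx hy
    have h3 : q * (t ^ (-(N / 2)) * wfac γ t x y) ≤ gau γ 2 (N / 2) t x y := by
      have : q ≤ Real.exp (-((1 - bk x y) / (2 * t))) := by
        refine Real.exp_le_exp.2 (neg_le_neg ?_)
        rw [div_le_iff₀ (by positivity)]; linarith
      rw [gau, mul_comm q, mul_assoc, mul_assoc, mul_comm (wfac γ t x y)]
      have := (Real.rpow_pos_of_pos ht (-(N / 2)))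
      gcongr
    have h4 : gau γ c (N / 2 - 1) t x y ≤ t * (t ^ (-(N / 2)) * wfac γ t x y) := by
      have : Real.exp (-((1 - bk x y) / (c * t))) ≤ 1 := by
        refine Real.exp_le_one_iff.2 (neg_nonpos.2 (div_nonneg ?_ (by positivity)))
        linarith [bk_le_one hx hy]
      rw [gau, show -(N / 2 - 1) = 1 + -(N / 2) by ring, Real.rpow_add ht, Real.rpow_one]
      have h0 : 0 ≤ t * t ^ (-(N / 2)) * wfac γ t x y := by
        have := (Real.rpow_pos_of_pos ht (-(N / 2)))
        positivity
      nlinarith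
    set P := t ^ (-(N / 2)) * wfac γ t x y
    set u := parU γ 1 δ 2 (N / 2) y t x
    set w := parU γ M' 0 c (N / 2 - 1) y t x
    have h5 : q * P ≤ C₁ * u := h3.trans h1
    have h6 : K * w ≤ q / (2 * C₁) * P := by
      have : w ≤ C₂ * (s * P) := h2.trans (by gcongr; exact h4.trans (by gcongr))
      calc K * w ≤ (K + 1) * (C₂ * (s * P)) := by
            have : 0 < w := parU_pos _ _ _ _ _ _ _ _
            gcongr
            linarith
        _ = _ := by rw [hs]; field_simp
    have h7 : q / (2 * C₁) * P ≤ u + -K * w := by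
      have : q / C₁ * P ≤ u := by
        rw [div_mul_eq_mul_div, div_le_iff₀ (by positivity)]; linarith
      have h8 : q / C₁ * P = q / (2 * C₁) * P + q / (2 * C₁) * P := by field_simp; norm_num
      linarith
    have h9 : 0 ≤ u + -K * w := le_trans (by positivity) h7
    calc P = 2 * C₁ / q * (q / (2 * C₁) * P) := by field_simp
      _ ≤ 2 * C₁ / q * (u + -K * w) := by gcongr
      _ ≤ _ := by
        have : 0 ≤ Real.exp b * C₀ * (u + -K * w) := by positivity
        rw [add_mul]; linarith

lemma continuous_bw {n : ℕ} : Continuous (bw : (Fin n → ℝ) → ℝ) := by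
  unfold bw; fun_prop

lemma continuous_bk {n : ℕ} : Continuous fun p : (Fin n → ℝ) × (Fin n → ℝ) => bk p.1 p.2 :=
  continuous_dotp.add ((continuous_bw.comp continuous_fst).mul (continuous_bw.comp continuous_snd))

lemma measurable_ballDensity (n : ℕ) (γ : ℝ) :
    Measurable fun x : Fin n → ℝ => ENNReal.ofReal ((1 - ∑ i, (x i) ^ 2) ^ (γ - 1 / 2)) := by
  refine ENNReal.measurable_ofReal.comp (Measurable.pow_const ?_ _)
  exact (by fun_prop : Continuous fun x : Fin n → ℝ => 1 - ∑ i, (x i) ^ 2).measurable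

lemma measurableSet_oBall (n : ℕ) : MeasurableSet {x : Fin n → ℝ | (∑ i, (x i) ^ 2) < 1} :=
  (isOpen_lt (by fun_prop) continuous_const).measurableSet

lemma mem_oBall {n : ℕ} {x : Fin n → ℝ} :
    x ∈ {x : Fin n → ℝ | (∑ i, (x i) ^ 2) < 1} ↔ ∑ i, (x i) ^ 2 < 1 := Iff.rfl

lemma ae_mem_cBall (n : ℕ) (γ : ℝ) : ∀ᵐ x ∂ballMeasure n γ, x ∈ cBall n := by
  refine (withDensity_absolutelyContinuous _ _).ae_le ?_
  refine (ae_restrict_mem (measurableSet_oBall n)).mono fun x hx => ?_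
  exact mem_cBall.2 (mem_oBall.1 hx).le

lemma restrict_cBall (n : ℕ) (γ : ℝ) : (ballMeasure n γ).restrict (cBall n) = ballMeasure n γ :=
  Measure.restrict_eq_self_of_ae_mem (ae_mem_cBall n γ)

lemma exists_abs_le_of_continuousOn {n : ℕ} {f : (Fin n → ℝ) → ℝ} (hf : ContinuousOn f (cBall n)) :
    ∃ K, 0 < K ∧ ∀ x ∈ cBall n, |f x| ≤ K := by
  obtain ⟨K, hK⟩ := (isCompact_cBall n).exists_bound_of_continuousOn hf
  exact ⟨max K 1, by positivity, fun x hx => (hK x hx).trans (le_max_left _ _)⟩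

section
variable {n : ℕ} {γ : ℝ} [IsFiniteMeasure (ballMeasure n γ)]

lemma integrable_of_continuousOn {f : (Fin n → ℝ) → ℝ} (hf : ContinuousOn f (cBall n)) :
    Integrable f (ballMeasure n γ) := by
  rw [← restrict_cBall]
  exact hf.integrableOn_compact (isCompact_cBall n)

lemma bint_mono {f g : (Fin n → ℝ) → ℝ} (hf : ContinuousOn f (cBall n))
    (hg : ContinuousOn g (cBall n)) (h : ∀ x ∈ cBall n, f x ≤ g x) :
    ∫ x, f x ∂ballMeasure n γ ≤ ∫ x, g x ∂ballMeasure n γ :=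
  integral_mono_ae (integrable_of_continuousOn hf) (integrable_of_continuousOn hg)
    ((ae_mem_cBall n γ).mono h)

lemma bint_add {f g : (Fin n → ℝ) → ℝ} (hf : ContinuousOn f (cBall n))
    (hg : ContinuousOn g (cBall n)) : ∫ x, (f x + g x) ∂ballMeasure n γ
      = ∫ x, f x ∂ballMeasure n γ + ∫ x, g x ∂ballMeasure n γ :=
  integral_add (integrable_of_continuousOn hf) (integrable_of_continuousOn hg)

lemma bint_congr {n : ℕ} {γ : ℝ} {f g : (Fin n → ℝ) → ℝ} (h : ∀ x ∈ cBall n, f x = g x) :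
    ∫ x, f x ∂ballMeasure n γ = ∫ x, g x ∂ballMeasure n γ :=
  integral_congr_ae ((ae_mem_cBall n γ).mono h)

lemma bint_nonneg {n : ℕ} {γ : ℝ} {f : (Fin n → ℝ) → ℝ} (h : ∀ x ∈ cBall n, 0 ≤ f x) :
    0 ≤ ∫ x, f x ∂ballMeasure n γ :=
  integral_nonneg_of_ae ((ae_mem_cBall n γ).mono h)

lemma continuousOn_posPart {n : ℕ} {f : (Fin n → ℝ) → ℝ} {s : Set (Fin n → ℝ)}
    (hf : ContinuousOn f s) : ContinuousOn (fun x => max (f x) 0) s :=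
  hf.sup continuousOn_const

lemma ballMeasure_pos {n : ℕ} {γ : ℝ} {U : Set (Fin n → ℝ)} (hU : IsOpen U)
    {y : Fin n → ℝ} (hy : y ∈ cBall n)
    (hyU : y ∈ U) : 0 < ballMeasure n γ (U ∩ {x | (∑ i, (x i) ^ 2) < 1}) := by
  have hopen : IsOpen (U ∩ {x : Fin n → ℝ | (∑ i, (x i) ^ 2) < 1}) :=
    hU.inter (isOpen_lt (by fun_prop) continuous_const)
  have hne : (U ∩ {x : Fin n → ℝ | (∑ i, (x i) ^ 2) < 1}).Nonempty := by
    have h1 : Tendsto (fun s : ℝ => s • y) (𝓝[<] 1) (𝓝 y) := by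
      have : Tendsto (fun s : ℝ => s • y) (𝓝 1) (𝓝 ((1 : ℝ) • y)) :=
        (continuous_id.smul continuous_const).tendsto 1
      rw [one_smul] at this
      exact this.mono_left nhdsWithin_le_nhds
    have h2 : ∀ᶠ s : ℝ in 𝓝[<] 1, 0 < s := nhdsWithin_le_nhds (lt_mem_nhds one_pos)
    obtain ⟨s, ⟨hs, hs0⟩, hs1⟩ :=
      ((h1.eventually (hU.mem_nhds hyU)).and h2 |>.and self_mem_nhdsWithin).exists
    refine ⟨s • y, hs, ?_⟩
    have e : ∑ i, ((s • y) i) ^ 2 = s ^ 2 * ∑ i, (y i) ^ 2 := by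
      simp [mul_pow, Finset.mul_sum]
    have h0 : ∑ i, (y i) ^ 2 ≤ 1 := hy
    have hs1' : s < 1 := hs1
    show ∑ i, ((s • y) i) ^ 2 < 1
    rw [e]
    nlinarith
  have hm : MeasurableSet (U ∩ {x : Fin n → ℝ | (∑ i, (x i) ^ 2) < 1}) := hopen.measurableSet
  rw [pos_iff_ne_zero]
  intro h0
  rw [ballMeasure, withDensity_apply_eq_zero (measurable_ballDensity n γ),
    Measure.restrict_apply' (measurableSet_oBall n)] at h0
  refine (hopen.measure_pos volume hne).ne' (measure_mono_null ?_ h0)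
  rintro x ⟨hxU, hx⟩
  refine ⟨⟨?_, hxU, hx⟩, hx⟩
  have : (0 : ℝ) < 1 - ∑ i, (x i) ^ 2 := sub_pos.2 hx
  simpa using Real.rpow_pos_of_pos this _

lemma bint_pos {f : (Fin n → ℝ) → ℝ} (hf : ContinuousOn f (cBall n)) (h : ∀ x ∈ cBall n, 0 ≤ f x)
    {y : Fin n → ℝ} (hy : y ∈ cBall n) (hfy : 0 < f y) : 0 < ∫ x, f x ∂ballMeasure n γ := by
  refine (integral_pos_iff_support_of_nonneg_ae ((ae_mem_cBall n γ).mono h)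
    (integrable_of_continuousOn hf)).2 ?_
  have h1 : f ⁻¹' Set.Ioi 0 ∈ 𝓝[cBall n] y := (hf y hy) (Ioi_mem_nhds hfy)
  obtain ⟨U, hU, hyU, hUf⟩ := mem_nhdsWithin.1 h1
  refine (ballMeasure_pos (γ := γ) hU hy hyU).trans_le (measure_mono ?_)
  rintro x ⟨hxU, hx⟩
  exact (hUf ⟨hxU, mem_cBall.2 (mem_oBall.1 hx).le⟩ : 0 < f x).ne'

lemma exists_bump_le {r : ℝ} (hr : 0 < r) : ∃ c > 0, ∀ y ∈ cBall n,
    c ≤ ∫ z, max 0 (r - (1 - bk z y)) ∂ballMeasure n γ := by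
  have hc : Continuous fun p : (Fin n → ℝ) × (Fin n → ℝ) => max 0 (r - (1 - bk p.2 p.1)) := by
    have := continuous_bk (n := n).comp continuous_swap
    exact continuous_const.max (continuous_const.sub (continuous_const.sub this))
  have hI : Continuous fun y => ∫ z in cBall n, max 0 (r - (1 - bk z y)) ∂ballMeasure n γ :=
    continuous_parametric_integral_of_continuous hc (isCompact_cBall n)
  rw [restrict_cBall] at hI
  have h0 : (0 : Fin n → ℝ) ∈ cBall n := by simp [mem_cBall]
  obtain ⟨y₀, hy₀, hmin⟩ := (isCompact_cBall n).exists_isMinOn ⟨0, h0⟩ hI.continuousOn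
  refine ⟨_, ?_, fun y hy => hmin hy⟩
  refine bint_pos (hc.comp (Continuous.prodMk_right y₀)).continuousOn
    (fun x _ => le_max_left _ _) hy₀ ?_
  have : bk y₀ y₀ = 1 := by
    have := one_sub_bk hy₀ hy₀
    simp [nsq] at this
    linarith
  simp [this, hr]

end

/-- A complete orthonormal system of eigenfunctions of the operator on the closed ball. -/
structure EigSys (n : ℕ) (γ : ℝ) (ι : Type) where
  /-- the eigenfunctions -/
  φ : ι → (Fin n → ℝ) → ℝ
  /-- the negatives of the eigenvalues -/
  Λ : ι → ℝ
  cont : ∀ i, ContinuousOn (φ i) (cBall n)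
  gen : ∀ i, ∀ x ∈ cBall n, HasGen γ (φ i) x (-(Λ i) * φ i x)
  orth : ∀ i, ∫ x, φ i x * φ i x ∂ballMeasure n γ = 1
  orth' : ∀ i j, i ≠ j → ∫ x, φ i x * φ j x ∂ballMeasure n γ = 0
  nonneg : ∀ i, 0 ≤ Λ i
  dense : ∀ f : (Fin n → ℝ) → ℝ, ContinuousOn f (cBall n) → ∀ ε > 0,
    ∃ s : Finset ι, ∃ a : ι → ℝ, ∀ x ∈ cBall n, |∑ i ∈ s, a i * φ i x - f x| ≤ ε
  /-- the index of the constant eigenfunction -/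
  i₀ : ι
  /-- the value of the constant eigenfunction -/
  c₀ : ℝ
  const : ∀ x ∈ cBall n, φ i₀ x = c₀
  Λ_const : Λ i₀ = 0

namespace EigSys

variable {n : ℕ} {γ : ℝ} {ι : Type} (E : EigSys n γ ι)

/-- The solution of the heat equation whose initial value is `∑ i ∈ s, a i * φ i`. -/
def ev (s : Finset ι) (a : ι → ℝ) (t : ℝ) (x : Fin n → ℝ) : ℝ :=
  ∑ i ∈ s, a i * Real.exp (-(E.Λ i) * t) * E.φ i x

lemma ev_zero (s : Finset ι) (a : ι → ℝ) (x : Fin n → ℝ) :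
    E.ev s a 0 x = ∑ i ∈ s, a i * E.φ i x := by simp [ev]

lemma continuousOn_ev (s : Finset ι) (a : ι → ℝ) (S : Set ℝ) :
    ContinuousOn (fun p : ℝ × (Fin n → ℝ) => E.ev s a p.1 p.2) (S ×ˢ cBall n) := by
  refine continuousOn_finsetSum _ fun i _ => ContinuousOn.mul ?_ ?_
  · exact (by fun_prop : Continuous fun p : ℝ × (Fin n → ℝ) =>
      a i * Real.exp (-(E.Λ i) * p.1)).continuousOn
  · exact (E.cont i).comp continuousOn_snd fun p hp => hp.2

lemma continuousOn_ev_right (s : Finset ι) (a : ι → ℝ) (t : ℝ) :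
    ContinuousOn (E.ev s a t) (cBall n) :=
  continuousOn_finsetSum _ fun i _ => continuousOn_const.mul (E.cont i)

lemma ev_heat (s : Finset ι) (a : ι → ℝ) (t : ℝ) {x : Fin n → ℝ} (hx : x ∈ cBall n) :
    ∃ d, HasDerivAt (fun r => E.ev s a r x) d t ∧ HasGen γ (E.ev s a t) x d := by
  refine ⟨_, ?_, HasGen.sum s fun i _ => (E.gen i x hx).const_mul _⟩
  refine HasDerivAt.fun_sum fun i _ => ?_
  have h := (((hasDerivAt_id' t).const_mul (-(E.Λ i))).exp.const_mul (a i)).mul_const (E.φ i x)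
  exact h.congr_deriv (by ring)

/-- Comparison of a finite solution with a supersolution. -/
lemma ev_le (hγ : -(1 / 2 : ℝ) < γ) (s : Finset ι) (a : ι → ℝ) {T : ℝ}
    {S : ℝ → (Fin n → ℝ) → ℝ}
    (hc : ContinuousOn (fun p : ℝ × (Fin n → ℝ) => S p.1 p.2) (Set.Icc 0 T ×ˢ cBall n))
    (h0 : ∀ x ∈ cBall n, E.ev s a 0 x ≤ S 0 x)
    (hS : ∀ t ∈ Set.Ioc 0 T, ∀ x ∈ cBall n, ∃ d ℓ,
      HasDerivAt (fun s => S s x) d t ∧ HasGen γ (S t) x ℓ ∧ ℓ ≤ d) :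
    ∀ t ∈ Set.Icc 0 T, ∀ x ∈ cBall n, E.ev s a t x ≤ S t x := by
  intro t ht x hx
  have := nonneg_of_supersolution hγ (T := T) (u := fun t x => S t x + -1 * E.ev s a t x)
    (hc.add (continuousOn_const.mul (E.continuousOn_ev s a _)))
    (fun x hx => by linarith [h0 x hx])
    (fun t ht x hx _ => by
      obtain ⟨d, ℓ, h1, h2, h3⟩ := hS t ht x hx
      obtain ⟨d', h1', h2'⟩ := E.ev_heat s a t hx
      exact ⟨_, _, h1.fun_add (h1'.const_mul (-1)), h2.add (h2'.const_mul (-1)), by linarith⟩)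
    t ht x hx
  linarith

/-- Comparison of a finite solution with a subsolution. -/
lemma le_ev (hγ : -(1 / 2 : ℝ) < γ) (s : Finset ι) (a : ι → ℝ) {T : ℝ}
    {S : ℝ → (Fin n → ℝ) → ℝ}
    (hc : ContinuousOn (fun p : ℝ × (Fin n → ℝ) => S p.1 p.2) (Set.Icc 0 T ×ˢ cBall n))
    (h0 : ∀ x ∈ cBall n, S 0 x ≤ E.ev s a 0 x)
    (hS : ∀ t ∈ Set.Ioc 0 T, ∀ x ∈ cBall n, ∃ d ℓ,
      HasDerivAt (fun s => S s x) d t ∧ HasGen γ (S t) x ℓ ∧ d ≤ ℓ) :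
    ∀ t ∈ Set.Icc 0 T, ∀ x ∈ cBall n, S t x ≤ E.ev s a t x := by
  intro t ht x hx
  have := nonneg_of_supersolution hγ (T := T) (u := fun t x => E.ev s a t x + -1 * S t x)
    ((E.continuousOn_ev s a _).add (continuousOn_const.mul hc))
    (fun x hx => by linarith [h0 x hx])
    (fun t ht x hx _ => by
      obtain ⟨d, ℓ, h1, h2, h3⟩ := hS t ht x hx
      obtain ⟨d', h1', h2'⟩ := E.ev_heat s a t hx
      exact ⟨_, _, h1'.fun_add (h1.const_mul (-1)), h2'.add (h2.const_mul (-1)), by linarith⟩)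
    t ht x hx
  linarith

lemma ev_nonneg (hγ : -(1 / 2 : ℝ) < γ) (s : Finset ι) (a : ι → ℝ)
    (h0 : ∀ x ∈ cBall n, 0 ≤ E.ev s a 0 x) {t : ℝ} (ht : 0 ≤ t) {x : Fin n → ℝ}
    (hx : x ∈ cBall n) : 0 ≤ E.ev s a t x :=
  E.le_ev hγ s a (T := t) (S := fun _ _ => 0) continuousOn_const h0
    (fun _ _ x _ => ⟨0, 0, hasDerivAt_const _ _, HasGen.const γ 0 x, le_rfl⟩) t ⟨ht, le_rfl⟩ x hx

lemma exists_ev_above {f : (Fin n → ℝ) → ℝ} (hf : ContinuousOn f (cBall n)) {ε : ℝ} (hε : 0 < ε) :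
    ∃ s a, ∀ x ∈ cBall n, f x ≤ E.ev s a 0 x ∧ E.ev s a 0 x ≤ f x + ε := by
  obtain ⟨s, a, h⟩ := E.dense (fun x => f x + ε / 2) (hf.add continuousOn_const) (ε / 2)
    (by positivity)
  refine ⟨s, a, fun x hx => ?_⟩
  have := abs_le.1 (h x hx)
  rw [E.ev_zero]
  constructor <;> linarith [this.1, this.2]

lemma exists_ev_below {f : (Fin n → ℝ) → ℝ} (hf : ContinuousOn f (cBall n)) {ε : ℝ} (hε : 0 < ε) :
    ∃ s a, ∀ x ∈ cBall n, E.ev s a 0 x ≤ f x ∧ f x ≤ E.ev s a 0 x + ε := by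
  obtain ⟨s, a, h⟩ := E.dense (fun x => f x - ε / 2) (hf.sub continuousOn_const) (ε / 2)
    (by positivity)
  refine ⟨s, a, fun x hx => ?_⟩
  have := abs_le.1 (h x hx)
  rw [E.ev_zero]
  constructor <;> linarith [this.1, this.2]

/-- The constant function `1` is a finite solution. -/
lemma exists_ev_one : ∃ s a, ∀ t, ∀ x ∈ cBall n, E.ev s a t x = 1 := by
  have hc : E.c₀ ≠ 0 := by
    intro h
    have h1 := E.orth E.i₀
    rw [bint_congr (g := fun _ => 0) fun x hx => by rw [E.const x hx, h, mul_zero]] at h1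
    simp at h1
  refine ⟨{E.i₀}, fun _ => 1 / E.c₀, fun t x hx => ?_⟩
  simp [ev, E.const x hx, E.Λ_const, hc]

variable [IsFiniteMeasure (ballMeasure n γ)]

lemma integral_mul_ev {g : (Fin n → ℝ) → ℝ} (hg : ContinuousOn g (cBall n)) (s : Finset ι)
    (a : ι → ℝ) (t : ℝ) : ∫ x, g x * E.ev s a t x ∂ballMeasure n γ
      = ∑ i ∈ s, a i * Real.exp (-(E.Λ i) * t) * ∫ x, g x * E.φ i x ∂ballMeasure n γ := by
  simp only [ev, Finset.mul_sum]
  rw [integral_finsetSum]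
  · refine Finset.sum_congr rfl fun i _ => ?_
    rw [← integral_const_mul]
    congr 1; ext x; ring
  · exact fun i _ => integrable_of_continuousOn (hg.mul (continuousOn_const.mul (E.cont i)))

lemma integral_ev_mul_phi [DecidableEq ι] (s : Finset ι) (a : ι → ℝ) (t : ℝ) (j : ι) :
    ∫ x, E.ev s a t x * E.φ j x ∂ballMeasure n γ
      = if j ∈ s then a j * Real.exp (-(E.Λ j) * t) else 0 := by
  have h := E.integral_mul_ev (E.cont j) s a t
  rw [← Finset.sum_ite_eq' s j fun i => a i * Real.exp (-(E.Λ i) * t)]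
  simp only [mul_comm (E.ev s a t _)]
  rw [h]
  refine Finset.sum_congr rfl fun i _ => ?_
  split_ifs with hij
  · rw [hij, E.orth, mul_one]
  · rw [E.orth' _ _ (Ne.symm hij), mul_zero]

/-- The heat evolution is symmetric. -/
lemma integral_ev_mul_ev_comm (s s' : Finset ι) (a a' : ι → ℝ) (t : ℝ) :
    ∫ x, E.ev s a t x * E.ev s' a' 0 x ∂ballMeasure n γ
      = ∫ x, E.ev s a 0 x * E.ev s' a' t x ∂ballMeasure n γ := by
  classical
  rw [E.integral_mul_ev (E.continuousOn_ev_right s a t),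
    E.integral_mul_ev (E.continuousOn_ev_right s a 0)]
  refine Finset.sum_congr rfl fun i _ => ?_
  rw [E.integral_ev_mul_phi, E.integral_ev_mul_phi]
  split_ifs
  · simp; ring
  · simp

lemma continuousOn_slice {T t : ℝ} {S : ℝ → (Fin n → ℝ) → ℝ} (ht : t ∈ Set.Icc 0 T)
    (hc : ContinuousOn (fun p : ℝ × (Fin n → ℝ) => S p.1 p.2) (Set.Icc 0 T ×ˢ cBall n)) :
    ContinuousOn (S t) (cBall n) :=
  hc.comp (Continuous.prodMk_right t).continuousOn fun _ hx => ⟨ht, hx⟩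

lemma integral_ev_mul_le (hγ : -(1 / 2 : ℝ) < γ) (s : Finset ι) (a : ι → ℝ)
    (h0 : ∀ x ∈ cBall n, 0 ≤ E.ev s a 0 x) {T : ℝ} (hT : 0 ≤ T) {S : ℝ → (Fin n → ℝ) → ℝ}
    (hc : ContinuousOn (fun p : ℝ × (Fin n → ℝ) => S p.1 p.2) (Set.Icc 0 T ×ˢ cBall n))
    (hS : ∀ t ∈ Set.Ioc 0 T, ∀ x ∈ cBall n, ∃ d ℓ,
      HasDerivAt (fun s => S s x) d t ∧ HasGen γ (S t) x ℓ ∧ ℓ ≤ d) :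
    ∫ x, E.ev s a T x * S 0 x ∂ballMeasure n γ ≤ ∫ x, E.ev s a 0 x * S T x ∂ballMeasure n γ := by
  have hcT := continuousOn_slice (t := T) ⟨hT, le_rfl⟩ hc
  have hc0 := continuousOn_slice (t := 0) ⟨le_rfl, hT⟩ hc
  have hF := E.continuousOn_ev_right s a T
  have hF0 := E.continuousOn_ev_right s a 0
  set J := ∫ x, E.ev s a T x ∂ballMeasure n γ
  have hJ : 0 ≤ J := bint_nonneg fun x hx => E.ev_nonneg hγ s a h0 hT hx
  refine le_of_forall_pos_le_add fun ε hε => ?_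
  obtain ⟨s', a', hq⟩ := E.exists_ev_below hc0 (show 0 < ε / (J + 1) by positivity)
  calc ∫ x, E.ev s a T x * S 0 x ∂ballMeasure n γ
      ≤ ∫ x, (E.ev s a T x * E.ev s' a' 0 x + E.ev s a T x * (ε / (J + 1))) ∂ballMeasure n γ := by
        refine bint_mono (hF.mul hc0) ((hF.mul (E.continuousOn_ev_right s' a' 0)).add
          (hF.mul continuousOn_const)) fun x hx => ?_
        have := mul_le_mul_of_nonneg_left (hq x hx).2 (E.ev_nonneg hγ s a h0 hT hx)
        linarith
    _ = ∫ x, E.ev s a 0 x * E.ev s' a' T x ∂ballMeasure n γ + J * (ε / (J + 1)) := by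
        rw [bint_add (hF.fun_mul (E.continuousOn_ev_right s' a' 0))
          (hF.fun_mul continuousOn_const), integral_mul_const,
          E.integral_ev_mul_ev_comm]
    _ ≤ _ := by
        refine add_le_add ?_ ?_
        · refine bint_mono (hF0.mul (E.continuousOn_ev_right s' a' T)) (hF0.mul hcT)
            fun x hx => mul_le_mul_of_nonneg_left ?_ (h0 x hx)
          exact E.ev_le hγ s' a' hc (fun x hx => (hq x hx).1) hS T ⟨hT, le_rfl⟩ x hx
        · rw [mul_div_assoc', div_le_iff₀ (by positivity)]; nlinarith

lemma le_integral_ev_mul (hγ : -(1 / 2 : ℝ) < γ) (s : Finset ι) (a : ι → ℝ)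
    (h0 : ∀ x ∈ cBall n, 0 ≤ E.ev s a 0 x) {T : ℝ} (hT : 0 ≤ T) {S : ℝ → (Fin n → ℝ) → ℝ}
    (hc : ContinuousOn (fun p : ℝ × (Fin n → ℝ) => S p.1 p.2) (Set.Icc 0 T ×ˢ cBall n))
    (hS : ∀ t ∈ Set.Ioc 0 T, ∀ x ∈ cBall n, ∃ d ℓ,
      HasDerivAt (fun s => S s x) d t ∧ HasGen γ (S t) x ℓ ∧ d ≤ ℓ) :
    ∫ x, E.ev s a 0 x * max (S T x) 0 ∂ballMeasure n γ
      ≤ ∫ x, E.ev s a T x * max (S 0 x) 0 ∂ballMeasure n γ := by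
  have hcT := continuousOn_posPart (continuousOn_slice (t := T) ⟨hT, le_rfl⟩ hc)
  have hc0 := continuousOn_posPart (continuousOn_slice (t := 0) ⟨le_rfl, hT⟩ hc)
  have hF := E.continuousOn_ev_right s a T
  have hF0 := E.continuousOn_ev_right s a 0
  set J := ∫ x, E.ev s a T x ∂ballMeasure n γ
  have hJ : 0 ≤ J := bint_nonneg fun x hx => E.ev_nonneg hγ s a h0 hT hx
  refine le_of_forall_pos_le_add fun ε hε => ?_
  obtain ⟨s', a', hq⟩ := E.exists_ev_above hc0 (show 0 < ε / (J + 1) by positivity)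
  calc ∫ x, E.ev s a 0 x * max (S T x) 0 ∂ballMeasure n γ
      ≤ ∫ x, E.ev s a 0 x * E.ev s' a' T x ∂ballMeasure n γ := by
        refine bint_mono (hF0.mul hcT) (hF0.mul (E.continuousOn_ev_right s' a' T))
            fun x hx => mul_le_mul_of_nonneg_left (max_le ?_ ?_) (h0 x hx)
        · exact E.le_ev hγ s' a' hc (fun x hx => (le_max_left _ _).trans (hq x hx).1) hS T
            ⟨hT, le_rfl⟩ x hx
        · exact E.ev_nonneg hγ s' a' (fun x hx => (le_max_right _ _).trans (hq x hx).1) hT hx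
    _ = ∫ x, E.ev s a T x * E.ev s' a' 0 x ∂ballMeasure n γ := (E.integral_ev_mul_ev_comm ..).symm
    _ ≤ ∫ x, (E.ev s a T x * max (S 0 x) 0 + E.ev s a T x * (ε / (J + 1))) ∂ballMeasure n γ := by
        refine bint_mono (hF.mul (E.continuousOn_ev_right s' a' 0)) ((hF.mul hc0).add
          (hF.mul continuousOn_const)) fun x hx => ?_
        have := mul_le_mul_of_nonneg_left (hq x hx).2 (E.ev_nonneg hγ s a h0 hT hx)
        linarith
    _ = ∫ x, E.ev s a T x * max (S 0 x) 0 ∂ballMeasure n γ + J * (ε / (J + 1)) := by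
        rw [bint_add (hF.fun_mul hc0) (hF.fun_mul continuousOn_const), integral_mul_const]
    _ ≤ _ := by
        refine add_le_add le_rfl ?_
        rw [mul_div_assoc', div_le_iff₀ (by positivity)]; nlinarith

end EigSys

lemma bw_mul_le_one {n : ℕ} (x y : Fin n → ℝ) : bw x * bw y ≤ 1 :=
  mul_le_one₀ (bw_le_one x) (bw_nonneg y) (bw_le_one y)

lemma wfac_le {n : ℕ} (γ : ℝ) {t : ℝ} (ht : 0 < t) (x y : Fin n → ℝ) :
    wfac γ t x y ≤ (1 + 1 / t) ^ |γ| := by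
  have h0 : 0 ≤ bw x * bw y / t := div_nonneg (mul_nonneg (bw_nonneg x) (bw_nonneg y)) ht.le
  have h1 : bw x * bw y / t ≤ 1 / t := by gcongr; exact bw_mul_le_one x y
  calc wfac γ t x y ≤ (1 + bw x * bw y / t) ^ |γ| :=
        Real.rpow_le_rpow_of_exponent_le (by linarith) (neg_le_abs γ)
    _ ≤ _ := Real.rpow_le_rpow (by linarith) (by linarith) (abs_nonneg γ)

lemma le_wfac {n : ℕ} (γ : ℝ) {t : ℝ} (ht : 0 < t) (x y : Fin n → ℝ) :
    (1 + 1 / t) ^ (-|γ|) ≤ wfac γ t x y := by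
  have h0 : 0 ≤ bw x * bw y / t := div_nonneg (mul_nonneg (bw_nonneg x) (bw_nonneg y)) ht.le
  have h1 : bw x * bw y / t ≤ 1 / t := by gcongr; exact bw_mul_le_one x y
  calc (1 + 1 / t) ^ (-|γ|) ≤ (1 + bw x * bw y / t) ^ (-|γ|) :=
        Real.rpow_le_rpow_of_nonpos (by linarith) (by linarith) (neg_nonpos.2 (abs_nonneg γ))
    _ ≤ _ := Real.rpow_le_rpow_of_exponent_le (by linarith) (neg_le_neg (le_abs_self γ))

lemma gau_le {n : ℕ} (γ a : ℝ) {t δ : ℝ} (ht : 0 < t) {x y : Fin n → ℝ} (h : δ ≤ 1 - bk x y) :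
    gau γ 2 a t x y ≤ t ^ (-a) * Real.exp (-(δ / (2 * t))) * (1 + 1 / t) ^ |γ| := by
  rw [gau]
  have := wfac_le γ ht x y
  have := wfac_pos γ ht x y
  gcongr

lemma tendsto_gau_tail (γ a : ℝ) {δ : ℝ} (hδ : 0 < δ) :
    Tendsto (fun t : ℝ => t ^ (-a) * Real.exp (-(δ / (2 * t))) * (1 + 1 / t) ^ |γ|)
      (𝓝[>] 0) (𝓝 0) := by
  have h1 := (tendsto_rpow_mul_exp_neg_mul_atTop_nhds_zero (a + |γ|) (δ / 2)
    (by positivity)).const_mul ((2 : ℝ) ^ |γ|)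
  rw [mul_zero] at h1
  have h2 := h1.comp tendsto_inv_nhdsGT_zero
  refine squeeze_zero' ?_ ?_ h2
  · filter_upwards [self_mem_nhdsWithin] with t ht
    have : (0 : ℝ) < t := ht
    positivity
  · filter_upwards [Ioc_mem_nhdsGT (zero_lt_one (α := ℝ))] with t ht
    have ht0 := ht.1
    have h3 : (1 + 1 / t) ≤ 2 * t⁻¹ := by
      have : 1 ≤ t⁻¹ := (one_le_inv₀ ht0).2 ht.2
      rw [one_div]; linarith
    have h4 : (1 + 1 / t) ^ |γ| ≤ 2 ^ |γ| * t⁻¹ ^ |γ| := by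
      rw [← Real.mul_rpow (by norm_num) (by positivity)]
      exact Real.rpow_le_rpow (by positivity) h3 (abs_nonneg γ)
    have h5 : t ^ (-a) = t⁻¹ ^ a := by rw [Real.inv_rpow ht0.le, Real.rpow_neg ht0.le]
    simp only [Function.comp]
    rw [h5, Real.rpow_add (by positivity), show -(δ / (2 * t)) = -(δ / 2) * t⁻¹ by field_simp]
    have h6 : 0 < t⁻¹ ^ a := by positivity
    calc _ ≤ t⁻¹ ^ a * Real.exp (-(δ / 2) * t⁻¹) * (2 ^ |γ| * t⁻¹ ^ |γ|) := by gcongr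
      _ = _ := by ring

namespace Barrier

variable {n : ℕ} {γ : ℝ} (B : Barrier n γ)

/-- The positive part of the subsolution. -/
def k (t : ℝ) (x y : Fin n → ℝ) : ℝ := max (B.v t x y) 0

lemma k_nonneg (t : ℝ) (x y : Fin n → ℝ) : 0 ≤ B.k t x y := le_max_right _ _

lemma C_pos : 0 < B.C := zero_lt_one.trans_le B.hC

lemma continuousOn_shift {f : ℝ → (Fin n → ℝ) → ℝ}
    (hf : ContinuousOn (fun p : ℝ × (Fin n → ℝ) => f p.1 p.2) (Set.Ioi 0 ×ˢ cBall n))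
    {τ : ℝ} (hτ : 0 < τ) (T : ℝ) :
    ContinuousOn (fun p : ℝ × (Fin n → ℝ) => f (τ + p.1) p.2) (Set.Icc 0 T ×ˢ cBall n) := by
  refine hf.comp (f := fun p : ℝ × (Fin n → ℝ) => (τ + p.1, p.2)) (by fun_prop) fun p hp => ?_
  have : 0 ≤ p.1 := hp.1.1
  exact ⟨by show 0 < τ + p.1; linarith, hp.2⟩

lemma continuousOn_time {f : ℝ → (Fin n → ℝ) → ℝ}
    (hf : ContinuousOn (fun p : ℝ × (Fin n → ℝ) => f p.1 p.2) (Set.Ioi 0 ×ˢ cBall n))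
    {x : Fin n → ℝ} (hx : x ∈ cBall n) : ContinuousOn (fun t => f t x) (Set.Ioi 0) :=
  hf.comp (f := fun t : ℝ => (t, x)) (by fun_prop) fun _ ht => ⟨ht, hx⟩

lemma continuousOn_space {f : ℝ → (Fin n → ℝ) → ℝ}
    (hf : ContinuousOn (fun p : ℝ × (Fin n → ℝ) => f p.1 p.2) (Set.Ioi 0 ×ˢ cBall n))
    {t : ℝ} (ht : 0 < t) : ContinuousOn (f t) (cBall n) :=
  hf.comp (f := fun x => (t, x)) (by fun_prop) fun _ hx => ⟨ht, hx⟩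

lemma continuousOn_U {y : Fin n → ℝ} (hy : y ∈ cBall n) {t : ℝ} (ht : 0 < t) :
    ContinuousOn (fun x => B.U t x y) (cBall n) :=
  continuousOn_space (f := fun t x => B.U t x y) (B.U_cont y hy) ht

lemma continuousOn_v {y : Fin n → ℝ} (hy : y ∈ cBall n) {t : ℝ} (ht : 0 < t) :
    ContinuousOn (fun x => B.v t x y) (cBall n) :=
  continuousOn_space (f := fun t x => B.v t x y) (B.v_cont y hy) ht

lemma continuousOn_k {y : Fin n → ℝ} (hy : y ∈ cBall n) {t : ℝ} (ht : 0 < t) :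
    ContinuousOn (fun x => B.k t x y) (cBall n) :=
  continuousOn_posPart (B.continuousOn_v hy ht)

lemma k_le_gau {x y : Fin n → ℝ} (hx : x ∈ cBall n) (hy : y ∈ cBall n) {t : ℝ} (ht : 0 < t)
    (ht1 : t ≤ 1) : B.k t x y ≤ B.C * gau γ 2 ((n + 2 * γ) / 2) t x y :=
  max_le (B.v_le x hx y hy t ht ht1) (mul_nonneg B.C_pos.le (gau_pos _ _ _ ht x y).le)

lemma k_le_U {x y : Fin n → ℝ} (hx : x ∈ cBall n) (hy : y ∈ cBall n) {t : ℝ} (ht : 0 < t)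
    (ht1 : t ≤ 1) : B.k t x y ≤ B.C ^ 2 * B.U t x y := by
  refine (B.k_le_gau hx hy ht ht1).trans ?_
  rw [sq, mul_assoc]
  exact mul_le_mul_of_nonneg_left (B.le_U x hx y hy t ht) B.C_pos.le

lemma exists_U_le {t : ℝ} (ht : 0 < t) :
    ∃ K > 0, ∀ r ∈ Set.Icc t 1, ∀ x ∈ cBall n, ∀ y ∈ cBall n, B.U r x y ≤ K := by
  have hc : ContinuousOn (fun r : ℝ => B.C * (r ^ (-((n + 2 * γ) / 2)) * (1 + 1 / r) ^ |γ|))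
      (Set.Icc t 1) := by
    have hne : ∀ r ∈ Set.Icc t 1, r ≠ 0 := fun r hr => (ht.trans_le hr.1).ne'
    refine continuousOn_const.mul (ContinuousOn.mul ?_ ?_)
    · exact continuousOn_id.rpow_const fun r hr => Or.inl (hne r hr)
    · refine ContinuousOn.rpow_const ?_ fun r hr => Or.inr (abs_nonneg γ)
      exact continuousOn_const.add (continuousOn_const.div continuousOn_id hne)
  obtain ⟨K, hK⟩ := isCompact_Icc.exists_bound_of_continuousOn hc
  refine ⟨max K 1, by positivity, fun r hr x hx y hy => ?_⟩
  have hr0 := ht.trans_le hr.1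
  have h1 := gau_le γ ((n + 2 * γ) / 2) hr0 (δ := 0) (x := x) (y := y)
    (by linarith [bk_le_one hx hy])
  simp only [zero_div, neg_zero, Real.exp_zero, mul_one] at h1
  calc B.U r x y ≤ B.C * gau γ 2 ((n + 2 * γ) / 2) r x y := B.U_le x hx y hy r hr0 hr.2
    _ ≤ B.C * (r ^ (-((n + 2 * γ) / 2)) * (1 + 1 / r) ^ |γ|) :=
      mul_le_mul_of_nonneg_left h1 B.C_pos.le
    _ ≤ _ := (le_abs_self _).trans ((hK r hr).trans (le_max_left _ _))

lemma exists_k_tail {δ η : ℝ} (hδ : 0 < δ) (hη : 0 < η) : ∀ᶠ τ in 𝓝[>] 0,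
    ∀ x ∈ cBall n, ∀ y ∈ cBall n, δ ≤ 1 - bk x y → B.k τ x y ≤ η := by
  have h := (tendsto_gau_tail γ ((n + 2 * γ) / 2) hδ).const_mul B.C
  rw [mul_zero] at h
  filter_upwards [h.eventually (gt_mem_nhds hη), Ioc_mem_nhdsGT (zero_lt_one (α := ℝ))]
    with τ h1 h2 x hx y hy hxy
  refine (B.k_le_gau hx hy h2.1 h2.2).trans (le_trans ?_ h1.le)
  exact mul_le_mul_of_nonneg_left (gau_le γ _ h2.1 hxy) B.C_pos.le

variable {ι : Type} (E : EigSys n γ ι) [IsFiniteMeasure (ballMeasure n γ)]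

lemma integral_ev_mul_U_le (hγ : -(1 / 2 : ℝ) < γ) (s : Finset ι) (a : ι → ℝ)
    (h0 : ∀ x ∈ cBall n, 0 ≤ E.ev s a 0 x) {τ t : ℝ} (hτ : 0 < τ) (ht : 0 ≤ t) {y : Fin n → ℝ}
    (hy : y ∈ cBall n) :
    ∫ x, E.ev s a t x * B.U τ x y ∂ballMeasure n γ
      ≤ ∫ x, E.ev s a 0 x * B.U (τ + t) x y ∂ballMeasure n γ := by
  have h := E.integral_ev_mul_le hγ s a h0 ht (S := fun r x => B.U (τ + r) x y)
    (continuousOn_shift (f := fun r x => B.U r x y) (B.U_cont y hy) hτ t) fun r hr x hx => by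
      obtain ⟨d, ℓ, h1, h2, h3⟩ := B.U_super y hy (τ + r) (by linarith [hr.1]) x hx
      exact ⟨d, ℓ, h1.comp_const_add τ r, h2, h3⟩
  simpa using h

lemma le_integral_ev_mul_k (hγ : -(1 / 2 : ℝ) < γ) (s : Finset ι) (a : ι → ℝ)
    (h0 : ∀ x ∈ cBall n, 0 ≤ E.ev s a 0 x) {τ t : ℝ} (hτ : 0 < τ) (ht : 0 ≤ t) (htt : τ + t ≤ B.t₁)
    {y : Fin n → ℝ} (hy : y ∈ cBall n) :
    ∫ x, E.ev s a 0 x * B.k (τ + t) x y ∂ballMeasure n γ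
      ≤ ∫ x, E.ev s a t x * B.k τ x y ∂ballMeasure n γ := by
  have h := E.le_integral_ev_mul hγ s a h0 ht (S := fun r x => B.v (τ + r) x y)
    (continuousOn_shift (f := fun r x => B.v r x y) (B.v_cont y hy) hτ t) fun r hr x hx => by
      obtain ⟨d, ℓ, h1, h2, h3⟩ := B.v_sub y hy (τ + r) (by linarith [hr.1])
        (by linarith [hr.2]) x hx
      exact ⟨d, ℓ, h1.comp_const_add τ r, h2, h3⟩
  simpa [k] using h

include E in
lemma exists_mass_U_le (hγ : -(1 / 2 : ℝ) < γ) : ∃ A > 0, ∀ τ, 0 < τ → τ ≤ 1 → ∀ y ∈ cBall n,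
    ∫ x, B.U τ x y ∂ballMeasure n γ ≤ A := by
  obtain ⟨s, a, h1⟩ := E.exists_ev_one
  obtain ⟨K, hK, hU⟩ := B.exists_U_le one_pos
  refine ⟨K * (ballMeasure n γ).real Set.univ + 1, by positivity, fun τ hτ hτ1 y hy => ?_⟩
  have h2 := B.integral_ev_mul_U_le E hγ s a (fun x hx => by simp [h1 0 x hx]) hτ
    (sub_nonneg.2 hτ1) hy
  rw [bint_congr (f := fun x => E.ev s a (1 - τ) x * B.U τ x y) (g := fun x => B.U τ x y)
      fun x hx => by rw [h1 _ x hx, one_mul],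
    bint_congr (f := fun x => E.ev s a 0 x * B.U (τ + (1 - τ)) x y) (g := fun x => B.U 1 x y)
      fun x hx => by
      rw [h1 _ x hx, one_mul, add_sub_cancel]] at h2
  refine h2.trans ?_
  have h3 : ∫ x, B.U 1 x y ∂ballMeasure n γ ≤ ∫ _, K ∂ballMeasure n γ :=
    bint_mono (B.continuousOn_U hy one_pos) continuousOn_const
      fun x hx => hU 1 ⟨le_rfl, le_rfl⟩ x hx y hy
  rw [integral_const, smul_eq_mul] at h3
  linarith

include E in
lemma exists_mass_k_le (hγ : -(1 / 2 : ℝ) < γ) : ∃ A > 0, ∀ τ, 0 < τ → τ ≤ 1 → ∀ y ∈ cBall n,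
    ∫ x, B.k τ x y ∂ballMeasure n γ ≤ A := by
  obtain ⟨A, hA, h⟩ := B.exists_mass_U_le E hγ
  have := B.C_pos
  refine ⟨B.C ^ 2 * A, by positivity, fun τ hτ hτ1 y hy => ?_⟩
  calc _ ≤ ∫ x, B.C ^ 2 * B.U τ x y ∂ballMeasure n γ :=
        bint_mono (B.continuousOn_k hy hτ) (continuousOn_const.mul (B.continuousOn_U hy hτ))
          fun x hx => B.k_le_U hx hy hτ hτ1
    _ = B.C ^ 2 * ∫ x, B.U τ x y ∂ballMeasure n γ := integral_const_mul _ _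
    _ ≤ _ := by gcongr; exact h τ hτ hτ1 y hy

include E in
lemma exists_le_mass_k (hγ : -(1 / 2 : ℝ) < γ) : ∃ c > 0, ∀ τ, 0 < τ → τ ≤ B.t₁ → ∀ y ∈ cBall n,
    c ≤ ∫ x, B.k τ x y ∂ballMeasure n γ := by
  obtain ⟨s, a, h1⟩ := E.exists_ev_one
  obtain ⟨c, hc, hb⟩ := exists_bump_le (γ := γ) (n := n) B.ht₁
  have ht := B.ht₁
  have hC := B.C_pos
  set L := B.t₁ ^ (-((n + 2 * γ) / 2)) * (1 + 1 / B.t₁) ^ (-|γ|) / (B.C * B.t₁) with hL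
  have hL0 : 0 < L := by positivity
  refine ⟨L * c, by positivity, fun τ hτ hτ1 y hy => ?_⟩
  have h2 := B.le_integral_ev_mul_k E hγ s a (fun x hx => by simp [h1 0 x hx]) hτ
    (sub_nonneg.2 hτ1) (by linarith) hy
  rw [bint_congr (f := fun x => E.ev s a 0 x * B.k (τ + (B.t₁ - τ)) x y)
      (g := fun x => B.k B.t₁ x y) fun x hx => by
      rw [h1 _ x hx, one_mul, add_sub_cancel],
    bint_congr (f := fun x => E.ev s a (B.t₁ - τ) x * B.k τ x y) (g := fun x => B.k τ x y)
      fun x hx => by rw [h1 _ x hx, one_mul]] at h2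
  refine le_trans ?_ h2
  have hcont : Continuous fun z => max 0 (B.t₁ - (1 - bk z y)) := by
    have := continuous_bk.comp (Continuous.prodMk_left y (X := Fin n → ℝ))
    exact continuous_const.max (continuous_const.sub (continuous_const.sub this))
  calc L * c ≤ L * ∫ z, max 0 (B.t₁ - (1 - bk z y)) ∂ballMeasure n γ := by gcongr; exact hb y hy
    _ = ∫ z, L * max 0 (B.t₁ - (1 - bk z y)) ∂ballMeasure n γ := (integral_const_mul _ _).symm
    _ ≤ _ := by
      refine bint_mono (continuous_const.mul hcont).continuousOn (B.continuousOn_k hy ht)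
        fun z hz => ?_
      rcases le_total (B.t₁ - (1 - bk z y)) 0 with h | h
      · rw [max_eq_left h, mul_zero]; exact B.k_nonneg _ _ _
      · rw [max_eq_right h]
        have h3 := B.le_v z hz y hy B.t₁ ht le_rfl (by linarith)
        have h4 := le_wfac γ ht z y
        have h5 : L * B.t₁ ≤ B.v B.t₁ z y := by
          rw [hL, div_mul_eq_mul_div, div_le_iff₀ (by positivity)]
          have : 0 < B.t₁ ^ (-((n + 2 * γ) / 2)) := by positivity
          have h6 := (mul_le_mul_of_nonneg_left h4 this.le).trans h3
          have h7 := mul_le_mul_of_nonneg_right h6 ht.le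
          linarith
        calc L * (B.t₁ - (1 - bk z y)) ≤ L * B.t₁ := by
              gcongr; linarith [bk_le_one hz hy]
          _ ≤ _ := h5.trans (le_max_left _ _)

end Barrier

lemma exists_bk_nhd {n : ℕ} {g : (Fin n → ℝ) → ℝ} (hg : ContinuousOn g (cBall n)) {y : Fin n → ℝ}
    (hy : y ∈ cBall n) {ε : ℝ} (hε : 0 < ε) :
    ∃ δ > 0, ∀ z ∈ cBall n, 1 - bk z y < δ → |g z - g y| < ε := by
  obtain ⟨r, hr, h⟩ := Metric.continuousOn_iff.1 hg y hy ε hε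
  refine ⟨r ^ 2 / 2, by positivity, fun z hz hzy => h z hz ?_⟩
  rw [one_sub_bk hz hy] at hzy
  rw [dist_pi_lt_iff hr]
  intro i
  have h1 : (z i - y i) ^ 2 ≤ nsq (z - y) :=
    Finset.single_le_sum (f := fun i => (z - y) i ^ 2) (fun j _ => sq_nonneg _) (Finset.mem_univ i)
  rw [Real.dist_eq]
  refine abs_lt_of_sq_lt_sq ?_ hr.le
  nlinarith [sq_nonneg (bw z - bw y)]

namespace Barrier

variable {n : ℕ} {γ : ℝ} (B : Barrier n γ) [IsFiniteMeasure (ballMeasure n γ)]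

lemma mul_le_of_integral_mul_k_le {c : ℝ} (hc : 0 < c) {g : (Fin n → ℝ) → ℝ}
    (hg : ContinuousOn g (cBall n)) (hg0 : ∀ x ∈ cBall n, 0 ≤ g x) {y : Fin n → ℝ}
    (hy : y ∈ cBall n)
    (hm : ∀ τ, 0 < τ → τ ≤ B.t₁ → c ≤ ∫ x, B.k τ x y ∂ballMeasure n γ) {D : ℝ}
    (h : ∀ᶠ τ in 𝓝[>] 0, ∫ x, g x * B.k τ x y ∂ballMeasure n γ ≤ D) : c * g y ≤ D := by
  set V := (ballMeasure n γ).real Set.univ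
  have key : ∀ ε > 0, c * g y ≤ D + ε * (1 + c) := by
    intro ε hε
    obtain ⟨δ, hδ, hn⟩ := exists_bk_nhd hg hy hε
    set m := max (g y - ε) 0 with hmdef
    have hm0 : 0 ≤ m := le_max_right _ _
    have hV : 0 ≤ V := measureReal_nonneg
    obtain ⟨τ, ⟨⟨h1, h2⟩, h3⟩⟩ := ((h.and (B.exists_k_tail hδ
      (show 0 < ε / (m * V + 1) by positivity))).and (Ioc_mem_nhdsGT B.ht₁)).exists
    have hk := B.continuousOn_k hy h3.1
    have h4 : ∫ x, m * B.k τ x y ∂ballMeasure n γ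
        ≤ ∫ x, (g x * B.k τ x y + m * (ε / (m * V + 1))) ∂ballMeasure n γ := by
      refine bint_mono (continuousOn_const.mul hk) ((hg.mul hk).add continuousOn_const)
        fun x hx => ?_
      have hk0 := B.k_nonneg τ x y
      rcases lt_or_ge (1 - bk x y) δ with hlt | hge
      · have h5 : m ≤ g x := max_le (by linarith [(abs_lt.1 (hn x hx hlt)).1]) (hg0 x hx)
        have h6 := mul_le_mul_of_nonneg_right h5 hk0
        have : 0 ≤ m * (ε / (m * V + 1)) := by positivity
        linarith
      · have h5 := mul_le_mul_of_nonneg_left (h2 x hx y hy hge) hm0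
        have := mul_nonneg (hg0 x hx) hk0
        linarith
    rw [bint_add (hg.fun_mul hk) continuousOn_const, integral_const_mul, integral_const,
      smul_eq_mul] at h4
    have h5 := mul_le_mul_of_nonneg_left (hm τ h3.1 h3.2) hm0
    have h6 : V * (m * (ε / (m * V + 1))) ≤ ε := by
      rw [mul_div_assoc', mul_div_assoc', div_le_iff₀ (by positivity)]; nlinarith
    have h7 : g y - ε ≤ m := le_max_left _ _
    have h8 := mul_le_mul_of_nonneg_left h7 hc.le
    linarith
  refine le_of_forall_pos_le_add fun ε hε => ?_
  have := key (ε / (1 + c)) (by positivity)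
  rwa [div_mul_cancel₀ _ (by positivity)] at this

lemma le_mul_of_le_integral_mul_k {A : ℝ} (hA : 0 < A) {g : (Fin n → ℝ) → ℝ}
    (hg : ContinuousOn g (cBall n)) {y : Fin n → ℝ} (hy : y ∈ cBall n) (hgy : 0 ≤ g y)
    (hm : ∀ τ, 0 < τ → τ ≤ 1 → ∫ x, B.k τ x y ∂ballMeasure n γ ≤ A) {D : ℝ}
    (h : ∀ᶠ τ in 𝓝[>] 0, D ≤ ∫ x, g x * B.k τ x y ∂ballMeasure n γ) : D ≤ A * g y := by
  set V := (ballMeasure n γ).real Set.univ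
  obtain ⟨K, hK, hgK⟩ := exists_abs_le_of_continuousOn hg
  have key : ∀ ε > 0, D ≤ A * g y + ε * (1 + A) := by
    intro ε hε
    obtain ⟨δ, hδ, hn⟩ := exists_bk_nhd hg hy hε
    have hV : 0 ≤ V := measureReal_nonneg
    obtain ⟨τ, ⟨⟨h1, h2⟩, h3⟩⟩ := ((h.and (B.exists_k_tail hδ
      (show 0 < ε / (K * V + 1) by positivity))).and (Ioc_mem_nhdsGT one_pos)).exists
    have hk := B.continuousOn_k hy h3.1
    have h4 : ∫ x, g x * B.k τ x y ∂ballMeasure n γ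
        ≤ ∫ x, ((g y + ε) * B.k τ x y + K * (ε / (K * V + 1))) ∂ballMeasure n γ := by
      refine bint_mono (hg.mul hk) ((continuousOn_const.mul hk).add continuousOn_const)
        fun x hx => ?_
      have hk0 := B.k_nonneg τ x y
      rcases lt_or_ge (1 - bk x y) δ with hlt | hge
      · have h5 : g x ≤ g y + ε := by linarith [(abs_lt.1 (hn x hx hlt)).2]
        have h6 := mul_le_mul_of_nonneg_right h5 hk0
        have : 0 ≤ K * (ε / (K * V + 1)) := by positivity
        linarith
      · have h5 := mul_le_mul_of_nonneg_left (h2 x hx y hy hge) hK.le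
        have h6 := mul_le_mul_of_nonneg_right ((le_abs_self _).trans (hgK x hx)) hk0
        have : 0 ≤ (g y + ε) * B.k τ x y := by positivity
        linarith
    rw [bint_add (continuousOn_const.fun_mul hk) continuousOn_const, integral_const_mul,
      integral_const, smul_eq_mul] at h4
    have h5 := mul_le_mul_of_nonneg_left (hm τ h3.1 h3.2) (by positivity : 0 ≤ g y + ε)
    have h6 : V * (K * (ε / (K * V + 1))) ≤ ε := by
      rw [mul_div_assoc', mul_div_assoc', div_le_iff₀ (by positivity)]; nlinarith
    linarith
  refine le_of_forall_pos_le_add fun ε hε => ?_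
  have := key (ε / (1 + A)) (by positivity)
  rwa [div_mul_cancel₀ _ (by positivity)] at this

variable {ι : Type} (E : EigSys n γ ι)

include B in
/-- Ultracontractivity of the heat evolution for small times. -/
lemma exists_ev_le_integral (hγ : -(1 / 2 : ℝ) < γ) {t : ℝ} (ht : 0 < t) (ht1 : t < 1) :
    ∃ K > 0, ∀ (s : Finset ι) (a : ι → ℝ), (∀ x ∈ cBall n, 0 ≤ E.ev s a 0 x) →
      ∀ y ∈ cBall n, E.ev s a t y ≤ K * ∫ x, E.ev s a 0 x ∂ballMeasure n γ := by
  obtain ⟨c, hc, hm⟩ := B.exists_le_mass_k E hγ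
  obtain ⟨K, hK, hU⟩ := B.exists_U_le ht
  have hC := B.C_pos
  refine ⟨B.C ^ 2 * K / c, by positivity, fun s a h0 y hy => ?_⟩
  have hF := E.continuousOn_ev_right s a t
  have hF0 := E.continuousOn_ev_right s a 0
  have h1 := B.mul_le_of_integral_mul_k_le hc hF (fun x hx => E.ev_nonneg hγ s a h0 ht.le hx) hy
    (fun τ h h' => hm τ h h' y hy) (D := B.C ^ 2 * (K * ∫ x, E.ev s a 0 x ∂ballMeasure n γ)) ?_
  · rw [div_mul_eq_mul_div, le_div_iff₀ hc]; linarith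
  filter_upwards [Ioc_mem_nhdsGT (sub_pos.2 ht1)] with τ hτ
  have hτ1 : τ ≤ 1 := by linarith [hτ.2]
  have hUτ := B.continuousOn_U hy hτ.1
  calc ∫ x, E.ev s a t x * B.k τ x y ∂ballMeasure n γ
      ≤ ∫ x, B.C ^ 2 * (E.ev s a t x * B.U τ x y) ∂ballMeasure n γ := by
        refine bint_mono (hF.mul (B.continuousOn_k hy hτ.1))
          (continuousOn_const.mul (hF.mul hUτ)) fun x hx => ?_
        have := mul_le_mul_of_nonneg_left (B.k_le_U hx hy hτ.1 hτ1)
          (E.ev_nonneg hγ s a h0 ht.le hx)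
        linarith
    _ = B.C ^ 2 * ∫ x, E.ev s a t x * B.U τ x y ∂ballMeasure n γ := integral_const_mul _ _
    _ ≤ B.C ^ 2 * ∫ x, E.ev s a 0 x * B.U (τ + t) x y ∂ballMeasure n γ := by
        exact mul_le_mul_of_nonneg_left
          (B.integral_ev_mul_U_le E hγ s a h0 hτ.1 ht.le hy) (sq_nonneg _)
    _ ≤ B.C ^ 2 * ∫ x, K * E.ev s a 0 x ∂ballMeasure n γ := by
        refine mul_le_mul_of_nonneg_left ?_ (sq_nonneg _)
        refine bint_mono (hF0.mul (B.continuousOn_U hy (by linarith [hτ.1])))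
          (continuousOn_const.mul hF0) fun x hx => ?_
        rw [mul_comm]
        exact mul_le_mul_of_nonneg_right
          (hU _ ⟨by linarith [hτ.1], by linarith [hτ.2]⟩ x hx y hy) (h0 x hx)
    _ = _ := by rw [integral_const_mul]

include B in
/-- On-diagonal bound for the partial sums of the heat kernel. -/
lemma exists_sum_phi_sq_le (hγ : -(1 / 2 : ℝ) < γ) {t : ℝ} (ht : 0 < t) (ht1 : t < 1) :
    ∃ K > 0, ∀ (s : Finset ι), ∀ y ∈ cBall n,
      ∑ i ∈ s, Real.exp (-(2 * E.Λ i * t)) * E.φ i y ^ 2 ≤ K := by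
  classical
  obtain ⟨K, hK, hev⟩ := B.exists_ev_le_integral E hγ ht ht1
  set V := (ballMeasure n γ).real Set.univ
  have hV : 0 ≤ V := measureReal_nonneg
  refine ⟨K ^ 2 * V + 1, by positivity, fun s y hy => ?_⟩
  set a : ι → ℝ := fun i => Real.exp (-(E.Λ i) * t) * E.φ i y with ha
  set A := ∑ i ∈ s, Real.exp (-(2 * E.Λ i * t)) * E.φ i y ^ 2 with hA
  have hexp : ∀ i, Real.exp (-(2 * E.Λ i * t)) = Real.exp (-(E.Λ i) * t) ^ 2 := fun i => by
    rw [← Real.exp_nat_mul]; congr 1; push_cast; ring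
  have hA1 : E.ev s a t y = A := Finset.sum_congr rfl fun i _ => by rw [hexp, ha]; ring
  set g := E.ev s a 0 with hg
  have hgc : ContinuousOn g (cBall n) := E.continuousOn_ev_right s a 0
  have hA2 : ∫ x, g x * g x ∂ballMeasure n γ = A := by
    rw [hg, E.integral_mul_ev hgc]
    refine Finset.sum_congr rfl fun i hi => ?_
    rw [E.integral_ev_mul_phi, if_pos hi, ha, hexp]
    simp
    ring
  have habs : ContinuousOn (fun x => (g x * g x / K + K) / 2) (cBall n) :=
    ((hgc.mul hgc).div_const K |>.add continuousOn_const).div_const 2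
  have key : ∀ ε > 0, A ≤ K * ((A / K + K * V) / 2 + ε * V) := by
    intro ε hε
    obtain ⟨s', a', hq⟩ := E.exists_ev_above habs hε
    have hle : ∀ x ∈ cBall n, |g x| ≤ E.ev s' a' 0 x := fun x hx => by
      refine le_trans ?_ (hq x hx).1
      have h1 : |g x| * |g x| = g x * g x := abs_mul_abs_self _
      rw [← h1, le_div_iff₀ two_pos, div_add' _ _ _ hK.ne', le_div_iff₀ hK]
      nlinarith [sq_nonneg (|g x| - K)]
    have h2 : A ≤ E.ev s' a' t y := by
      rw [← hA1]
      refine E.ev_le hγ s a (T := t) (E.continuousOn_ev s' a' _)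
        (fun x hx => (le_abs_self _).trans (hle x hx)) (fun r _ x hx => ?_) t ⟨ht.le, le_rfl⟩ y hy
      obtain ⟨d, h, h'⟩ := E.ev_heat s' a' r hx
      exact ⟨d, d, h, h', le_rfl⟩
    refine h2.trans ((hev s' a' (fun x hx => (abs_nonneg _).trans (hle x hx)) y hy).trans ?_)
    gcongr
    calc ∫ x, E.ev s' a' 0 x ∂ballMeasure n γ
        ≤ ∫ x, ((g x * g x * (1 / (2 * K)) + K / 2) + ε) ∂ballMeasure n γ := by
          refine bint_mono (E.continuousOn_ev_right s' a' 0)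
            (((hgc.mul hgc).mul continuousOn_const |>.add continuousOn_const).add
              continuousOn_const) fun x hx => (hq x hx).2.trans (le_of_eq ?_)
          field_simp
      _ = _ := by
          rw [bint_add (((hgc.fun_mul hgc).fun_mul continuousOn_const).fun_add continuousOn_const)
            continuousOn_const, bint_add ((hgc.fun_mul hgc).fun_mul continuousOn_const)
            continuousOn_const, integral_mul_const, hA2, integral_const, integral_const,
            smul_eq_mul, smul_eq_mul]
          change A * (1 / (2 * K)) + V * (K / 2) + V * ε = _
          field_simp
  have h3 : ∀ ε > 0, A ≤ K ^ 2 * V + ε := by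
    intro ε hε
    have h := key (ε / (2 * K * (V + 1))) (by positivity)
    have e1 : K * ((A / K + K * V) / 2) = A / 2 + K ^ 2 * V / 2 := by field_simp
    have e2 : K * (ε / (2 * K * (V + 1)) * V) ≤ ε / 2 := by
      have : K * (ε / (2 * K * (V + 1)) * V) = ε / 2 * (V / (V + 1)) := by field_simp
      rw [this]
      have : V / (V + 1) ≤ 1 := by rw [div_le_one (by positivity)]; linarith
      nlinarith
    rw [mul_add, e1] at h
    linarith
  exact h3 1 one_pos

end Barrier

namespace EigSys

variable {n : ℕ} {γ : ℝ} {ι : Type} (E : EigSys n γ ι)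

/-- The heat kernel. -/
def p (t : ℝ) (x y : Fin n → ℝ) : ℝ := ∑' i, Real.exp (-(E.Λ i) * t) * E.φ i x * E.φ i y

lemma p_comm (t : ℝ) (x y : Fin n → ℝ) : E.p t x y = E.p t y x :=
  tsum_congr fun i => by ring

/-- The heat kernel series is dominated, uniformly on the closed ball, by a summable family. -/
def Dominated : Prop :=
  ∀ t, 0 < t → ∃ b : ι → ℝ, Summable b ∧ ∀ i, ∀ x ∈ cBall n, ∀ y ∈ cBall n,
    |Real.exp (-(E.Λ i) * t) * E.φ i x * E.φ i y| ≤ b i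

lemma dominated [IsFiniteMeasure (ballMeasure n γ)] (B : Barrier n γ)
    (hγ : -(1 / 2 : ℝ) < γ) : E.Dominated := by
  intro t ht
  set s := min t 1 / 4 with hs
  have hs0 : 0 < s := by positivity
  have hst : 4 * s ≤ t := by rw [hs]; linarith [min_le_left t 1]
  have hs1 : s < 1 := by rw [hs]; linarith [min_le_right t 1]
  obtain ⟨K, hK, h⟩ := B.exists_sum_phi_sq_le E hγ hs0 hs1
  have hsum : Summable fun i => Real.exp (-(2 * E.Λ i * s)) := by
    refine summable_of_sum_le (c := K * (ballMeasure n γ).real Set.univ)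
      (fun i => (Real.exp_pos _).le) fun S => ?_
    have hc : ∀ i, ContinuousOn (fun y => Real.exp (-(2 * E.Λ i * s)) * E.φ i y ^ 2) (cBall n) :=
      fun i => continuousOn_const.mul ((E.cont i).pow 2)
    have h1 : ∑ i ∈ S, Real.exp (-(2 * E.Λ i * s))
        = ∫ y, ∑ i ∈ S, Real.exp (-(2 * E.Λ i * s)) * E.φ i y ^ 2 ∂ballMeasure n γ := by
      rw [integral_finsetSum _ fun i _ => integrable_of_continuousOn (hc i)]
      refine Finset.sum_congr rfl fun i _ => ?_
      simp only [integral_const_mul, pow_two, E.orth, mul_one]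
    rw [h1]
    refine (bint_mono (continuousOn_finsetSum _ fun i _ => hc i) continuousOn_const
      (h S)).trans_eq ?_
    rw [integral_const, smul_eq_mul, mul_comm]
  refine ⟨fun i => K * Real.exp (-(2 * E.Λ i * s)), hsum.mul_left K, fun i x hx y hy => ?_⟩
  have h2 := fun z hz => h {i} z hz
  simp only [Finset.sum_singleton] at h2
  have hx2 := h2 x hx
  have hy2 := h2 y hy
  have h3 : Real.exp (-(E.Λ i) * t)
      ≤ Real.exp (-(2 * E.Λ i * s)) * Real.exp (-(2 * E.Λ i * s)) := by
    rw [← Real.exp_add]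
    refine Real.exp_le_exp.2 ?_
    nlinarith [E.nonneg i]
  rw [mul_assoc, abs_mul, abs_of_pos (Real.exp_pos _)]
  set e := Real.exp (-(2 * E.Λ i * s))
  have he : 0 < e := Real.exp_pos _
  have h4 : e * |E.φ i x * E.φ i y| ≤ K := by
    have : |E.φ i x * E.φ i y| ≤ (E.φ i x ^ 2 + E.φ i y ^ 2) / 2 := by
      rw [abs_le]
      constructor <;> nlinarith [sq_nonneg (E.φ i x - E.φ i y), sq_nonneg (E.φ i x + E.φ i y)]
    nlinarith
  calc _ ≤ (e * e) * |E.φ i x * E.φ i y| := mul_le_mul_of_nonneg_right h3 (abs_nonneg _)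
    _ = e * (e * |E.φ i x * E.φ i y|) := by ring
    _ ≤ e * K := mul_le_mul_of_nonneg_left h4 he.le
    _ = _ := mul_comm _ _

section
variable {E} (hE : E.Dominated)
include hE

lemma Dominated.summable {t : ℝ} (ht : 0 < t) {x y : Fin n → ℝ} (hx : x ∈ cBall n)
    (hy : y ∈ cBall n) : Summable fun i => Real.exp (-(E.Λ i) * t) * E.φ i x * E.φ i y := by
  obtain ⟨b, hb, h⟩ := hE t ht
  exact Summable.of_norm_bounded hb fun i => h i x hx y hy

lemma Dominated.continuousOn_p {t : ℝ} (ht : 0 < t) :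
    ContinuousOn (fun q : (Fin n → ℝ) × (Fin n → ℝ) => E.p t q.1 q.2) (cBall n ×ˢ cBall n) := by
  obtain ⟨b, hb, h⟩ := hE t ht
  refine continuousOn_tsum (fun i => ?_) hb fun i q hq => h i _ hq.1 _ hq.2
  exact (continuousOn_const.mul ((E.cont i).comp continuousOn_fst fun q hq => hq.1)).mul
    ((E.cont i).comp continuousOn_snd fun q hq => hq.2)

lemma Dominated.continuousOn_p_right {t : ℝ} (ht : 0 < t) {x : Fin n → ℝ} (hx : x ∈ cBall n) :
    ContinuousOn (fun z => E.p t x z) (cBall n) :=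
  (hE.continuousOn_p ht).comp (Continuous.prodMk_right x).continuousOn fun _ hz => ⟨hx, hz⟩

variable [Countable ι] [IsFiniteMeasure (ballMeasure n γ)]

lemma Dominated.hasSum_integral {t : ℝ} (ht : 0 < t) {x : Fin n → ℝ} (hx : x ∈ cBall n)
    {g : (Fin n → ℝ) → ℝ} (hg : ContinuousOn g (cBall n)) :
    HasSum (fun i => Real.exp (-(E.Λ i) * t) * E.φ i x * ∫ z, E.φ i z * g z ∂ballMeasure n γ)
      (∫ z, E.p t x z * g z ∂ballMeasure n γ) := by
  obtain ⟨b, hb, h⟩ := hE t ht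
  obtain ⟨K, hK, hgK⟩ := exists_abs_le_of_continuousOn hg
  have key := hasSum_integral_of_dominated_convergence (μ := ballMeasure n γ)
    (F := fun i z => Real.exp (-(E.Λ i) * t) * E.φ i x * (E.φ i z * g z))
    (f := fun z => E.p t x z * g z) (fun i _ => b i * K)
    (fun i => (integrable_of_continuousOn
      (continuousOn_const.mul ((E.cont i).mul hg))).aestronglyMeasurable)
    (fun i => by
      filter_upwards [ae_mem_cBall n γ] with z hz
      rw [Real.norm_eq_abs, ← mul_assoc, abs_mul]
      exact mul_le_mul (h i x hx z hz) (hgK z hz) (abs_nonneg _)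
        ((abs_nonneg _).trans (h i x hx z hz)))
    (Eventually.of_forall fun _ => hb.mul_right K) (integrable_const _)
    (by
      filter_upwards [ae_mem_cBall n γ] with z hz
      have := (hE.summable ht hx hz).hasSum.mul_right (g z)
      simpa only [p, mul_assoc] using this)
  simpa only [integral_const_mul] using key

lemma Dominated.integral_mul_phi {t : ℝ} (ht : 0 < t) {x : Fin n → ℝ} (hx : x ∈ cBall n) (j : ι) :
    ∫ z, E.p t x z * E.φ j z ∂ballMeasure n γ = Real.exp (-(E.Λ j) * t) * E.φ j x := by
  refine (hE.hasSum_integral ht hx (E.cont j)).unique ?_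
  have := hasSum_single (f := fun i => Real.exp (-(E.Λ i) * t) * E.φ i x *
    ∫ z, E.φ i z * E.φ j z ∂ballMeasure n γ) j fun i hi => by rw [E.orth' i j hi, mul_zero]
  simpa only [E.orth, mul_one] using this

lemma Dominated.integral_mul_ev {t : ℝ} (ht : 0 < t) {x : Fin n → ℝ} (hx : x ∈ cBall n)
    (s : Finset ι) (a : ι → ℝ) :
    ∫ z, E.p t x z * E.ev s a 0 z ∂ballMeasure n γ = E.ev s a t x := by
  rw [E.integral_mul_ev (hE.continuousOn_p_right ht hx)]
  refine Finset.sum_congr rfl fun i _ => ?_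
  rw [hE.integral_mul_phi ht hx]
  simp
  ring

lemma Dominated.integral_p {t : ℝ} (ht : 0 < t) {x : Fin n → ℝ} (hx : x ∈ cBall n) :
    ∫ z, E.p t x z ∂ballMeasure n γ = 1 := by
  obtain ⟨s, a, h⟩ := E.exists_ev_one
  rw [← h t x hx, ← hE.integral_mul_ev ht hx s a]
  exact bint_congr fun z hz => by rw [h 0 z hz, mul_one]

lemma Dominated.integral_mul_p {t r : ℝ} (ht : 0 < t) (hr : 0 < r) {x y : Fin n → ℝ}
    (hx : x ∈ cBall n) (hy : y ∈ cBall n) :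
    ∫ z, E.p t x z * E.p r z y ∂ballMeasure n γ = E.p (t + r) x y := by
  have hc : ContinuousOn (fun z => E.p r z y) (cBall n) := by
    simpa only [E.p_comm r _ y] using hE.continuousOn_p_right hr hy
  refine (hE.hasSum_integral ht hx hc).unique ?_
  have h : ∀ i, ∫ z, E.φ i z * E.p r z y ∂ballMeasure n γ = Real.exp (-(E.Λ i) * r) * E.φ i y :=
    fun i => by
      rw [← hE.integral_mul_phi hr hy i]
      exact bint_congr fun z _ => by rw [E.p_comm r z y, mul_comm]
  have h' := (hE.summable (by linarith : 0 < t + r) hx hy).hasSum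
  have h2 : (fun i => Real.exp (-(E.Λ i) * t) * E.φ i x *
      ∫ z, E.φ i z * E.p r z y ∂ballMeasure n γ)
      = fun i => Real.exp (-(E.Λ i) * (t + r)) * E.φ i x * E.φ i y := by
    ext i
    rw [h, mul_add, Real.exp_add]
    ring
  rwa [h2]

lemma Dominated.integral_mul_nonneg (hγ : -(1 / 2 : ℝ) < γ) {t : ℝ} (ht : 0 < t)
    {x : Fin n → ℝ} (hx : x ∈ cBall n)
    {g : (Fin n → ℝ) → ℝ} (hg : ContinuousOn g (cBall n)) (h0 : ∀ z ∈ cBall n, 0 ≤ g z) :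
    0 ≤ ∫ z, E.p t x z * g z ∂ballMeasure n γ := by
  have hp := hE.continuousOn_p_right ht hx
  obtain ⟨K, hK, hpK⟩ := exists_abs_le_of_continuousOn hp
  set V := (ballMeasure n γ).real Set.univ
  have hV : 0 ≤ V := measureReal_nonneg
  refine le_of_forall_pos_le_add fun η hη => ?_
  obtain ⟨s, a, h⟩ := E.exists_ev_above hg (ε := η / (K * V + 1)) (by positivity)
  set ε := η / (K * V + 1) with hε
  have hε0 : 0 < ε := by positivity
  have h1 := E.ev_nonneg hγ s a (fun z hz => (h0 z hz).trans (h z hz).1) ht.le hx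
  rw [← hE.integral_mul_ev ht hx] at h1
  have h2 : ∫ z, E.p t x z * E.ev s a 0 z ∂ballMeasure n γ
      ≤ ∫ z, (E.p t x z * g z + K * ε) ∂ballMeasure n γ := by
    refine bint_mono (hp.mul (E.continuousOn_ev_right s a 0)) ((hp.mul hg).add continuousOn_const)
      fun z hz => ?_
    have h3 : |E.p t x z * (E.ev s a 0 z - g z)| ≤ K * ε := by
      rw [abs_mul]
      refine mul_le_mul (hpK z hz) ?_ (abs_nonneg _) hK.le
      rw [abs_le]
      constructor <;> linarith [(h z hz).1, (h z hz).2]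
    linarith [le_abs_self (E.p t x z * (E.ev s a 0 z - g z))]
  rw [bint_add (hp.fun_mul hg) continuousOn_const, integral_const, smul_eq_mul] at h2
  change _ ≤ _ + V * (K * ε) at h2
  have h4 : V * (K * ε) ≤ η := by
    rw [hε, mul_div_assoc', mul_div_assoc', div_le_iff₀ (by positivity)]; nlinarith
  linarith

lemma Dominated.p_nonneg (hγ : -(1 / 2 : ℝ) < γ) {t : ℝ} (ht : 0 < t) {x y : Fin n → ℝ}
    (hx : x ∈ cBall n) (hy : y ∈ cBall n) : 0 ≤ E.p t x y := by
  by_contra! hneg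
  have hp := hE.continuousOn_p_right ht hx
  have hg : ContinuousOn (fun z => max (-E.p t x z) 0) (cBall n) := continuousOn_posPart hp.neg
  have h1 := hE.integral_mul_nonneg hγ ht hx hg fun z _ => le_max_right _ _
  have h2 := bint_pos (γ := γ) (hg.mul hg) (fun z _ => mul_self_nonneg _) hy
    (mul_pos (lt_max_of_lt_left (by linarith)) (lt_max_of_lt_left (by linarith)))
  have h3 : ∫ z, E.p t x z * max (-E.p t x z) 0 ∂ballMeasure n γ
      = -∫ z, max (-E.p t x z) 0 * max (-E.p t x z) 0 ∂ballMeasure n γ := by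
    rw [← integral_neg]
    congr 1; ext z
    rcases le_total (-E.p t x z) 0 with h | h
    · simp [max_eq_right h]
    · simp [max_eq_left h]
  simp only [Pi.mul_apply] at h2
  linarith

lemma Dominated.integral_mul_le (hγ : -(1 / 2 : ℝ) < γ) {t : ℝ} (ht : 0 < t)
    {x : Fin n → ℝ} (hx : x ∈ cBall n) {S : ℝ → (Fin n → ℝ) → ℝ}
    (hc : ContinuousOn (fun p : ℝ × (Fin n → ℝ) => S p.1 p.2) (Set.Icc 0 t ×ˢ cBall n))
    (hS : ∀ r ∈ Set.Ioc 0 t, ∀ x ∈ cBall n, ∃ d ℓ,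
      HasDerivAt (fun s => S s x) d r ∧ HasGen γ (S r) x ℓ ∧ ℓ ≤ d) :
    ∫ z, E.p t x z * S 0 z ∂ballMeasure n γ ≤ S t x := by
  have hp := hE.continuousOn_p_right ht hx
  have hS0 := continuousOn_slice (t := 0) ⟨le_rfl, ht.le⟩ hc
  refine le_of_forall_pos_le_add fun ε hε => ?_
  obtain ⟨s, a, h⟩ := E.exists_ev_below hS0 hε
  have h1 := E.ev_le hγ s a hc (fun z hz => (h z hz).1) hS t ⟨ht.le, le_rfl⟩ x hx
  have h2 : ∫ z, E.p t x z * S 0 z ∂ballMeasure n γ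
      ≤ ∫ z, (E.p t x z * E.ev s a 0 z + E.p t x z * ε) ∂ballMeasure n γ := by
    refine bint_mono (hp.mul hS0) ((hp.mul (E.continuousOn_ev_right s a 0)).add
      (hp.mul continuousOn_const)) fun z hz => ?_
    have := mul_le_mul_of_nonneg_left (h z hz).2 (hE.p_nonneg hγ ht hx hz)
    linarith
  rw [bint_add (hp.fun_mul (E.continuousOn_ev_right s a 0)) (hp.fun_mul continuousOn_const),
    integral_mul_const, hE.integral_p ht hx, hE.integral_mul_ev ht hx] at h2
  linarith

lemma Dominated.le_integral_mul (hγ : -(1 / 2 : ℝ) < γ) {t : ℝ} (ht : 0 < t)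
    {x : Fin n → ℝ} (hx : x ∈ cBall n) {S : ℝ → (Fin n → ℝ) → ℝ}
    (hc : ContinuousOn (fun p : ℝ × (Fin n → ℝ) => S p.1 p.2) (Set.Icc 0 t ×ˢ cBall n))
    (hS : ∀ r ∈ Set.Ioc 0 t, ∀ x ∈ cBall n, ∃ d ℓ,
      HasDerivAt (fun s => S s x) d r ∧ HasGen γ (S r) x ℓ ∧ d ≤ ℓ) :
    S t x ≤ ∫ z, E.p t x z * max (S 0 z) 0 ∂ballMeasure n γ := by
  have hp := hE.continuousOn_p_right ht hx
  have hS0 := continuousOn_posPart (continuousOn_slice (t := 0) ⟨le_rfl, ht.le⟩ hc)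
  refine le_of_forall_pos_le_add fun ε hε => ?_
  obtain ⟨s, a, h⟩ := E.exists_ev_above hS0 hε
  have h1 := E.le_ev hγ s a hc (fun z hz => (le_max_left _ _).trans (h z hz).1) hS t
    ⟨ht.le, le_rfl⟩ x hx
  have h2 : ∫ z, E.p t x z * E.ev s a 0 z ∂ballMeasure n γ
      ≤ ∫ z, (E.p t x z * max (S 0 z) 0 + E.p t x z * ε) ∂ballMeasure n γ := by
    refine bint_mono (hp.mul (E.continuousOn_ev_right s a 0)) ((hp.mul hS0).add
      (hp.mul continuousOn_const)) fun z hz => ?_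
    have := mul_le_mul_of_nonneg_left (h z hz).2 (hE.p_nonneg hγ ht hx hz)
    linarith
  rw [bint_add (hp.fun_mul hS0) (hp.fun_mul continuousOn_const),
    integral_mul_const, hE.integral_p ht hx, hE.integral_mul_ev ht hx] at h2
  linarith

end

section
variable {E} (hE : E.Dominated) [Countable ι] [IsFiniteMeasure (ballMeasure n γ)]
  (B : Barrier n γ)
include hE

/-- Gaussian upper bound for small times. -/
lemma Dominated.exists_p_le (hγ : -(1 / 2 : ℝ) < γ) : ∃ K > 0, ∀ t, 0 < t →
    ∀ x ∈ cBall n, ∀ y ∈ cBall n, E.p t x y ≤ K * B.U t x y := by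
  obtain ⟨c, hc, hm⟩ := B.exists_le_mass_k E hγ
  have hC := B.C_pos
  refine ⟨B.C ^ 2 / c, by positivity, fun t ht x hx y hy => ?_⟩
  have hp := hE.continuousOn_p_right ht hx
  have hUt : ContinuousOn (fun r => B.U r x y) (Set.Ioi 0) :=
    Barrier.continuousOn_time (f := fun r x => B.U r x y) (B.U_cont y hy) hx
  have hev : ∀ ε > 0, ∀ᶠ τ in 𝓝[>] (0 : ℝ), B.U (τ + t) x y ≤ B.U t x y + ε := by
    intro ε hε
    have h1 : Tendsto (fun τ : ℝ => τ + t) (𝓝[>] 0) (𝓝 t) := by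
      have : Tendsto (fun τ : ℝ => τ + t) (𝓝 0) (𝓝 (0 + t)) := tendsto_id.add_const t
      rw [zero_add] at this
      exact this.mono_left nhdsWithin_le_nhds
    have h2 := ((hUt.continuousAt (Ioi_mem_nhds ht)).tendsto.comp h1).eventually_lt_const
      (by linarith : B.U t x y < B.U t x y + ε)
    exact h2.mono fun _ h => h.le
  rw [div_mul_eq_mul_div, le_div_iff₀ hc]
  refine le_of_forall_pos_le_add fun ε hε => ?_
  have key := B.mul_le_of_integral_mul_k_le hc hp (fun z hz => hE.p_nonneg hγ ht hx hz) hy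
    (fun τ h h' => hm τ h h' y hy) (D := B.C ^ 2 * (B.U t x y + ε / B.C ^ 2)) ?_
  · rw [mul_add, mul_div_cancel₀ _ (by positivity : B.C ^ 2 ≠ 0)] at key
    linarith
  filter_upwards [hev (ε / B.C ^ 2) (by positivity), Ioc_mem_nhdsGT zero_lt_one] with τ h1 hτ
  have hUτ := B.continuousOn_U hy hτ.1
  have h3 := hE.integral_mul_le hγ ht hx (S := fun r x => B.U (τ + r) x y)
    (Barrier.continuousOn_shift (f := fun r x => B.U r x y) (B.U_cont y hy) hτ.1 t)
    fun r hr x hx => by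
      obtain ⟨d, ℓ, h1, h2, h3⟩ := B.U_super y hy (τ + r) (by linarith [hr.1, hτ.1]) x hx
      exact ⟨d, ℓ, h1.comp_const_add τ r, h2, h3⟩
  simp only [add_zero] at h3
  calc ∫ z, E.p t x z * B.k τ z y ∂ballMeasure n γ
      ≤ ∫ z, B.C ^ 2 * (E.p t x z * B.U τ z y) ∂ballMeasure n γ := by
        refine bint_mono (hp.mul (B.continuousOn_k hy hτ.1))
          (continuousOn_const.mul (hp.mul hUτ)) fun z hz => ?_
        have := mul_le_mul_of_nonneg_left (B.k_le_U hz hy hτ.1 hτ.2)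
          (hE.p_nonneg hγ ht hx hz)
        linarith
    _ = B.C ^ 2 * ∫ z, E.p t x z * B.U τ z y ∂ballMeasure n γ := integral_const_mul _ _
    _ ≤ _ := mul_le_mul_of_nonneg_left (h3.trans h1) (sq_nonneg _)

/-- Lower bound by the subsolution for small times. -/
lemma Dominated.exists_v_le (hγ : -(1 / 2 : ℝ) < γ) : ∃ K > 0, ∀ t, 0 < t → t < B.t₁ →
    ∀ x ∈ cBall n, ∀ y ∈ cBall n, B.v t x y ≤ K * E.p t x y := by
  obtain ⟨A, hA, hm⟩ := B.exists_mass_k_le E hγ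
  refine ⟨A, hA, fun t ht ht1 x hx y hy => ?_⟩
  have hp := hE.continuousOn_p_right ht hx
  have hvt : ContinuousOn (fun r => B.v r x y) (Set.Ioi 0) :=
    Barrier.continuousOn_time (f := fun r x => B.v r x y) (B.v_cont y hy) hx
  have hev : ∀ ε > 0, ∀ᶠ τ in 𝓝[>] (0 : ℝ), B.v t x y - ε ≤ B.v (τ + t) x y := by
    intro ε hε
    have h1 : Tendsto (fun τ : ℝ => τ + t) (𝓝[>] 0) (𝓝 t) := by
      have : Tendsto (fun τ : ℝ => τ + t) (𝓝 0) (𝓝 (0 + t)) := tendsto_id.add_const t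
      rw [zero_add] at this
      exact this.mono_left nhdsWithin_le_nhds
    have h2 := ((hvt.continuousAt (Ioi_mem_nhds ht)).tendsto.comp h1).eventually_const_lt
      (by linarith : B.v t x y - ε < B.v t x y)
    exact h2.mono fun _ h => h.le
  refine le_of_forall_pos_le_add fun ε hε => ?_
  have key := B.le_mul_of_le_integral_mul_k hA hp hy (hE.p_nonneg hγ ht hx hy)
    (fun τ h h' => hm τ h h' y hy) (D := B.v t x y - ε) ?_
  · linarith
  filter_upwards [hev ε hε, Ioc_mem_nhdsGT (sub_pos.2 ht1)] with τ h1 hτ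
  have h3 := hE.le_integral_mul hγ ht hx (S := fun r x => B.v (τ + r) x y)
    (Barrier.continuousOn_shift (f := fun r x => B.v r x y) (B.v_cont y hy) hτ.1 t)
    fun r hr x hx => by
      obtain ⟨d, ℓ, h1, h2, h3⟩ := B.v_sub y hy (τ + r) (by linarith [hr.1, hτ.1])
        (by linarith [hr.2, hτ.2]) x hx
      exact ⟨d, ℓ, h1.comp_const_add τ r, h2, h3⟩
  simp only [add_zero] at h3
  exact h1.trans h3

end

end EigSys

lemma ballEig_nonneg {n : ℕ} (hn : 1 ≤ n) {γ : ℝ} (hγ : -(1 / 2 : ℝ) < γ) (k : ℕ) :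
    0 ≤ ballEig n γ k := by
  rcases Nat.eq_zero_or_pos k with rfl | hk
  · simp [ballEig]
  · have h1 : (1 : ℝ) ≤ n := by exact_mod_cast hn
    have h2 : (1 : ℝ) ≤ k := by exact_mod_cast hk
    exact mul_nonneg (by linarith) (by linarith)

lemma continuous_eval_mv {n : ℕ} (Q : MvPolynomial (Fin n) ℝ) :
    Continuous fun x : Fin n → ℝ => eval x Q := MvPolynomial.continuous_eval Q

/-- A polynomial identity on the open ball extends to the closed ball. -/
lemma eval_eq_of_oBall {n : ℕ} {p q : MvPolynomial (Fin n) ℝ}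
    (h : ∀ x : Fin n → ℝ, (∑ i, (x i) ^ 2) < 1 → eval x p = eval x q) {x : Fin n → ℝ}
    (hx : x ∈ cBall n) : eval x p = eval x q := by
  have hc : ∀ Q : MvPolynomial (Fin n) ℝ,
      Tendsto (fun r : ℝ => eval (r • x) Q) (𝓝[<] 1) (𝓝 (eval x Q)) := fun Q => by
    have h1 : Continuous fun r : ℝ => eval (r • x) Q :=
      (continuous_eval_mv Q).comp (continuous_id.smul continuous_const)
    have h2 := h1.tendsto 1
    rw [one_smul] at h2
    exact h2.mono_left nhdsWithin_le_nhds
  refine tendsto_nhds_unique_of_eventuallyEq (hc p) (hc q) ?_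
  filter_upwards [Ioo_mem_nhdsLT (zero_lt_one (α := ℝ))] with r hr
  refine h _ ?_
  simp only [Pi.smul_apply, smul_eq_mul, mul_pow, ← Finset.mul_sum]
  have h1 := mem_cBall.1 hx
  nlinarith [hr.1, hr.2]

lemma exists_eval_near {n : ℕ} {f : (Fin n → ℝ) → ℝ} (hf : ContinuousOn f (cBall n)) {ε : ℝ}
    (hε : 0 < ε) : ∃ Q : MvPolynomial (Fin n) ℝ, ∀ x ∈ cBall n, |eval x Q - f x| ≤ ε := by
  have : CompactSpace (cBall n) := isCompact_iff_compactSpace.1 (isCompact_cBall n)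
  let X : Fin n → C(cBall n, ℝ) := fun i =>
    ⟨fun x => x.1 i, (continuous_apply i).comp continuous_subtype_val⟩
  let A : Subalgebra ℝ C(cBall n, ℝ) := (aeval X : MvPolynomial (Fin n) ℝ →ₐ[ℝ] _).range
  have hA : A.SeparatesPoints := by
    intro x y hxy
    obtain ⟨i, hi⟩ : ∃ i, x.1 i ≠ y.1 i := by
      by_contra! h
      exact hxy (Subtype.ext (funext h))
    exact ⟨X i, ⟨X i, ⟨MvPolynomial.X i, by simp⟩, rfl⟩, hi⟩
  obtain ⟨⟨g, Q, hQ⟩, hg⟩ :=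
    ContinuousMap.exists_mem_subalgebra_near_continuousMap_of_separatesPoints A hA
      ⟨fun x => f x.1, continuousOn_iff_continuous_domRestrict.1 hf⟩ ε hε
  refine ⟨Q, fun x hx => ?_⟩
  have h1 := (ContinuousMap.norm_lt_iff _ hε).1 hg ⟨x, hx⟩
  have h2 : g ⟨x, hx⟩ = eval x Q := by
    rw [← hQ]
    let ev : C(cBall n, ℝ) →ₐ[ℝ] ℝ := ContinuousMap.evalAlgHom ℝ ℝ ⟨x, hx⟩
    change ev (aeval X Q) = _
    rw [← AlgHom.comp_apply, comp_aeval]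
    rfl
  simp only [ContinuousMap.coe_sub, Pi.sub_apply, Real.norm_eq_abs, h2] at h1
  exact h1.le

section
variable {n : ℕ} {γ : ℝ} {P : (k : ℕ) → Fin (ballNk n k) → MvPolynomial (Fin n) ℝ}

lemma isFiniteMeasure_ballMeasure (hdeg : ∀ k j, (P k j).totalDegree ≤ k)
    (h : ∃ j : Fin (ballNk n 0), ∫ x, eval x (P 0 j) * eval x (P 0 j) ∂(ballMeasure n γ) = 1) :
    IsFiniteMeasure (ballMeasure n γ) := by
  obtain ⟨j, hj⟩ := h
  have h0 := totalDegree_eq_zero_iff_eq_C.1 (Nat.le_zero.1 (hdeg 0 j))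
  rw [h0] at hj
  simp only [eval_C, integral_const, smul_eq_mul] at hj
  by_contra hfin
  have : ballMeasure n γ Set.univ = ⊤ := by
    by_contra h
    exact hfin ⟨lt_top_iff_ne_top.2 h⟩
  simp [Measure.real, this] at hj

/-- The eigenfunction system given by the orthogonal polynomials. -/
lemma exists_eigSys (hn : 1 ≤ n) (hγ : -(1 / 2 : ℝ) < γ)
    (hdeg : ∀ k j, (P k j).totalDegree ≤ k)
    (horth : ∀ (k : ℕ) (j : Fin (ballNk n k)) (k' : ℕ) (j' : Fin (ballNk n k')),
      ∫ x, eval x (P k j) * eval x (P k' j') ∂(ballMeasure n γ)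
        = if (⟨k, j⟩ : Σ k, Fin (ballNk n k)) = ⟨k', j'⟩ then 1 else 0)
    (hspan : ∀ m : ℕ, ∀ Q : MvPolynomial (Fin n) ℝ, Q.totalDegree ≤ m →
      Q ∈ Submodule.span ℝ {R | ∃ k ≤ m, ∃ j, R = P k j})
    (heig : ∀ (k : ℕ) (j : Fin (ballNk n k)), ∀ x : Fin n → ℝ, (∑ i, (x i) ^ 2) < 1 →
      eval x (ballOp n γ (P k j)) = -(ballEig n γ k) * eval x (P k j)) :
    ∃ E : EigSys n γ (Σ k, Fin (ballNk n k)), (∀ i x, E.φ i x = eval x (P i.1 i.2)) ∧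
      ∀ i, E.Λ i = ballEig n γ i.1 := by
  have hN : 0 < ballNk n 0 := by simp [ballNk]
  have h0 := totalDegree_eq_zero_iff_eq_C.1 (Nat.le_zero.1 (hdeg 0 ⟨0, hN⟩))
  refine ⟨⟨fun i x => eval x (P i.1 i.2), fun i => ballEig n γ i.1,
    fun i => (continuous_eval_mv _).continuousOn, fun i x hx => ?_, fun i => ?_,
    fun i j hij => ?_, fun i => ballEig_nonneg hn hγ _, fun f hf ε hε => ?_, ⟨0, ⟨0, hN⟩⟩,
    coeff 0 (P 0 ⟨0, hN⟩), fun x _ => ?_, ?_⟩, fun _ _ => rfl, fun _ => rfl⟩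
  · have h1 := eval_eq_of_oBall (p := ballOp n γ (P i.1 i.2))
      (q := C (-(ballEig n γ i.1)) * P i.1 i.2) (fun x hx => by
        rw [heig i.1 i.2 x hx, map_mul, eval_C]) hx
    rw [map_mul, eval_C] at h1
    rw [← h1]
    exact hasGen_eval γ _ x
  · rw [horth, if_pos rfl]
  · rw [horth, if_neg hij]
  · obtain ⟨Q, hQ⟩ := exists_eval_near hf hε
    have h1 : Q ∈ Submodule.span ℝ
        (Set.range fun i : Σ k, Fin (ballNk n k) => P i.1 i.2) := by
      refine Submodule.span_mono ?_ (hspan _ Q le_rfl)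
      rintro R ⟨k, -, j, rfl⟩
      exact ⟨⟨k, j⟩, rfl⟩
    obtain ⟨c, hc⟩ := Finsupp.mem_span_range_iff_exists_finsupp.1 h1
    refine ⟨c.support, c, fun x hx => ?_⟩
    have h2 := hQ x hx
    rw [← hc, Finsupp.sum, map_sum] at h2
    simpa only [smul_eval] using h2
  · change eval x (P 0 ⟨0, hN⟩) = _
    conv_lhs => rw [h0]
    rw [eval_C]
  · simp [ballEig]

lemma ballHeat_eq (E : EigSys n γ (Σ k, Fin (ballNk n k))) (hE : E.Dominated)
    (hφ : ∀ i x, E.φ i x = eval x (P i.1 i.2)) (hΛ : ∀ i, E.Λ i = ballEig n γ i.1)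
    {t : ℝ} (ht : 0 < t) {x y : Fin n → ℝ} (hx : x ∈ cBall n) (hy : y ∈ cBall n) :
    ballHeat n γ P t x y = E.p t x y := by
  rw [EigSys.p, (hE.summable ht hx hy).tsum_sigma' fun k => Summable.of_finite, ballHeat]
  refine tsum_congr fun k => ?_
  rw [tsum_fintype, Finset.mul_sum]
  refine Finset.sum_congr rfl fun j _ => ?_
  rw [hφ, hφ, hΛ]
  ring

end

section
variable {n : ℕ} {x y z : Fin n → ℝ}

lemma ballDist_eq (x y : Fin n → ℝ) : ballDist n x y = Real.arccos (bk x y) := rfl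

lemma ballDist_comm (x y : Fin n → ℝ) : ballDist n x y = ballDist n y x := by
  rw [ballDist_eq, ballDist_eq, bk_comm]

lemma continuous_ballDist_right (x : Fin n → ℝ) : Continuous fun y => ballDist n x y :=
  Real.continuous_arccos.comp (continuous_bk.comp (Continuous.prodMk_right x))

lemma ballDist_nonneg (x y : Fin n → ℝ) : 0 ≤ ballDist n x y := Real.arccos_nonneg _

lemma ballDist_le_pi (x y : Fin n → ℝ) : ballDist n x y ≤ π := Real.arccos_le_pi _

lemma neg_one_le_bk (hx : x ∈ cBall n) (hy : y ∈ cBall n) : -1 ≤ bk x y := by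
  have h1 : 0 ≤ nsq (x + y) := nsq_nonneg _
  have h2 : nsq (x + y) = nsq x + nsq y + 2 * dotp x y := by
    simp only [nsq, dotp, Finset.mul_sum, ← Finset.sum_add_distrib, Pi.add_apply]
    exact Finset.sum_congr rfl fun i _ => by ring
  have h3 : nsq x ≤ 1 := hx
  have h4 : nsq y ≤ 1 := hy
  have h5 := mul_nonneg (bw_nonneg x) (bw_nonneg y)
  rw [bk]
  linarith

lemma cos_ballDist (hx : x ∈ cBall n) (hy : y ∈ cBall n) : Real.cos (ballDist n x y) = bk x y :=
  Real.cos_arccos (neg_one_le_bk hx hy) (bk_le_one hx hy)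

lemma one_sub_bk_le (hx : x ∈ cBall n) (hy : y ∈ cBall n) :
    1 - bk x y ≤ ballDist n x y ^ 2 / 2 := by
  rw [← cos_ballDist hx hy]
  linarith [Real.one_sub_sq_div_two_le_cos (x := ballDist n x y)]

lemma le_one_sub_bk (hx : x ∈ cBall n) (hy : y ∈ cBall n) :
    2 / π ^ 2 * ballDist n x y ^ 2 ≤ 1 - bk x y := by
  rw [← cos_ballDist hx hy]
  have := Real.cos_le_one_sub_mul_cos_sq (x := ballDist n x y)
    (by rw [abs_of_nonneg (ballDist_nonneg x y)]; exact ballDist_le_pi x y)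
  linarith

/-- The ballLift of a point of the ball to the upper half-sphere. -/
def ballLift (x : Fin n → ℝ) : EuclideanSpace ℝ (Option (Fin n)) :=
  WithLp.toLp 2 fun o => o.elim (bw x) x

lemma inner_ballLift (x y : Fin n → ℝ) : inner ℝ (ballLift x) (ballLift y) = bk x y := by
  simp [ballLift, PiLp.inner_apply, Fintype.sum_option, bk, dotp]
  rw [add_comm, mul_comm (bw y)]
  congr 1
  exact Finset.sum_congr rfl fun i _ => mul_comm _ _

lemma bk_self (hx : x ∈ cBall n) : bk x x = 1 := by
  have := bw_sq hx
  rw [bk, dotp_self]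
  nlinarith

lemma norm_ballLift (hx : x ∈ cBall n) : ‖ballLift x‖ = 1 := by
  rw [← Real.sqrt_one, ← bk_self hx, ← inner_ballLift, real_inner_self_eq_norm_sq,
    Real.sqrt_sq (norm_nonneg _)]

lemma ballDist_eq_angle (hx : x ∈ cBall n) (hy : y ∈ cBall n) :
    ballDist n x y = InnerProductGeometry.angle (ballLift x) (ballLift y) := by
  rw [InnerProductGeometry.angle, norm_ballLift hx, norm_ballLift hy, inner_ballLift,
    mul_one, div_one,
    ballDist_eq]

lemma ballDist_triangle (hx : x ∈ cBall n) (hy : y ∈ cBall n) (hz : z ∈ cBall n) :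
    ballDist n x z ≤ ballDist n x y + ballDist n y z := by
  rw [ballDist_eq_angle hx hy, ballDist_eq_angle hy hz, ballDist_eq_angle hx hz]
  exact InnerProductGeometry.angle_le_angle_add_angle _ _ _

lemma ballDist_self (hx : x ∈ cBall n) : ballDist n x x = 0 := by
  rw [ballDist_eq, bk_self hx, Real.arccos_one]

lemma dotp_smul_add (a b : ℝ) (x y z : Fin n → ℝ) :
    dotp (a • x + b • y) z = a * dotp x z + b * dotp y z := by
  simp only [dotp, Finset.mul_sum, ← Finset.sum_add_distrib, Pi.add_apply, Pi.smul_apply,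
    smul_eq_mul]
  exact Finset.sum_congr rfl fun i _ => by ring

lemma nsq_smul_add (a b : ℝ) (x y : Fin n → ℝ) :
    nsq (a • x + b • y) = a ^ 2 * nsq x + b ^ 2 * nsq y + 2 * (a * b) * dotp x y := by
  simp only [nsq, dotp, Finset.mul_sum, ← Finset.sum_add_distrib, Pi.add_apply, Pi.smul_apply,
    smul_eq_mul]
  exact Finset.sum_congr rfl fun i _ => by ring

/-- Nonnegative combinations of two lifts that lie on the unit sphere are lifts. -/
lemma comb_spec (hx : x ∈ cBall n) (hy : y ∈ cBall n) {a b : ℝ} (ha : 0 ≤ a) (hb : 0 ≤ b)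
    (h : a ^ 2 + b ^ 2 + 2 * (a * b) * bk x y = 1) :
    a • x + b • y ∈ cBall n ∧ ∀ z, bk (a • x + b • y) z = a * bk x z + b * bk y z := by
  have h1 : 1 - nsq (a • x + b • y) = (a * bw x + b * bw y) ^ 2 := by
    rw [nsq_smul_add]
    have hx2 := bw_sq hx
    have hy2 := bw_sq hy
    rw [bk] at h
    linear_combination -h - a ^ 2 * hx2 - b ^ 2 * hy2
  have h2 : bw (a • x + b • y) = a * bw x + b * bw y := by
    rw [bw, h1, Real.sqrt_sq]
    exact add_nonneg (mul_nonneg ha (bw_nonneg x)) (mul_nonneg hb (bw_nonneg y))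
  refine ⟨?_, fun z => ?_⟩
  · change nsq _ ≤ 1
    linarith [sq_nonneg (a * bw x + b * bw y)]
  · rw [bk, h2, dotp_smul_add, bk, bk]
    ring

/-- Existence of intermediate points on geodesics. -/
lemma exists_geodesic_point (hx : x ∈ cBall n) (hy : y ∈ cBall n) {s : ℝ} (hs : 0 ≤ s)
    (hsr : s ≤ ballDist n x y) :
    ∃ m ∈ cBall n, ballDist n x m = ballDist n x y - s ∧ ballDist n m y = s := by
  set r := ballDist n x y with hr
  have hcos : Real.cos r = bk x y := cos_ballDist hx hy
  have hrπ : r ≤ π := ballDist_le_pi x y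
  suffices h : ∃ m ∈ cBall n, bk m x = Real.cos (r - s) ∧ bk m y = Real.cos s by
    obtain ⟨m, hm, h1, h2⟩ := h
    refine ⟨m, hm, ?_, ?_⟩
    · rw [ballDist_eq, bk_comm, h1, Real.arccos_cos (by linarith) (by linarith)]
    · rw [ballDist_eq, h2, Real.arccos_cos hs (by linarith)]
  rcases eq_or_lt_of_le (hs.trans hsr) with h0 | h0
  · have hs0 : s = 0 := by linarith
    refine ⟨x, hx, ?_, ?_⟩
    · rw [bk_self hx, hs0, ← h0, sub_zero, Real.cos_zero]
    · rw [← hcos, hs0, ← h0]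
  rcases eq_or_lt_of_le hrπ with h1 | h1
  · rw [h1, Real.cos_pi] at hcos
    have hx2 := bw_sq hx
    have hy2 := bw_sq hy
    have h2 : nsq ((1 : ℝ) • x + (1 : ℝ) • y) + (bw x + bw y) ^ 2 = 0 := by
      rw [nsq_smul_add]
      rw [bk] at hcos
      linear_combination hx2 + hy2 - 2 * hcos
    have h3 := nsq_nonneg ((1 : ℝ) • x + (1 : ℝ) • y)
    have h4 : bw x + bw y = 0 := by nlinarith [sq_nonneg (bw x + bw y)]
    have h5 : bw x = 0 := by linarith [bw_nonneg x, bw_nonneg y]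
    have h6 : bw y = 0 := by linarith
    have h7 : dotp x y = -1 := by rw [bk, h5, h6] at hcos; linarith
    have h8 : nsq x = 1 := by rw [h5] at hx2; linarith
    set c := Real.cos (r - s) with hc
    have h9 : nsq (c • x + (0 : ℝ) • y) = c ^ 2 := by rw [nsq_smul_add, h8]; ring
    refine ⟨c • x + (0 : ℝ) • y, ?_, ?_, ?_⟩
    · change nsq _ ≤ 1
      rw [h9]
      exact Real.cos_sq_le_one _
    · rw [bk, dotp_smul_add, dotp_self, h5, h8]; ring
    · rw [bk, dotp_smul_add, h6, h7, hc, h1, Real.cos_pi_sub]; ring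
  · have hsin : 0 < Real.sin r := Real.sin_pos_of_pos_of_lt_pi h0 h1
    have ha : 0 ≤ Real.sin s := Real.sin_nonneg_of_nonneg_of_le_pi hs (by linarith)
    have hb : 0 ≤ Real.sin (r - s) :=
      Real.sin_nonneg_of_nonneg_of_le_pi (by linarith) (by linarith)
    have hrs := Real.sin_sq_add_cos_sq r
    have hss := Real.sin_sq_add_cos_sq s
    have hsub := Real.sin_sub r s
    have hcsub := Real.cos_sub r s
    obtain ⟨h2, h3⟩ := comb_spec (a := Real.sin s / Real.sin r)
      (b := Real.sin (r - s) / Real.sin r) hx hy (by positivity) (by positivity) (by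
        rw [← hcos, hsub]
        field_simp
        linear_combination (Real.sin r ^ 2 + 0) * hss - Real.sin s ^ 2 * hrs)
    refine ⟨_, h2, ?_, ?_⟩
    · rw [h3, bk_self hx, bk_comm y x, ← hcos, hsub, hcsub]
      field_simp
      linear_combination -Real.sin s * hrs
    · rw [h3, bk_self hy, ← hcos, hsub]
      field_simp
      ring

end

lemma rpow_neg_le_of_comparable (γ : ℝ) {a b K : ℝ} (ha : 0 < a) (hb : 0 < b) (hK : 0 < K)
    (h1 : a ≤ K * b) (h2 : b ≤ K * a) : a ^ (-γ) ≤ K ^ |γ| * b ^ (-γ) := by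
  rcases le_total 0 γ with h | h
  · rw [abs_of_nonneg h, Real.rpow_neg ha.le, Real.rpow_neg hb.le]
    have h3 := Real.rpow_le_rpow hb.le h2 h
    rw [Real.mul_rpow hK.le ha.le] at h3
    have := Real.rpow_pos_of_pos ha γ
    have := Real.rpow_pos_of_pos hb γ
    rw [← div_eq_mul_inv, le_div_iff₀ (by positivity), inv_mul_le_iff₀ (by positivity)]
    linarith
  · rw [abs_of_nonpos h]
    have h3 := Real.rpow_le_rpow ha.le h1 (neg_nonneg.2 h)
    rwa [Real.mul_rpow hK.le hb.le] at h3

/-- The on-diagonal profile of the heat kernel. -/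
def dg {n : ℕ} (γ t : ℝ) (y : Fin n → ℝ) : ℝ := t ^ (-((n + 2 * γ) / 2)) * wfac γ t y y

section
variable {n : ℕ} {γ : ℝ} {x y : Fin n → ℝ}

lemma dg_pos (γ : ℝ) {t : ℝ} (ht : 0 < t) (y : Fin n → ℝ) : 0 < dg γ t y :=
  mul_pos (Real.rpow_pos_of_pos ht _) (wfac_pos γ ht y y)

lemma wfac_comparable (γ : ℝ) {t M : ℝ} (ht : 0 < t) (hM : 0 ≤ M) (hx : x ∈ cBall n)
    (hy : y ∈ cBall n) (h : 1 - bk x y ≤ M * t) :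
    wfac γ t x y ≤ (2 + 2 * M) ^ |γ| * wfac γ t y y ∧
      wfac γ t y y ≤ (2 + 2 * M) ^ |γ| * wfac γ t x y := by
  have h0 := one_sub_bk hx hy
  have h1 : (bw x - bw y) ^ 2 ≤ 2 * (M * t) := by linarith [nsq_nonneg (x - y)]
  have hxx := bw_nonneg x
  have hyy := bw_nonneg y
  have hxy := mul_nonneg hxx hyy
  have e : ∀ q : ℝ, 1 + q / t = (t + q) / t := fun q => by field_simp
  have p1 : 0 < 1 + bw x * bw y / t := by positivity
  have p2 : 0 < 1 + bw y * bw y / t := by positivity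
  have c1 : 1 + bw x * bw y / t ≤ (2 + 2 * M) * (1 + bw y * bw y / t) := by
    rw [e, e, mul_div_assoc', div_le_div_iff_of_pos_right ht]
    nlinarith [sq_nonneg (bw x - 2 * bw y), mul_nonneg hM (mul_self_nonneg (bw y))]
  have c2 : 1 + bw y * bw y / t ≤ (2 + 2 * M) * (1 + bw x * bw y / t) := by
    rw [e, e, mul_div_assoc', div_le_div_iff_of_pos_right ht]
    nlinarith [sq_nonneg (bw x), mul_nonneg hM hxy]
  exact ⟨rpow_neg_le_of_comparable γ p1 p2 (by positivity) c1 c2,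
    rpow_neg_le_of_comparable γ p2 p1 (by positivity) c2 c1⟩

lemma dg_le_dg (γ : ℝ) {t M : ℝ} (ht : 0 < t) (hM : 0 ≤ M) (hx : x ∈ cBall n)
    (hy : y ∈ cBall n) (h : 1 - bk x y ≤ M * t) :
    dg γ t x ≤ ((2 + 2 * M) ^ |γ|) ^ 2 * dg γ t y := by
  have h1 := (wfac_comparable γ ht hM hx hy h).1
  have h2 := (wfac_comparable γ ht hM hy hx (by rwa [bk_comm])).2
  rw [wfac_comm γ t y x] at h2
  have h3 : 0 < (2 + 2 * M) ^ |γ| := by positivity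
  have h4 : wfac γ t x x ≤ ((2 + 2 * M) ^ |γ|) ^ 2 * wfac γ t y y := by
    calc _ ≤ _ := h2
      _ ≤ _ := mul_le_mul_of_nonneg_left h1 h3.le
      _ = _ := by ring
  rw [dg, dg, mul_left_comm]
  exact mul_le_mul_of_nonneg_left h4 (Real.rpow_nonneg ht.le _)

lemma wfac_scale (γ : ℝ) {t l : ℝ} (ht : 0 < t) (hl : 1 ≤ l) (x y : Fin n → ℝ) :
    wfac γ (t / l) x y ≤ l ^ |γ| * wfac γ t x y ∧
      wfac γ t x y ≤ l ^ |γ| * wfac γ (t / l) x y := by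
  have hq := mul_nonneg (bw_nonneg x) (bw_nonneg y)
  have hl0 : 0 < l := by linarith
  set q := bw x * bw y / t with hq'
  have hq0 : 0 ≤ q := by positivity
  have e : 1 + bw x * bw y / (t / l) = 1 + l * q := by rw [hq']; field_simp
  have h1 : 1 + l * q ≤ l * (1 + q) := by nlinarith
  have h2 : 1 + q ≤ l * (1 + l * q) := by nlinarith [mul_nonneg hl0.le hq0]
  rw [wfac, wfac, e]
  exact ⟨rpow_neg_le_of_comparable γ (by positivity) (by positivity) hl0 h1 h2,
    rpow_neg_le_of_comparable γ (by positivity) (by positivity) hl0 h2 h1⟩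

lemma dg_div_le (γ : ℝ) {t l : ℝ} (ht : 0 < t) (hl : 1 ≤ l) (y : Fin n → ℝ) :
    dg γ (t / l) y ≤ l ^ ((n + 2 * γ) / 2) * l ^ |γ| * dg γ t y := by
  have hl0 : 0 < l := by linarith
  rw [dg, dg, Real.div_rpow ht.le hl0.le, Real.rpow_neg hl0.le, div_inv_eq_mul]
  calc _ ≤ t ^ (-((n + 2 * γ) / 2)) * l ^ ((n + 2 * γ) / 2) * (l ^ |γ| * wfac γ t y y) :=
        mul_le_mul_of_nonneg_left (wfac_scale γ ht hl y y).1 (by positivity)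
    _ = _ := by ring

lemma dg_le_div (hn : 1 ≤ n) (hγ : -(1 / 2 : ℝ) < γ) {t l : ℝ} (ht : 0 < t) (hl : 1 ≤ l)
    (y : Fin n → ℝ) : dg γ t y ≤ l ^ |γ| * dg γ (t / l) y := by
  have hl0 : 0 < l := by linarith
  have hn1 : (1 : ℝ) ≤ n := by exact_mod_cast hn
  have h1 : (1 : ℝ) ≤ l ^ ((n + 2 * γ) / 2) := Real.one_le_rpow hl (by linarith)
  rw [dg, dg, Real.div_rpow ht.le hl0.le, Real.rpow_neg hl0.le, div_inv_eq_mul]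
  have h2 := (wfac_scale γ ht hl y y).2
  have h3 := wfac_pos γ ht y y
  have h4 : 0 < t ^ (-((n + 2 * γ) / 2)) := Real.rpow_pos_of_pos ht _
  calc t ^ (-((n + 2 * γ) / 2)) * wfac γ t y y
      ≤ t ^ (-((n + 2 * γ) / 2)) * (l ^ |γ| * wfac γ (t / l) y y) :=
        mul_le_mul_of_nonneg_left h2 h4.le
    _ ≤ t ^ (-((n + 2 * γ) / 2)) * (l ^ |γ| * wfac γ (t / l) y y) * l ^ ((n + 2 * γ) / 2) :=
        le_mul_of_one_le_right (mul_nonneg h4.le (h3.le.trans h2)) h1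
    _ = _ := by ring

lemma measurableSet_ballDist_lt (x : Fin n → ℝ) (r : ℝ) : MeasurableSet {y | ballDist n x y < r} :=
  (isOpen_lt (continuous_ballDist_right x) continuous_const).measurableSet

lemma ballVol_mono [IsFiniteMeasure (ballMeasure n γ)] (x : Fin n → ℝ) {r s : ℝ} (h : r ≤ s) :
    ballVol n γ x r ≤ ballVol n γ x s :=
  measureReal_mono fun _ hy => lt_of_lt_of_le hy h

lemma ballVol_le [IsFiniteMeasure (ballMeasure n γ)] (x : Fin n → ℝ) (r : ℝ) :
    ballVol n γ x r ≤ (ballMeasure n γ).real Set.univ :=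
  measureReal_mono (Set.subset_univ _)

/-- Integrating a lower bound on a ball. -/
lemma mul_ballVol_le [IsFiniteMeasure (ballMeasure n γ)] {f : (Fin n → ℝ) → ℝ}
    (hf : ContinuousOn f (cBall n)) (h0 : ∀ z ∈ cBall n, 0 ≤ f z) {c r : ℝ}
    (h : ∀ z ∈ cBall n, ballDist n x z < r → c ≤ f z) :
    c * ballVol n γ x r ≤ ∫ z, f z ∂ballMeasure n γ := by
  have h1 : ∫ z, Set.indicator {z | ballDist n x z < r} (fun _ => c) z ∂ballMeasure n γ
      = c * ballVol n γ x r := by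
    rw [integral_indicator_const _ (measurableSet_ballDist_lt x r), smul_eq_mul, mul_comm]
    rfl
  rw [← h1]
  refine integral_mono_ae ((integrable_const c).indicator (measurableSet_ballDist_lt x r))
    (integrable_of_continuousOn hf) ?_
  filter_upwards [ae_mem_cBall n γ] with z hz
  by_cases hzr : ballDist n x z < r
  · rw [Set.indicator_of_mem (by exact hzr)]
    exact h z hz hzr
  · rw [Set.indicator_of_notMem (by exact hzr)]
    exact h0 z hz

/-- Integrating an upper bound by a constant on a ball and by another function elsewhere. -/
lemma le_mul_ballVol_add [IsFiniteMeasure (ballMeasure n γ)] {f g : (Fin n → ℝ) → ℝ}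
    (hf : ContinuousOn f (cBall n)) (hg : ContinuousOn g (cBall n)) (h0 : ∀ z ∈ cBall n, 0 ≤ g z)
    {c r : ℝ}
    (h : ∀ z ∈ cBall n, ballDist n x z < r → f z ≤ c)
    (h' : ∀ z ∈ cBall n, r ≤ ballDist n x z → f z ≤ g z) :
    ∫ z, f z ∂ballMeasure n γ ≤ c * ballVol n γ x r + ∫ z, g z ∂ballMeasure n γ := by
  have h1 : ∫ z, Set.indicator {z | ballDist n x z < r} (fun _ => c) z ∂ballMeasure n γ
      = c * ballVol n γ x r := by
    rw [integral_indicator_const _ (measurableSet_ballDist_lt x r), smul_eq_mul, mul_comm]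
    rfl
  have hi := (integrable_const (μ := ballMeasure n γ) c).indicator (measurableSet_ballDist_lt x r)
  rw [← h1, ← integral_add hi (integrable_of_continuousOn hg)]
  refine integral_mono_ae (integrable_of_continuousOn hf)
    (hi.add (integrable_of_continuousOn hg)) ?_
  filter_upwards [ae_mem_cBall n γ] with z hz
  by_cases hzr : ballDist n x z < r
  · rw [Set.indicator_of_mem (by exact hzr)]
    linarith [h z hz hzr, h0 z hz]
  · rw [Set.indicator_of_notMem (by exact hzr)]
    linarith [h' z hz (not_lt.1 hzr)]

end

section
variable {n : ℕ} {γ : ℝ} {x y : Fin n → ℝ}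

lemma ballDist_lt_sqrt {r : ℝ} (h : ballDist n x y < √r) : ballDist n x y ^ 2 < r :=
  (Real.lt_sqrt (ballDist_nonneg x y)).1 h

lemma ballVol_nonneg (x : Fin n → ℝ) (r : ℝ) : 0 ≤ ballVol n γ x r := ENNReal.toReal_nonneg

lemma gau_le_gau_two_mul (γ a : ℝ) {t m : ℝ} (ht : 0 < t) (h : m * t ≤ 1 - bk x y) :
    gau γ 2 a t x y ≤ 2 ^ a * 2 ^ |γ| * Real.exp (-(m / 4)) * gau γ 2 a (2 * t) x y := by
  have h1 := (wfac_scale γ (by positivity : 0 < 2 * t) one_le_two x y).1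
  rw [mul_div_cancel_left₀ _ two_ne_zero] at h1
  have h2 : t ^ (-a) = 2 ^ a * (2 * t) ^ (-a) := by
    rw [Real.mul_rpow two_pos.le ht.le, ← mul_assoc, ← Real.rpow_add two_pos, add_neg_cancel,
      Real.rpow_zero, one_mul]
  have h3 : Real.exp (-((1 - bk x y) / (2 * t))) ≤
      Real.exp (-(m / 4)) * Real.exp (-((1 - bk x y) / (2 * (2 * t)))) := by
    rw [← Real.exp_add, Real.exp_le_exp]
    have e : (1 - bk x y) / (2 * t) = 2 * ((1 - bk x y) / (2 * (2 * t))) := by field_simp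
    have : m / 4 ≤ (1 - bk x y) / (2 * (2 * t)) := by
      rw [le_div_iff₀ (by positivity)]; linarith
    linarith
  rw [gau, gau, h2]
  have := wfac_pos γ ht x y
  calc _ ≤ 2 ^ a * (2 * t) ^ (-a) *
        (Real.exp (-(m / 4)) * Real.exp (-((1 - bk x y) / (2 * (2 * t))))) *
        (2 ^ |γ| * wfac γ (2 * t) x y) := by gcongr
    _ = _ := by ring

namespace Barrier
variable (B : Barrier n γ)

lemma dg_le_k {t : ℝ} (ht : 0 < t) (ht1 : t ≤ B.t₁) (hx : x ∈ cBall n) (hy : y ∈ cBall n)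
    (h : 1 - bk x y ≤ t) : dg γ t y ≤ 4 ^ |γ| * B.C * B.k t x y := by
  have h1 := (wfac_comparable γ ht zero_le_one hx hy (by linarith)).2
  rw [show (2 + 2 * 1 : ℝ) = 4 by norm_num] at h1
  have h2 := B.le_v x hx y hy t ht ht1 h
  have h3 : B.C * B.v t x y ≤ B.C * B.k t x y :=
    mul_le_mul_of_nonneg_left (le_max_left _ _) B.C_pos.le
  have h4 : 0 < t ^ (-((n + 2 * γ) / 2)) := Real.rpow_pos_of_pos ht _
  calc dg γ t y ≤ t ^ (-((n + 2 * γ) / 2)) * (4 ^ |γ| * wfac γ t x y) :=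
        mul_le_mul_of_nonneg_left h1 h4.le
    _ = 4 ^ |γ| * (t ^ (-((n + 2 * γ) / 2)) * wfac γ t x y) := by ring
    _ ≤ 4 ^ |γ| * (B.C * B.k t x y) := by
        exact mul_le_mul_of_nonneg_left (h2.trans h3) (by positivity)
    _ = _ := by ring

variable {ι : Type} (E : EigSys n γ ι) [IsFiniteMeasure (ballMeasure n γ)]

include E in
lemma exists_dg_mul_ballVol_le (hγ : -(1 / 2 : ℝ) < γ) : ∃ K > 0, ∀ t, 0 < t → t ≤ B.t₁ →
    ∀ y ∈ cBall n, dg γ t y * ballVol n γ y √t ≤ K := by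
  obtain ⟨A, hA, h⟩ := B.exists_mass_k_le E hγ
  have hC := B.C_pos
  refine ⟨4 ^ |γ| * B.C * A, by positivity, fun t ht ht1 y hy => ?_⟩
  have h1 : dg γ t y * ballVol n γ y √t ≤ ∫ z, 4 ^ |γ| * B.C * B.k t z y ∂ballMeasure n γ := by
    refine mul_ballVol_le (continuousOn_const.mul (B.continuousOn_k hy ht))
      (fun z _ => mul_nonneg (by positivity) (B.k_nonneg t z y)) fun z hz hzr => ?_
    refine B.dg_le_k ht ht1 hz hy ?_
    rw [bk_comm]
    linarith [one_sub_bk_le hy hz, ballDist_lt_sqrt hzr]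
  rw [integral_const_mul] at h1
  refine h1.trans ?_
  gcongr
  exact h t ht (ht1.trans B.ht₁') y hy

include E in
lemma exists_le_dg_mul_ballVol_scaled (hγ : -(1 / 2 : ℝ) < γ) : ∃ l ≥ 1, ∃ c > 0, ∀ t, 0 < t →
    t ≤ B.t₁ / 2 → ∀ y ∈ cBall n, c ≤ dg γ t y * ballVol n γ y √(l * t) := by
  obtain ⟨A, hA, hU⟩ := B.exists_mass_U_le E hγ
  obtain ⟨c, hc, hk⟩ := B.exists_le_mass_k E hγ
  have hC := B.C_pos
  set a := ((n : ℝ) + 2 * γ) / 2 with ha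
  set K := B.C * (2 ^ a * 2 ^ |γ|) * B.C with hK
  have hK0 : 0 < K := by positivity
  have hlim : Tendsto (fun l : ℝ => K * A * Real.exp (-((2 / π ^ 2) * l / 4))) atTop (𝓝 0) := by
    rw [← mul_zero (K * A)]
    refine (Real.tendsto_exp_neg_atTop_nhds_zero.comp ?_).const_mul _
    exact (tendsto_id.const_mul_atTop (by positivity : 0 < 2 / π ^ 2)).atTop_div_const
      (by norm_num)
  obtain ⟨l, h1, hl⟩ := ((hlim.eventually_lt_const (half_pos hc)).and
    (eventually_ge_atTop 1)).exists
  have hl0 : 0 < l := by linarith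
  set D := B.C * (2 + 2 * l) ^ |γ| with hD
  have hD0 : 0 < D := by positivity
  refine ⟨l, hl, c / 2 / D, by positivity, fun t ht ht1 y hy => ?_⟩
  have ht0 := B.ht₁
  have ht1' := B.ht₁'
  have key : ∫ z, B.k t z y ∂ballMeasure n γ ≤ D * dg γ t y * ballVol n γ y √(l * t) +
      ∫ z, K * Real.exp (-((2 / π ^ 2) * l / 4)) * B.U (2 * t) z y ∂ballMeasure n γ := by
    refine le_mul_ballVol_add (B.continuousOn_k hy ht)
      (continuousOn_const.mul (B.continuousOn_U hy (by positivity)))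
      (fun z _ => (mul_pos (by positivity) (B.U_pos _ _ _)).le) (fun z hz hzr => ?_)
      fun z hz hzr => ?_
    · have h2 : 1 - bk z y ≤ l * t := by
        rw [bk_comm]
        have : 0 < l * t := by positivity
        linarith [one_sub_bk_le hy hz, ballDist_lt_sqrt hzr]
      have h3 := (wfac_comparable γ ht hl0.le hz hy h2).1
      have h4 : Real.exp (-((1 - bk z y) / (2 * t))) ≤ 1 := by
        rw [Real.exp_le_one_iff, neg_nonpos]
        exact div_nonneg (sub_nonneg.2 (bk_le_one hz hy)) (by positivity)
      have h5 : 0 < t ^ (-a) := Real.rpow_pos_of_pos ht _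
      have h6 := wfac_pos γ ht z y
      calc B.k t z y ≤ B.C * gau γ 2 a t z y := B.k_le_gau hz hy ht (by linarith)
        _ ≤ B.C * (t ^ (-a) * 1 * ((2 + 2 * l) ^ |γ| * wfac γ t y y)) := by
          rw [gau]; gcongr
        _ = _ := by rw [dg, hD]; ring
    · have h2 : 2 / π ^ 2 * l * t ≤ 1 - bk z y := by
        rw [bk_comm]
        refine le_trans ?_ (le_one_sub_bk hy hz)
        rw [mul_assoc]
        have := (Real.sqrt_le_left (ballDist_nonneg y z)).1 hzr
        gcongr
      have h3 := gau_le_gau_two_mul γ a ht h2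
      have h4 := B.le_U z hz y hy (2 * t) (by positivity)
      calc B.k t z y ≤ B.C * gau γ 2 a t z y := B.k_le_gau hz hy ht (by linarith)
        _ ≤ B.C * (2 ^ a * 2 ^ |γ| * Real.exp (-(2 / π ^ 2 * l / 4)) *
            gau γ 2 a (2 * t) z y) := by gcongr
        _ ≤ B.C * (2 ^ a * 2 ^ |γ| * Real.exp (-(2 / π ^ 2 * l / 4)) *
            (B.C * B.U (2 * t) z y)) := by gcongr
        _ = K * Real.exp (-((2 / π ^ 2) * l / 4)) * B.U (2 * t) z y := by rw [hK]; ring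
  rw [integral_const_mul] at key
  have h2 := hk t ht (by linarith) y hy
  have h3 : K * Real.exp (-((2 / π ^ 2) * l / 4)) * ∫ z, B.U (2 * t) z y ∂ballMeasure n γ ≤
      K * Real.exp (-((2 / π ^ 2) * l / 4)) * A := by
    gcongr
    exact hU (2 * t) (by positivity) (by linarith) y hy
  rw [div_le_iff₀ hD0]
  nlinarith

include E in
lemma exists_le_dg_mul_ballVol (hγ : -(1 / 2 : ℝ) < γ) : ∃ c > 0, ∀ t, 0 < t →
    t ≤ B.t₁ / 2 → ∀ y ∈ cBall n, c ≤ dg γ t y * ballVol n γ y √t := by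
  obtain ⟨l, hl, c, hc, h⟩ := B.exists_le_dg_mul_ballVol_scaled E hγ
  have hl0 : 0 < l := by linarith
  refine ⟨c / (l ^ ((n + 2 * γ) / 2) * l ^ |γ|), by positivity, fun t ht ht1 y hy => ?_⟩
  have h1 := h (t / l) (by positivity) ((div_le_self ht.le hl).trans ht1) y hy
  rw [mul_div_cancel₀ _ hl0.ne'] at h1
  have h2 := mul_le_mul_of_nonneg_right (dg_div_le γ ht hl y)
    (ballVol_nonneg (γ := γ) y √t)
  rw [div_le_iff₀ (by positivity)]
  linarith

end Barrier
end

lemma rpow_mul_exp_neg_le (b : ℝ) (hb : 0 ≤ b) {s : ℝ} (hs : 0 ≤ s) :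
    (2 + 2 * s) ^ b * Real.exp (-(s / 4)) ≤ (8 * (b + 1)) ^ b := by
  have h1 : 2 + 2 * s ≤ 8 * (b + 1) * Real.exp (s / (4 * (b + 1))) := by
    have h2 := Real.add_one_le_exp (s / (4 * (b + 1)))
    have h3 : 8 * (b + 1) * (s / (4 * (b + 1)) + 1) = 2 * s + 8 * (b + 1) := by
      field_simp; ring
    have h4 := mul_le_mul_of_nonneg_left h2 (by positivity : 0 ≤ 8 * (b + 1))
    linarith
  have h2 := Real.rpow_le_rpow (by positivity) h1 hb
  rw [Real.mul_rpow (by positivity) (Real.exp_pos _).le, ← Real.exp_mul] at h2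
  have h3 : Real.exp (s / (4 * (b + 1)) * b) ≤ Real.exp (s / 4) := by
    rw [Real.exp_le_exp, div_mul_eq_mul_div, div_le_div_iff₀ (by positivity) (by norm_num)]
    nlinarith
  rw [Real.exp_neg, ← div_eq_mul_inv, div_le_iff₀ (Real.exp_pos _)]
  exact h2.trans (by gcongr)

namespace EigSys

variable {n : ℕ} {γ : ℝ} {ι : Type} {E : EigSys n γ ι} (hE : E.Dominated) [Countable ι]
  [IsFiniteMeasure (ballMeasure n γ)] (B : Barrier n γ)
include hE

include B in
/-- Gaussian upper bound for the heat kernel in terms of its on-diagonal profile. -/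
lemma Dominated.exists_p_le_dg (hγ : -(1 / 2 : ℝ) < γ) : ∃ K > 0, ∀ t, 0 < t → t ≤ 1 →
    ∀ x ∈ cBall n, ∀ y ∈ cBall n,
      E.p t x y ≤ K * Real.exp (-(ballDist n x y) ^ 2 / (2 * π ^ 2 * t)) * dg γ t y := by
  obtain ⟨K, hK, h⟩ := hE.exists_p_le B hγ
  have hC := B.C_pos
  refine ⟨K * B.C * (8 * (|γ| + 1)) ^ |γ|, by positivity, fun t ht ht1 x hx y hy => ?_⟩
  set s := (1 - bk x y) / t with hs
  have hst : 1 - bk x y = s * t := by rw [hs, div_mul_cancel₀ _ ht.ne']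
  have hs0 : 0 ≤ s := div_nonneg (sub_nonneg.2 (bk_le_one hx hy)) ht.le
  have h1 := (wfac_comparable γ ht hs0 hx hy hst.le).1
  have h2 := rpow_mul_exp_neg_le |γ| (abs_nonneg γ) hs0
  have h3 : Real.exp (-(s / 4)) ≤ Real.exp (-(ballDist n x y) ^ 2 / (2 * π ^ 2 * t)) := by
    rw [Real.exp_le_exp, neg_div, neg_le_neg_iff]
    have := le_one_sub_bk hx hy
    have e : ballDist n x y ^ 2 / (2 * π ^ 2 * t) = 2 / π ^ 2 * ballDist n x y ^ 2 / t / 4 := by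
      field_simp; norm_num
    rw [e, hs]
    gcongr
  have h4 : 0 < t ^ (-((n + 2 * γ) / 2)) := Real.rpow_pos_of_pos ht _
  have h5 := wfac_pos γ ht y y
  have h6 : Real.exp (-((1 - bk x y) / (2 * t))) = Real.exp (-(s / 4)) * Real.exp (-(s / 4)) := by
    rw [← Real.exp_add, hs]
    congr 1
    field_simp
    ring
  calc E.p t x y ≤ K * (B.C * gau γ 2 ((n + 2 * γ) / 2) t x y) :=
        (h t ht x hx y hy).trans (by gcongr; exact B.U_le x hx y hy t ht ht1)
    _ ≤ K * (B.C * (t ^ (-((n + 2 * γ) / 2)) * (Real.exp (-(s / 4)) * Real.exp (-(s / 4))) *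
        ((2 + 2 * s) ^ |γ| * wfac γ t y y))) := by
      rw [gau, h6]; gcongr
    _ = K * B.C * ((2 + 2 * s) ^ |γ| * Real.exp (-(s / 4))) * Real.exp (-(s / 4)) * dg γ t y := by
      rw [dg]; ring
    _ ≤ _ := by
      have := dg_pos γ ht y
      gcongr

lemma Dominated.exists_dg_le_p (hγ : -(1 / 2 : ℝ) < γ) : ∃ c > 0, ∀ t, 0 < t → t < B.t₁ →
    ∀ x ∈ cBall n, ∀ y ∈ cBall n, 1 - bk x y ≤ t → c * dg γ t y ≤ E.p t x y := by
  obtain ⟨K, hK, h⟩ := hE.exists_v_le B hγ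
  have hC := B.C_pos
  refine ⟨1 / (4 ^ |γ| * B.C * K), by positivity, fun t ht ht1 x hx y hy hxy => ?_⟩
  have h1 := B.dg_le_k ht ht1.le hx hy hxy
  have h2 : B.k t x y ≤ K * E.p t x y :=
    max_le (h t ht ht1 x hx y hy) (mul_nonneg hK.le (hE.p_nonneg hγ ht hx hy))
  rw [one_div_mul_eq_div, div_le_iff₀ (by positivity)]
  calc _ ≤ _ := h1
    _ ≤ 4 ^ |γ| * B.C * (K * E.p t x y) := by gcongr
    _ = _ := by ring

/-- Chaining the near-diagonal lower bound along geodesics. -/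
lemma Dominated.exists_pow_mul_dg_le_p (hγ : -(1 / 2 : ℝ) < γ) : ∃ ε > 0, ε ≤ 1 ∧
    ∀ τ, 0 < τ → τ ≤ B.t₁ / 2 → ∀ N : ℕ, ∀ x ∈ cBall n, ∀ y ∈ cBall n,
      ballDist n x y ≤ (N + 1) * (√τ / 4) →
        ε ^ (N + 1) * dg γ τ y ≤ E.p ((N + 1) * τ) x y := by
  obtain ⟨c, hc, hp⟩ := hE.exists_dg_le_p B hγ
  obtain ⟨v, hv, hV⟩ := B.exists_le_dg_mul_ballVol E hγ
  have ht₁ := B.ht₁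
  set K : ℝ := (4 ^ |γ|) ^ 2 with hK
  set L : ℝ := 16 ^ (((n : ℝ) + 2 * γ) / 2) * 16 ^ |γ| with hL
  have hK0 : 0 < K := by positivity
  have hL0 : 0 < L := by positivity
  set ε := min 1 (min c (c / K * (v / L))) with hε
  have hε0 : 0 < ε := by positivity
  have hεc : ε ≤ c := (min_le_right _ _).trans (min_le_left _ _)
  have hεv : ε ≤ c / K * (v / L) := (min_le_right _ _).trans (min_le_right _ _)
  refine ⟨ε, hε0, min_le_left _ _, fun τ hτ hτ1 N => ?_⟩
  set d := √τ / 4 with hd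
  have hd0 : 0 < d := by positivity
  have hd2 : d ^ 2 = τ / 16 := by rw [hd, div_pow, Real.sq_sqrt hτ.le]; norm_num
  have near : ∀ x ∈ cBall n, ∀ y ∈ cBall n, ballDist n x y ≤ 3 * d → 1 - bk x y ≤ τ := by
    intro x hx y hy h
    have := one_sub_bk_le hx hy
    have := pow_le_pow_left₀ (ballDist_nonneg x y) h 2
    nlinarith
  induction N with
  | zero =>
    intro x hx y hy h
    simp only [Nat.cast_zero, zero_add, one_mul, pow_one] at h ⊢
    refine le_trans ?_ (hp τ hτ (by linarith) x hx y hy (near x hx y hy (by linarith)))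
    have := dg_pos γ hτ y
    gcongr
  | succ N ih =>
    intro x hx y hy h
    push_cast at h ⊢
    have hNd : 0 ≤ (N : ℝ) * d := by positivity
    obtain ⟨m, hm, hxm, hmy⟩ : ∃ m ∈ cBall n, ballDist n x m ≤ N * d ∧ ballDist n m y ≤ 2 * d := by
      rcases le_total (ballDist n x y) (2 * d) with h' | h'
      · exact ⟨x, hx, by rwa [ballDist_self hx], h'⟩
      · obtain ⟨m, hm, h1, h2⟩ := exists_geodesic_point hx hy (by positivity) h'
        exact ⟨m, hm, by linarith, h2.le⟩
    have hNτ : 0 < ((N : ℝ) + 1) * τ := by positivity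
    have hyτ := dg_pos γ hτ y
    have hmτ := dg_pos γ hτ m
    have h1 : ε ^ (N + 1) * (dg γ τ m / K) * (c * dg γ τ y) * ballVol n γ m d ≤
        ∫ z, E.p ((N + 1) * τ) x z * E.p τ z y ∂ballMeasure n γ := by
      have hc2 : ContinuousOn (fun z => E.p τ z y) (cBall n) := by
        simp_rw [fun z => E.p_comm τ z y]
        exact hE.continuousOn_p_right hτ hy
      refine mul_ballVol_le ((hE.continuousOn_p_right hNτ hx).mul hc2)
        (fun z hz => mul_nonneg (hE.p_nonneg hγ hNτ hx hz) (hE.p_nonneg hγ hτ hz hy))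
        fun z hz hmz => ?_
      have hxz := ih x hx z hz (by linarith [ballDist_triangle hx hm hz])
      have hzm : ballDist n z m = ballDist n m z := ballDist_comm _ _
      have hzy := hp τ hτ (by linarith) z hz y hy
        (near z hz y hy (by linarith [ballDist_triangle hz hm hy]))
      have hmz' := dg_le_dg γ hτ zero_le_one hm hz
        (by linarith [near m hm z hz (by linarith)])
      rw [show (2 + 2 * 1 : ℝ) = 4 by norm_num] at hmz'
      have h2 : dg γ τ m / K ≤ dg γ τ z := by rw [div_le_iff₀ hK0]; linarith
      have h3 : ε ^ (N + 1) * (dg γ τ m / K) ≤ E.p ((N + 1) * τ) x z :=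
        le_trans (by gcongr) hxz
      exact mul_le_mul h3 hzy (by positivity) (hE.p_nonneg hγ hNτ hx hz)
    rw [hE.integral_mul_p hNτ hτ hx hy] at h1
    rw [show ((N : ℝ) + 1 + 1) * τ = (N + 1) * τ + τ by ring]
    refine le_trans ?_ h1
    have h2 : v ≤ L * (dg γ τ m * ballVol n γ m d) := by
      have h3 := hV (τ / 16) (by positivity) (by linarith) m hm
      rw [show √(τ / 16) = d by rw [← hd2, Real.sqrt_sq hd0.le]] at h3
      have h4 := mul_le_mul_of_nonneg_right (dg_div_le γ hτ (by norm_num : (1 : ℝ) ≤ 16) m)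
        (ballVol_nonneg (γ := γ) m d)
      rw [← mul_assoc]
      exact h3.trans h4
    have h3 : v / L ≤ dg γ τ m * ballVol n γ m d := by rw [div_le_iff₀ hL0]; linarith
    calc ε ^ (N + 1 + 1) * dg γ τ y = ε ^ (N + 1) * dg γ τ y * ε := by ring
      _ ≤ ε ^ (N + 1) * dg γ τ y * (c / K * (dg γ τ m * ballVol n γ m d)) := by
        refine mul_le_mul_of_nonneg_left (hεv.trans ?_) (by positivity)
        gcongr
      _ = _ := by ring

/-- Gaussian lower bound for the heat kernel in terms of its on-diagonal profile. -/
lemma Dominated.exists_dg_le_p_gaussian (hn : 1 ≤ n) (hγ : -(1 / 2 : ℝ) < γ) :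
    ∃ c > 0, ∃ b > 0, ∀ t, 0 < t → t ≤ B.t₁ / 2 → ∀ x ∈ cBall n, ∀ y ∈ cBall n,
      c * Real.exp (-(ballDist n x y) ^ 2 / (b * t)) * dg γ t y ≤ E.p t x y := by
  obtain ⟨ε, hε, hε1, h⟩ := hE.exists_pow_mul_dg_le_p B hγ
  set β := |γ| + -Real.log ε + 1 with hβ
  have hlog : Real.log ε ≤ 0 := Real.log_nonpos hε.le hε1
  have hβ0 : 0 < β := by have := abs_nonneg γ; linarith
  refine ⟨Real.exp (-(2 * β)), Real.exp_pos _, 1 / (16 * β), by positivity,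
    fun t ht ht1 x hx y hy => ?_⟩
  set q := ballDist n x y ^ 2 / t with hq
  have hq0 : 0 ≤ q := by positivity
  set N := ⌈16 * q⌉₊ with hN
  have hN1 : 16 * q ≤ N := Nat.le_ceil _
  have hN2 : (N : ℝ) < 16 * q + 1 := Nat.ceil_lt_add_one (by positivity)
  have hN0 : (0 : ℝ) < N + 1 := by positivity
  have hτ : 0 < t / (N + 1) := by positivity
  have h1N : (1 : ℝ) ≤ N + 1 := by linarith [Nat.cast_nonneg (α := ℝ) N]
  have hdist : ballDist n x y ≤ (N + 1) * (√(t / (N + 1)) / 4) := by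
    refine (sq_le_sq₀ (ballDist_nonneg x y) (by positivity)).1 ?_
    rw [mul_pow, div_pow, Real.sq_sqrt hτ.le]
    have e : ballDist n x y ^ 2 = q * t := by rw [hq, div_mul_cancel₀ _ ht.ne']
    have e2 : ((N : ℝ) + 1) ^ 2 * (t / (N + 1) / 4 ^ 2) = (N + 1) * t / 16 := by
      field_simp; norm_num
    rw [e, e2]
    nlinarith
  have h1 := h (t / (N + 1)) hτ ((div_le_self ht.le h1N).trans ht1) N x hx y hy hdist
  rw [mul_div_cancel₀ _ hN0.ne'] at h1
  have h2 := dg_le_div hn hγ ht h1N y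
  have h3 : ((N : ℝ) + 1) ^ |γ| ≤ Real.exp ((N + 1) * |γ|) := by
    rw [Real.exp_mul]
    exact Real.rpow_le_rpow hN0.le (by linarith [Real.add_one_le_exp ((N : ℝ) + 1)]) (abs_nonneg _)
  have h4 : ε ^ (N + 1) = Real.exp ((N + 1) * Real.log ε) := by
    rw [mul_comm, Real.exp_mul, Real.exp_log hε]
    exact_mod_cast rfl
  have h5 := dg_pos γ hτ y
  have h6 : Real.exp (-(2 * β)) * Real.exp (-(ballDist n x y) ^ 2 / (1 / (16 * β) * t)) *
      Real.exp ((N + 1) * |γ|) ≤ ε ^ (N + 1) := by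
    rw [h4, ← Real.exp_add, ← Real.exp_add, Real.exp_le_exp]
    have e : -(ballDist n x y) ^ 2 / (1 / (16 * β) * t) = -(16 * q * β) := by
      rw [hq]; field_simp
    rw [e]
    have : ((N : ℝ) + 1) * (|γ| + -Real.log ε) ≤ (16 * q + 2) * β :=
      mul_le_mul (by linarith) (by linarith) (by linarith [abs_nonneg γ]) (by positivity)
    linarith
  calc _ ≤ Real.exp (-(2 * β)) * Real.exp (-(ballDist n x y) ^ 2 / (1 / (16 * β) * t)) *
        (Real.exp ((N + 1) * |γ|) * dg γ (t / (N + 1)) y) := by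
        refine mul_le_mul_of_nonneg_left (h2.trans ?_) (by positivity)
        gcongr
    _ = Real.exp (-(2 * β)) * Real.exp (-(ballDist n x y) ^ 2 / (1 / (16 * β) * t)) *
        Real.exp ((N + 1) * |γ|) * dg γ (t / (N + 1)) y := by ring
    _ ≤ ε ^ (N + 1) * dg γ (t / (N + 1)) y := by gcongr
    _ ≤ _ := h1

end EigSys

namespace EigSys

variable {n : ℕ} {γ : ℝ} {ι : Type} {E : EigSys n γ ι} (hE : E.Dominated) [Countable ι]
  [IsFiniteMeasure (ballMeasure n γ)] (B : Barrier n γ)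
include hE

/-- One-sided Gaussian bounds for small times. -/
lemma Dominated.exists_bounds_of_le (hn : 1 ≤ n) (hγ : -(1 / 2 : ℝ) < γ) :
    ∃ c₁ > 0, ∃ c₂ > 0, ∃ c₃ > 0, ∃ c₄ > 0, ∀ t, 0 < t → t ≤ B.t₁ / 2 →
      ∀ x ∈ cBall n, ∀ y ∈ cBall n,
        c₁ * Real.exp (-(ballDist n x y) ^ 2 / (c₂ * t)) ≤ E.p t x y * ballVol n γ y √t ∧
        E.p t x y * ballVol n γ y √t ≤ c₃ * Real.exp (-(ballDist n x y) ^ 2 / (c₄ * t)) := by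
  obtain ⟨K, hK, hup⟩ := hE.exists_p_le_dg B hγ
  obtain ⟨c, hc, b, hb, hlow⟩ := hE.exists_dg_le_p_gaussian B hn hγ
  obtain ⟨v, hv, hv'⟩ := B.exists_le_dg_mul_ballVol E hγ
  obtain ⟨V, hV, hV'⟩ := B.exists_dg_mul_ballVol_le E hγ
  have ht₁ := B.ht₁
  have ht₁' := B.ht₁'
  refine ⟨c * v, by positivity, b, hb, K * V, by positivity, 2 * π ^ 2, by positivity,
    fun t ht ht1 x hx y hy => ?_⟩
  have hy0 := ballVol_nonneg (γ := γ) y √t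
  constructor
  · calc _ = c * Real.exp (-(ballDist n x y) ^ 2 / (b * t)) * v := by ring
      _ ≤ c * Real.exp (-(ballDist n x y) ^ 2 / (b * t)) * (dg γ t y * ballVol n γ y √t) := by
        gcongr; exact hv' t ht ht1 y hy
      _ = c * Real.exp (-(ballDist n x y) ^ 2 / (b * t)) * dg γ t y * ballVol n γ y √t := by ring
      _ ≤ _ := by gcongr; exact hlow t ht ht1 x hx y hy
  · calc _ ≤ K * Real.exp (-(ballDist n x y) ^ 2 / (2 * π ^ 2 * t)) * dg γ t y *
          ballVol n γ y √t := by gcongr; exact hup t ht (by linarith) x hx y hy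
      _ = K * Real.exp (-(ballDist n x y) ^ 2 / (2 * π ^ 2 * t)) *
          (dg γ t y * ballVol n γ y √t) := by ring
      _ ≤ K * Real.exp (-(ballDist n x y) ^ 2 / (2 * π ^ 2 * t)) * V := by
        gcongr; exact hV' t ht (by linarith) y hy
      _ = _ := by ring

lemma Dominated.p_mem_Icc (hγ : -(1 / 2 : ℝ) < γ) {s a b : ℝ} (hs : 0 < s)
    (h : ∀ x ∈ cBall n, ∀ y ∈ cBall n, E.p s x y ∈ Set.Icc a b) {t : ℝ} (hst : s < t)
    {x y : Fin n → ℝ} (hx : x ∈ cBall n) (hy : y ∈ cBall n) : E.p t x y ∈ Set.Icc a b := by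
  have hr : 0 < t - s := sub_pos.2 hst
  have h1 := hE.integral_mul_p hr hs hx hy
  rw [sub_add_cancel] at h1
  have hc1 := hE.continuousOn_p_right hr hx
  have hc2 : ContinuousOn (fun z => E.p s z y) (cBall n) := by
    simp_rw [fun z => E.p_comm s z y]
    exact hE.continuousOn_p_right hs hy
  have h2 : ∀ q : ℝ, ∫ z, E.p (t - s) x z * q ∂ballMeasure n γ = q := fun q => by
    rw [integral_mul_const, hE.integral_p hr hx, one_mul]
  constructor
  · rw [← h1, ← h2 a]
    exact bint_mono (hc1.mul continuousOn_const) (hc1.mul hc2) fun z hz =>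
      mul_le_mul_of_nonneg_left (h z hz y hy).1 (hE.p_nonneg hγ hr hx hz)
  · rw [← h1]
    refine le_trans ?_ (h2 b).le
    exact bint_mono (hc1.mul hc2) (hc1.mul continuousOn_const) fun z hz =>
      mul_le_mul_of_nonneg_left (h z hz y hy).2 (hE.p_nonneg hγ hr hx hz)

include B in
/-- One-sided Gaussian bounds for all times. -/
lemma Dominated.exists_bounds (hn : 1 ≤ n) (hγ : -(1 / 2 : ℝ) < γ) :
    ∃ c₁ > 0, ∃ c₂ > 0, ∃ c₃ > 0, ∃ c₄ > 0, ∀ t, 0 < t →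
      ∀ x ∈ cBall n, ∀ y ∈ cBall n,
        c₁ * Real.exp (-(ballDist n x y) ^ 2 / (c₂ * t)) ≤ E.p t x y * ballVol n γ y √t ∧
        E.p t x y * ballVol n γ y √t ≤ c₃ * Real.exp (-(ballDist n x y) ^ 2 / (c₄ * t)) := by
  obtain ⟨c₁, hc₁, c₂, hc₂, c₃, hc₃, c₄, hc₄, h⟩ := hE.exists_bounds_of_le B hn hγ
  obtain ⟨v, hv, hv'⟩ := B.exists_le_dg_mul_ballVol E hγ
  have ht₁ := B.ht₁
  set T := B.t₁ / 2 with hT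
  have hT0 : 0 < T := by positivity
  set s := T / 2 with hs
  have hs0 : 0 < s := by positivity
  have hsT : s < T := half_lt_self hT0
  set D := s ^ (-((n + 2 * γ) / 2)) * (1 + 1 / s) ^ |γ| with hD
  have hD0 : 0 < D := by positivity
  set W := (ballMeasure n γ).real Set.univ + 1 with hW
  have hW0 : 0 < W := by positivity
  have hW1 : ∀ y r, ballVol n γ y r ≤ W := fun y r => (ballVol_le y r).trans (by linarith)
  have hw0 : ∀ y ∈ cBall n, v / D ≤ ballVol n γ y √s := fun y hy => by
    rw [div_le_iff₀ hD0]
    refine (hv' s hs0 hsT.le y hy).trans ?_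
    rw [mul_comm]
    have := ballVol_nonneg (γ := γ) y √s
    have := wfac_le γ hs0 y y
    rw [dg, hD]
    gcongr
  set w := v / D with hw
  have hwpos : 0 < w := by positivity
  have hexp : ∀ c t : ℝ, 0 < c → s ≤ t → ∀ x y : Fin n → ℝ,
      Real.exp (-(π ^ 2 / (c * s))) ≤ Real.exp (-(ballDist n x y) ^ 2 / (c * t)) ∧
      Real.exp (-(ballDist n x y) ^ 2 / (c * t)) ≤ 1 := fun c t hc hst x y => by
    have ht : 0 < t := hs0.trans_le hst
    rw [neg_div, Real.exp_le_exp, Real.exp_le_one_iff, neg_le_neg_iff, neg_nonpos]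
    refine ⟨?_, by positivity⟩
    have := pow_le_pow_left₀ (ballDist_nonneg x y) (ballDist_le_pi x y) 2
    gcongr
  set e₂ := Real.exp (-(π ^ 2 / (c₂ * s))) with he₂
  set e₄ := Real.exp (-(π ^ 2 / (c₄ * s))) with he₄
  have he₂0 : 0 < e₂ := Real.exp_pos _
  have he₄0 : 0 < e₄ := Real.exp_pos _
  have hmem : ∀ x ∈ cBall n, ∀ y ∈ cBall n, E.p s x y ∈ Set.Icc (c₁ * e₂ / W) (c₃ / w) := by
    intro x hx y hy
    obtain ⟨h1, h2⟩ := h s hs0 hsT.le x hx y hy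
    have hp := hE.p_nonneg hγ hs0 hx hy
    refine ⟨(div_le_iff₀ hW0).2 ?_, (le_div_iff₀ hwpos).2 ?_⟩
    · calc c₁ * e₂ ≤ c₁ * Real.exp (-(ballDist n x y) ^ 2 / (c₂ * s)) := by
            gcongr; exact (hexp c₂ s hc₂ le_rfl x y).1
        _ ≤ _ := h1
        _ ≤ _ := by gcongr; exact hW1 y _
    · calc E.p s x y * w ≤ E.p s x y * ballVol n γ y √s := by gcongr; exact hw0 y hy
        _ ≤ _ := h2
        _ ≤ c₃ * 1 := by gcongr; exact (hexp c₄ s hc₄ le_rfl x y).2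
        _ = c₃ := mul_one _
  refine ⟨min c₁ (c₁ * e₂ / W * w), by positivity, c₂, hc₂, max c₃ (c₃ / w * W / e₄),
    by positivity, c₄, hc₄, fun t ht x hx y hy => ?_⟩
  rcases le_or_gt t T with htT | htT
  · obtain ⟨h1, h2⟩ := h t ht htT x hx y hy
    exact ⟨le_trans (by gcongr; exact min_le_left _ _) h1,
      h2.trans (by gcongr; exact le_max_left _ _)⟩
  · have hst : s < t := hsT.trans htT
    obtain ⟨h1, h2⟩ := hE.p_mem_Icc hγ hs0 hmem hst hx hy
    have hwt : w ≤ ballVol n γ y √t :=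
      (hw0 y hy).trans (ballVol_mono y (Real.sqrt_le_sqrt hst.le))
    have hp := hE.p_nonneg hγ ht hx hy
    constructor
    · calc _ ≤ c₁ * e₂ / W * w * 1 := by
            gcongr
            · exact min_le_right _ _
            · exact (hexp c₂ t hc₂ hst.le x y).2
        _ ≤ E.p t x y * ballVol n γ y √t := by rw [mul_one]; gcongr
    · calc _ ≤ c₃ / w * W := mul_le_mul h2 (hW1 y _) (ballVol_nonneg y _) (by positivity)
        _ = c₃ / w * W / e₄ * e₄ := by rw [div_mul_cancel₀ _ he₄0.ne']
        _ ≤ _ := by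
          gcongr
          · exact le_max_right _ _
          · exact (hexp c₄ t hc₄ hst.le x y).1

end EigSys

lemma le_mul_sqrt_mul {a p u v : ℝ} (ha : 0 ≤ a) (hp : 0 ≤ p) (hu : a ≤ p * u) (hv : a ≤ p * v) :
    a ≤ p * √(u * v) := by
  rw [← Real.sqrt_sq hp, ← Real.sqrt_mul (sq_nonneg p)]
  refine Real.le_sqrt_of_sq_le ?_
  calc a ^ 2 = a * a := sq a
    _ ≤ p * u * (p * v) := mul_le_mul hu hv ha (ha.trans hu)
    _ = _ := by ring

lemma mul_sqrt_mul_le {a p u v : ℝ} (hp : 0 ≤ p) (hv0 : 0 ≤ v) (hu : p * u ≤ a)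
    (hv : p * v ≤ a) (ha : 0 ≤ a) : p * √(u * v) ≤ a := by
  rw [← Real.sqrt_sq hp, ← Real.sqrt_mul (sq_nonneg p)]
  refine Real.sqrt_le_iff.2 ⟨ha, ?_⟩
  calc p ^ 2 * (u * v) = p * u * (p * v) := by ring
    _ ≤ a * a := mul_le_mul hu hv (by positivity) ha
    _ = a ^ 2 := (sq a).symm

end

/-- Two-sided Gaussian bounds for the heat kernel on the unit ball. -/
theorem stmt0 (n : ℕ) (hn : 1 ≤ n) (γ : ℝ) (hγ : -(1 / 2 : ℝ) < γ)
    (P : (k : ℕ) → Fin (ballNk n k) → MvPolynomial (Fin n) ℝ)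
    (hdeg : ∀ k j, (P k j).totalDegree ≤ k)
    (horth : ∀ (k : ℕ) (j : Fin (ballNk n k)) (k' : ℕ) (j' : Fin (ballNk n k')),
      ∫ x, eval x (P k j) * eval x (P k' j') ∂(ballMeasure n γ)
        = if (⟨k, j⟩ : Σ k, Fin (ballNk n k)) = ⟨k', j'⟩ then 1 else 0)
    (hspan : ∀ m : ℕ, ∀ Q : MvPolynomial (Fin n) ℝ, Q.totalDegree ≤ m →
      Q ∈ Submodule.span ℝ {R | ∃ k ≤ m, ∃ j, R = P k j})
    (heig : ∀ (k : ℕ) (j : Fin (ballNk n k)), ∀ x : Fin n → ℝ, (∑ i, (x i) ^ 2) < 1 →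
      eval x (ballOp n γ (P k j)) = -(ballEig n γ k) * eval x (P k j)) :
    ∃ c₁ > (0 : ℝ), ∃ c₂ > (0 : ℝ), ∃ c₃ > (0 : ℝ), ∃ c₄ > (0 : ℝ),
      ∀ x : Fin n → ℝ, (∑ i, (x i) ^ 2) ≤ 1 →
      ∀ y : Fin n → ℝ, (∑ i, (y i) ^ 2) ≤ 1 →
      ∀ t : ℝ, 0 < t →
        c₁ * Real.exp (-(ballDist n x y) ^ 2 / (c₂ * t)) /
            Real.sqrt (ballVol n γ x (Real.sqrt t) * ballVol n γ y (Real.sqrt t))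
          ≤ ballHeat n γ P t x y ∧
        ballHeat n γ P t x y ≤
          c₃ * Real.exp (-(ballDist n x y) ^ 2 / (c₄ * t)) /
            Real.sqrt (ballVol n γ x (Real.sqrt t) * ballVol n γ y (Real.sqrt t)) := by
  have hN : 0 < ballNk n 0 := by simp [ballNk]
  have : IsFiniteMeasure (ballMeasure n γ) :=
    isFiniteMeasure_ballMeasure hdeg ⟨⟨0, hN⟩, by simpa using horth 0 ⟨0, hN⟩ 0 ⟨0, hN⟩⟩
  obtain ⟨E, hφ, hΛ⟩ := exists_eigSys hn hγ hdeg horth hspan heig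
  obtain ⟨B⟩ := nonempty_barrier n hγ
  have hE := E.dominated B hγ
  obtain ⟨c₁, hc₁, c₂, hc₂, c₃, hc₃, c₄, hc₄, h⟩ := hE.exists_bounds B hn hγ
  refine ⟨c₁, hc₁, c₂, hc₂, c₃, hc₃, c₄, hc₄, fun x hx y hy t ht => ?_⟩
  have hx' : x ∈ cBall n := mem_cBall.2 hx
  have hy' : y ∈ cBall n := mem_cBall.2 hy
  obtain ⟨hl, hu⟩ := h t ht x hx' y hy'
  obtain ⟨hl', hu'⟩ := h t ht y hy' x hx'
  rw [E.p_comm, ballDist_comm] at hl' hu'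
  rw [ballHeat_eq E hE hφ hΛ ht hx' hy']
  have hp := hE.p_nonneg hγ ht hx' hy'
  have hVy := ballVol_nonneg (γ := γ) y √t
  have hlow := le_mul_sqrt_mul (by positivity) hp hl' hl
  have hup := mul_sqrt_mul_le hp hVy hu' hu (by positivity)
  have hpos : 0 < √(ballVol n γ x √t * ballVol n γ y √t) := by
    refine (Real.sqrt_nonneg _).lt_of_ne' fun h0 => ?_
    rw [h0, mul_zero] at hlow
    exact absurd hlow (not_le.2 (by positivity))
  exact ⟨(div_le_iff₀ hpos).2 hlow, (le_div_iff₀ hpos).2 hup⟩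

end
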